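/- Assume K = 0. Then for every i ∈ {1,…,N} and every nonzero v_0 ∈ sing M[m] there exist vectors v_1,…,v_{m_i+N−i} ∈ sing M[m] such that the polynomial function v_0 u^{m_i+N−i} + v_1 u^{m_i+N−i−1} + … + v_{m_i+N−i} is annihilated by D_{K=0,M}(u,∂) restricted to sing M[m]-valued functions. Moreover, the ℂ-span of all such polynomial solutions is the whole kernel: every holomorphic solution of D_{K=0,M}(u,∂) f = 0 on a simply connected open subset of ℂ∖{z_1,…,z_n} with values in sing M[m] is a ℂ-linear combination of restrictions of such polynomials. -/

import Mathlib

noncomputable section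

namespace GaudinModel

/-- A vector-valued quasi-exponential: a finite sum of functions `e^{λu} p(u)` with `p` a
vector-valued polynomial. -/
def IsQE {M : Type*} [AddCommGroup M] [Module ℂ M] (f : ℂ → M) : Prop :=
  ∃ (k d : ℕ) (lam : Fin k → ℂ) (v : Fin k → Fin d → M),
    ∀ u : ℂ, f u = ∑ i : Fin k, ∑ j : Fin d,
      (Complex.exp (lam i * u) * u ^ (j : ℕ)) • v i j

variable {N n : ℕ}

/-- Points away from the singular points `z_1, …, z_n`. -/
def GoodG {n : ℕ} (z : Fin n → ℂ) (u : ℂ) : Prop := ∀ j : Fin n, u ≠ z j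

section Setup

variable (V : Fin n → Type*) [∀ i, AddCommGroup (V i)] [∀ i, Module ℂ (V i)]
  (M : Type*) [NormedAddCommGroup M] [NormedSpace ℂ M]
  (E : ∀ i : Fin n, Fin N → Fin N → (V i →ₗ[ℂ] V i))
  (φ : M ≃ₗ[ℂ] PiTensorProduct ℂ V)

/-- The commutation relations of `gl_N`: `[e_{ab}, e_{cd}] = δ_{bc} e_{ad} − δ_{da} e_{cb}`,
for the operators `E i a b` (the action of `e_{ab}` on the `i`-th factor `V i`). -/
def GlRel : Prop :=
  ∀ (i : Fin n) (a b c d : Fin N),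
    E i a b ∘ₗ E i c d - E i c d ∘ₗ E i a b =
      (if b = c then (1 : ℂ) else 0) • E i a d - (if d = a then (1 : ℂ) else 0) • E i c b

/-- Each `V i` is the irreducible finite-dimensional `gl_N`-module with highest weight
`Λ i`: it is generated by a nonzero vector `v` with `e_{ab} v = 0` for `a < b` and
`e_{aa} v = Λ_a v`. -/
def IsHW (Λ : Fin n → Fin N → ℤ) : Prop :=
  ∀ i : Fin n, ∃ v : V i, v ≠ 0 ∧
    (∀ a b : Fin N, a < b → E i a b v = 0) ∧
    (∀ a : Fin N, E i a a v = (Λ i a : ℂ) • v) ∧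
    ∀ W : Submodule ℂ (V i), (∀ a b : Fin N, ∀ x ∈ W, E i a b x ∈ W) → v ∈ W →
      ∀ x : V i, x ∈ W

/-- `e_{ab}` acting in the `j`-th tensor factor of `M ≃ V 1 ⊗ ⋯ ⊗ V n`. -/
def EE (j : Fin n) (a b : Fin N) : Module.End ℂ M :=
  φ.symm.toLinearMap ∘ₗ
    (PiTensorProduct.map
      (Function.update (fun i : Fin n => (LinearMap.id : V i →ₗ[ℂ] V i)) j (E j a b))) ∘ₗ
    φ.toLinearMap

variable (z : Fin n → ℂ) (K : Matrix (Fin N) (Fin N) ℂ)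

/-- `X_{ab}(u,∂) = δ_{ab} ∂ − K_{ab} − ∑_j e_{ba}^{(j)}/(u − z_j)`,
acting on `M`-valued functions. -/
def Xg (a b : Fin N) (f : ℂ → M) : ℂ → M :=
  fun u => (if a = b then deriv f u else 0) - K a b • f u
    - ∑ j : Fin n, (u - z j)⁻¹ • (EE V M E φ j b a) (f u)

/-- The universal differential operator
`D_{K,M}(u,∂) = ∑_{σ ∈ S_N} sgn(σ) X_{1σ(1)}(u,∂) ⋯ X_{Nσ(N)}(u,∂)`. -/
def Dg (f : ℂ → M) : ℂ → M :=
  fun u => ∑ σ : Equiv.Perm (Fin N),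
    ((Equiv.Perm.sign σ : ℤˣ) : ℤ) •
      (((List.ofFn fun a : Fin N => Xg V M E φ z K a (σ a)).foldr (· ∘ ·) id) f u)

/-- The weight subspace `M[m]`. -/
def Wt (m : Fin N → ℤ) : Submodule ℂ M :=
  ⨅ a : Fin N, LinearMap.ker
    ((∑ j : Fin n, EE V M E φ j a a) - (m a : ℂ) • (1 : Module.End ℂ M))

/-- The subspace `sing M[m]` of `gl_N`-singular vectors of weight `m`. -/
def SingWt (m : Fin N → ℤ) : Submodule ℂ M :=
  Wt V M E φ m ⊓ ⨅ a : Fin N, ⨅ b : Fin N, ⨅ _ : a < b,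
    LinearMap.ker (∑ j : Fin n, EE V M E φ j a b)

end Setup

end GaudinModel

namespace GaudinAux

section AbstractLists
variable {A : Type*} [Ring A] {ι : Type*} [DecidableEq ι]

/-- An element occurring in a list of anticommuting square-zero elements kills the product. -/
lemma mul_prod_eq_zero (x : ι → A) (hx : ∀ a b, x a * x b = -(x b * x a)) (hs : ∀ a, x a * x a = 0)
    (a : ι) : ∀ l : List ι, a ∈ l → x a * (l.map x).prod = 0 := by
  intro l
  induction l with
  | nil => intro h; simp at h
  | cons b l ih =>
    intro h
    rw [List.map_cons, List.prod_cons, ← mul_assoc]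
    by_cases hab : a = b
    · subst hab; rw [hs, zero_mul]
    · have : a ∈ l := by
        rcases List.mem_cons.1 h with h | h
        · exact absurd h hab
        · exact h
      rw [hx a b, neg_mul, mul_assoc, ih this, mul_zero, neg_zero]

lemma prod_eq_zero_of_not_nodup (x : ι → A) (hx : ∀ a b, x a * x b = -(x b * x a))
    (hs : ∀ a, x a * x a = 0) : ∀ l : List ι, ¬ l.Nodup → (l.map x).prod = 0 := by
  intro l
  induction l with
  | nil => intro h; simp at h
  | cons b l ih =>
    intro h
    rw [List.map_cons, List.prod_cons]
    by_cases hb : b ∈ l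
    · exact mul_prod_eq_zero x hx hs b l hb
    · have : ¬ l.Nodup := fun hl => h (List.nodup_cons.2 ⟨hb, hl⟩)
      rw [ih this, mul_zero]

/-- Cofactor-like elements. -/
def Zr (x : ι → A) : List ι → ι → A
  | [], _ => 0
  | b :: l, i => (if b = i then (l.map x).prod else 0) - x b * Zr x l i

lemma Zr_eq_zero (x : ι → A) (i : ι) : ∀ l : List ι, i ∉ l → Zr x l i = 0 := by
  intro l
  induction l with
  | nil => intro _; rfl
  | cons b l ih =>
    intro h
    rw [List.mem_cons, not_or] at h
    rw [Zr, ih h.2, if_neg (fun e => h.1 e.symm), mul_zero, sub_zero]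

lemma mul_Zr (x : ι → A) (hx : ∀ a b, x a * x b = -(x b * x a)) (hs : ∀ a, x a * x a = 0)
    (a i : ι) : ∀ l : List ι, l.Nodup → a ∈ l → i ∈ l →
      x a * Zr x l i = if a = i then (l.map x).prod else 0 := by
  intro l
  induction l with
  | nil => intro _ h; simp at h
  | cons b l ih =>
    intro hn ha hi
    rw [List.nodup_cons] at hn
    rw [Zr, mul_sub, ← mul_assoc, hx a b, neg_mul, sub_neg_eq_add, mul_assoc]
    by_cases hb : b = i
    · subst hb
      rw [Zr_eq_zero x b l hn.1, mul_zero, mul_zero, add_zero, if_pos rfl]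
      by_cases hab : a = b
      · subst hab; simp
      · rw [if_neg hab]
        rcases List.mem_cons.1 ha with h | h
        · exact absurd h hab
        · exact mul_prod_eq_zero x hx hs a l h
    · have hil : i ∈ l := by
        rcases List.mem_cons.1 hi with h | h
        · exact absurd h.symm hb
        · exact h
      rw [if_neg hb, mul_zero, zero_add]
      by_cases hab : a = b
      · subst hab
        rw [if_neg hb, ← mul_assoc, hs, zero_mul]
      · have hal : a ∈ l := by
          rcases List.mem_cons.1 ha with h | h
          · exact absurd h hab
          · exact h
        rw [ih hn.2 hal hil]
        split_ifs
        · simp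
        · simp

/-- Extracting one simple pole. -/
lemma prod_sub_pole [Fintype ι] (x k ψ : ι → A) (p : A)
    (hkx : ∀ a b, k a * x b = -(x b * k a))
    (hψx : ∀ a b, ψ a * x b = -(x b * ψ a))
    (hkk : ∀ a b, k a * k b = -(ψ a * k b))
    (hpk : ∀ a, p * k a = k a * p)
    (hxp : ∀ a, x a * p = p * x a - p * p * ψ a) :
    ∀ l : List ι, (l.map (fun a => x a - p * k a)).prod =
      (l.map x).prod - p * ∑ i, k i * Zr x l i := by
  have hcons : ∀ b l, ∑ i, k i * Zr x (b :: l) i =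
      k b * (l.map x).prod + x b * ∑ i, k i * Zr x l i := by
    intro b l
    simp only [Zr, mul_sub, mul_ite, mul_zero, Finset.mul_sum, ← mul_assoc, hkx, neg_mul,
      sub_neg_eq_add]
    rw [Finset.sum_add_distrib]
    simp
  have key : ∀ a l, k a * ∑ i, k i * Zr x l i = -(ψ a * ∑ i, k i * Zr x l i) := by
    intro a l
    simp only [Finset.mul_sum, ← mul_assoc, hkk, neg_mul, Finset.sum_neg_distrib]
  intro l
  induction l with
  | nil => simp [Zr]
  | cons b l ih =>
    rw [List.map_cons, List.prod_cons, ih, hcons, List.map_cons, List.prod_cons]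
    set S := ∑ i, k i * Zr x l i with hS
    have e1 : x b * (p * S) = p * (x b * S) - p * (p * (ψ b * S)) := by
      rw [← mul_assoc, hxp, sub_mul]; simp only [mul_assoc]
    have e2 : p * k b * (p * S) = - (p * (p * (ψ b * S))) := by
      rw [mul_assoc, ← mul_assoc (k b), ← hpk, mul_assoc, hS, key]; simp
    rw [sub_mul, mul_sub, mul_sub, e1, e2]
    simp only [mul_add, mul_assoc]
    abel

end AbstractLists

section PoleExpansion
variable {A : Type*} [Ring A] {ι J : Type*} [DecidableEq J]

/-- Coefficients of the expansion of the row determinant over sets of poles. -/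
def BS (ψ : ι → A) (k : J → ι → A) : List ι → Finset J → A
  | [], S => if S = ∅ then 1 else 0
  | a :: l, S => ψ a * BS ψ k l S + ∑ j ∈ S, k j a * BS ψ k l (S.erase j)

lemma BS_eq_zero (ψ : ι → A) (k : J → ι → A) : ∀ (l : List ι) (S : Finset J),
    l.length < S.card → BS ψ k l S = 0 := by
  intro l
  induction l with
  | nil =>
    intro S h
    rw [BS, if_neg]
    rintro rfl; simp at h
  | cons a l ih =>
    intro S h
    rw [List.length_cons] at h
    rw [BS, ih S (by omega), mul_zero, zero_add]
    refine Finset.sum_eq_zero fun j hj => ?_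
    rw [ih _ (by rw [Finset.card_erase_of_mem hj]; omega), mul_zero]

lemma k_mul_BS (ψ : ι → A) (k : J → ι → A)
    (hψψ : ∀ a b, ψ a * ψ b = -(ψ b * ψ a))
    (hkψ : ∀ j a b, k j a * ψ b = -(ψ b * k j a))
    (hkk : ∀ j a b, k j a * k j b = -(ψ a * k j b))
    (hkk' : ∀ j j' a b, j ≠ j' → k j a * k j' b = -(k j' b * k j a)) (a : ι) :
    ∀ (l : List ι) (S : Finset J) (j : J), j ∈ S → k j a * BS ψ k l S = -(ψ a * BS ψ k l S) := by
  intro l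
  induction l with
  | nil =>
    intro S j hj
    have : S ≠ ∅ := by rintro rfl; simp at hj
    simp [BS, this]
  | cons b l ih =>
    intro S j hj
    rw [BS, mul_add, mul_add, ← mul_assoc, hkψ, neg_mul, mul_assoc, ih S j hj, mul_neg, neg_neg,
      ← mul_assoc, hψψ b a, neg_mul, mul_assoc, neg_add]
    congr 1
    rw [Finset.mul_sum, Finset.mul_sum, ← Finset.sum_neg_distrib]
    refine Finset.sum_congr rfl fun i hi => ?_
    by_cases hij : j = i
    · subst hij
      rw [← mul_assoc, hkk, neg_mul, mul_assoc]
    · rw [← mul_assoc, hkk' _ _ _ _ hij, neg_mul, mul_assoc,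
        ih _ j (Finset.mem_erase.2 ⟨hij, hj⟩), mul_neg, neg_neg, ← mul_assoc, hkψ, neg_mul,
        mul_assoc]

lemma commute_BS (ψ : ι → A) (k : J → ι → A) (d : A) (hψ : ∀ a, Commute d (ψ a))
    (hk : ∀ j a, Commute d (k j a)) : ∀ (l : List ι) (S : Finset J), Commute d (BS ψ k l S) := by
  intro l
  induction l with
  | nil => intro S; rw [BS]; split_ifs <;> simp
  | cons b l ih =>
    intro S
    rw [BS]
    refine ((hψ b).mul_right (ih S)).add_right ?_
    exact Commute.sum_right _ _ _ fun j _ => (hk j b).mul_right (ih _)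

lemma d_mul_noncommProd (p : J → A) (d : A) (hpp : ∀ i j, Commute (p i) (p j))
    (hd : ∀ j, d * p j = p j * d - p j * p j) (P : Finset J → A)
    (hP0 : P ∅ = 1) (hPi : ∀ j S, j ∉ S → P (insert j S) = p j * P S) (S : Finset J) :
    d * P S = P S * d - (∑ j ∈ S, p j) * P S := by
  have hc : ∀ (S : Finset J) (i : J), Commute (p i) (P S) := by
    intro S i
    induction S using Finset.induction_on with
    | empty => rw [hP0]; exact Commute.one_right _
    | insert j S hj ih => rw [hPi j S hj]; exact (hpp i j).mul_right ih
  induction S using Finset.induction_on with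
  | empty => simp [hP0]
  | insert j S hj ih =>
    rw [hPi j S hj, ← mul_assoc, hd, sub_mul, mul_assoc, ih, Finset.sum_insert hj, add_mul,
      mul_sub]
    have : (∑ i ∈ S, p i) * (p j * P S) = p j * ((∑ i ∈ S, p i) * P S) := by
      rw [← mul_assoc, ← mul_assoc]
      congr 1
      exact (Commute.sum_left _ _ _ fun i _ => hpp i j)
    rw [this]
    simp only [mul_assoc]
    abel

lemma prod_expansion (ψ : ι → A) (k : J → ι → A)
    (hψψ : ∀ a b, ψ a * ψ b = -(ψ b * ψ a))
    (hkψ : ∀ j a b, k j a * ψ b = -(ψ b * k j a))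
    (hkk : ∀ j a b, k j a * k j b = -(ψ a * k j b))
    (hkk' : ∀ j j' a b, j ≠ j' → k j a * k j' b = -(k j' b * k j a))
    (p : J → A) (d : A) (hpp : ∀ i j, Commute (p i) (p j))
    (hd : ∀ j, d * p j = p j * d - p j * p j)
    (hdψ : ∀ a, Commute d (ψ a)) (hdk : ∀ j a, Commute d (k j a))
    (hpψ : ∀ j a, Commute (p j) (ψ a)) (hpk : ∀ i j a, Commute (p i) (k j a))
    (P : Finset J → A)
    (hP0 : P ∅ = 1) (hPi : ∀ j S, j ∉ S → P (insert j S) = p j * P S) (S0 : Finset J) :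
    ∀ l : List ι, (l.map (fun a => ψ a * d - ∑ j ∈ S0, p j * k j a)).prod =
      ∑ S ∈ S0.powerset, (-1) ^ S.card * (P S * BS ψ k l S * d ^ (l.length - S.card)) := by
  have hPc : ∀ (y : A), (∀ j, Commute (p j) y) → ∀ S, Commute (P S) y := by
    intro y hy S
    induction S using Finset.induction_on with
    | empty => rw [hP0]; exact Commute.one_left _
    | insert j S hj ih => rw [hPi j S hj]; exact (hy j).mul_left ih
  intro l
  induction l with
  | nil =>
    rw [Finset.sum_eq_single ∅]
    · simp [BS, hP0]
    · intro S _ hS; simp [BS, hS]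
    · simp
  | cons a l ih =>
    rw [List.map_cons, List.prod_cons, ih, sub_mul, Finset.mul_sum]
    -- the `d` part
    have e1 : ∀ S ∈ S0.powerset, ψ a * d * ((-1) ^ S.card * (P S * BS ψ k l S * d ^ (l.length - S.card)))
        = (-1) ^ S.card * (P S * (ψ a * BS ψ k l S) * d ^ (l.length + 1 - S.card))
          - (-1) ^ S.card * ((∑ j ∈ S, p j) * P S * (ψ a * BS ψ k l S) * d ^ (l.length - S.card)) := by
      intro S _
      by_cases hS : l.length < S.card
      · rw [BS_eq_zero ψ k l S hS]; simp
      · have h1 : l.length + 1 - S.card = (l.length - S.card) + 1 := by omega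
        have hs : Commute (ψ a * d) ((-1 : A) ^ S.card) := (Commute.neg_one_right _).pow_right _
        rw [← mul_assoc, hs.eq, mul_assoc, ← mul_sub]
        congr 1
        have hB : d * BS ψ k l S = BS ψ k l S * d := (commute_BS ψ k d hdψ hdk l S).eq
        have hPψ : ψ a * P S = P S * ψ a := (hPc (ψ a) (fun j => hpψ j a) S).eq.symm
        have hpsum : ψ a * (∑ j ∈ S, p j) = (∑ j ∈ S, p j) * ψ a :=
          (Commute.sum_right _ _ _ fun j _ => (hpψ j a).symm).eq
        calc ψ a * d * (P S * BS ψ k l S * d ^ (l.length - S.card))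
            = ψ a * (d * P S) * BS ψ k l S * d ^ (l.length - S.card) := by simp only [mul_assoc]
          _ = (ψ a * P S) * (d * BS ψ k l S) * d ^ (l.length - S.card)
              - (ψ a * (∑ j ∈ S, p j)) * P S * BS ψ k l S * d ^ (l.length - S.card) := by
              rw [d_mul_noncommProd p d hpp hd P hP0 hPi S]
              simp only [mul_sub, sub_mul, mul_assoc]
          _ = _ := by
              rw [hB, hPψ, hpsum, h1, pow_succ']
              have : (∑ j ∈ S, p j) * ψ a * P S = (∑ j ∈ S, p j) * P S * ψ a := by
                rw [mul_assoc, hPψ, mul_assoc]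
              rw [this]
              simp only [mul_assoc]
    rw [Finset.sum_congr rfl e1, Finset.sum_sub_distrib]
    -- the `p` part
    have e2 : ∀ j ∈ S0, ∀ S ∈ S0.powerset, p j * k j a *
          ((-1) ^ S.card * (P S * BS ψ k l S * d ^ (l.length - S.card)))
        = (if j ∈ S then - ((-1) ^ S.card * (p j * P S * (ψ a * BS ψ k l S) * d ^ (l.length - S.card)))
            else - ((-1) ^ (insert j S).card * (P (insert j S) * (k j a * BS ψ k l ((insert j S).erase j)) *
              d ^ (l.length + 1 - (insert j S).card)))) := by
      intro j _ S _
      have hs : Commute (p j * k j a) ((-1 : A) ^ S.card) := (Commute.neg_one_right _).pow_right _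
      have hPk : k j a * P S = P S * k j a := (hPc (k j a) (fun i => hpk i j a) S).eq.symm
      rw [← mul_assoc, hs.eq, mul_assoc]
      have e3 : p j * k j a * (P S * BS ψ k l S * d ^ (l.length - S.card))
          = p j * P S * (k j a * BS ψ k l S) * d ^ (l.length - S.card) := by
        calc _ = p j * (k j a * P S) * BS ψ k l S * d ^ (l.length - S.card) := by
              simp only [mul_assoc]
          _ = _ := by rw [hPk]; simp only [mul_assoc]
      rw [e3]
      split_ifs with hjS
      · rw [k_mul_BS ψ k hψψ hkψ hkk hkk' a l S j hjS]
        simp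
      · rw [hPi j S hjS, Finset.card_insert_of_notMem hjS, Finset.erase_insert hjS,
          Nat.add_sub_add_right, pow_succ]
        simp
    have e4 : (∑ j ∈ S0, p j * k j a) * ∑ S ∈ S0.powerset,
          ((-1) ^ S.card * (P S * BS ψ k l S * d ^ (l.length - S.card)))
        = - (∑ S ∈ S0.powerset, (-1) ^ S.card *
            ((∑ j ∈ S, p j) * P S * (ψ a * BS ψ k l S) * d ^ (l.length - S.card)))
          - ∑ S ∈ S0.powerset, ∑ j ∈ S, (-1) ^ S.card * (P S * (k j a * BS ψ k l (S.erase j)) *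
              d ^ (l.length + 1 - S.card)) := by
      rw [Finset.sum_mul_sum, Finset.sum_congr rfl fun j hj => Finset.sum_congr rfl fun S hS => e2 j hj S hS]
      simp only [Finset.sum_ite, Finset.sum_add_distrib]
      rw [sub_eq_add_neg]
      congr 1
      · rw [← Finset.sum_neg_distrib]
        simp only [Finset.sum_filter]
        rw [Finset.sum_comm]
        refine Finset.sum_congr rfl fun S hS => ?_
        rw [← Finset.sum_filter, Finset.filter_mem_eq_inter,
          Finset.inter_eq_right.2 (Finset.mem_powerset.1 hS), Finset.sum_neg_distrib]
        simp only [Finset.sum_mul, Finset.mul_sum]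
      · simp only [Finset.sum_neg_distrib]
        congr 1
        rw [Finset.sum_sigma', Finset.sum_sigma']
        refine Finset.sum_bij' (fun x _ => ⟨insert x.1 x.2, x.1⟩) (fun x _ => ⟨x.2, x.1.erase x.2⟩)
          ?_ ?_ ?_ ?_ ?_
        · rintro ⟨j, S⟩ h
          simp only [Finset.mem_sigma, Finset.mem_filter, Finset.mem_powerset] at h ⊢
          exact ⟨Finset.insert_subset h.1 h.2.1, Finset.mem_insert_self _ _⟩
        · rintro ⟨S, j⟩ h
          simp only [Finset.mem_sigma, Finset.mem_filter, Finset.mem_powerset] at h ⊢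
          exact ⟨h.1 h.2, (Finset.erase_subset _ _).trans h.1, Finset.notMem_erase _ _⟩
        · rintro ⟨j, S⟩ h
          simp only [Finset.mem_sigma, Finset.mem_filter, Finset.mem_powerset] at h ⊢
          simp [Finset.erase_insert h.2.2]
        · rintro ⟨S, j⟩ h
          simp only [Finset.mem_sigma, Finset.mem_powerset] at h ⊢
          simp [Finset.insert_erase h.2]
        · rintro ⟨j, S⟩ h
          rfl
    rw [e4]
    simp only [BS, mul_add, add_mul, Finset.sum_add_distrib, Finset.mul_sum, Finset.sum_mul,
      List.length_cons]
    abel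

end PoleExpansion
end GaudinAux

namespace GaudinAux
open scoped TensorProduct

section Grass
variable (N : ℕ)

/-- The Grassmann algebra on `N` generators. -/
abbrev Lam := ExteriorAlgebra ℂ (Fin N → ℂ)

variable {N}
/-- Grassmann generators. -/
def psi0 (b : Fin N) : Lam N := ExteriorAlgebra.ι ℂ (Pi.single b (1 : ℂ))

lemma psi0_mul (a b : Fin N) : psi0 a * psi0 b = -(psi0 b * psi0 a) := by
  rw [eq_neg_iff_add_eq_zero]
  exact ExteriorAlgebra.ι_add_mul_swap _ _

variable (N) in
/-- Top form. -/
def om : Lam N →ₗ[ℂ] ℂ :=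
  ExteriorAlgebra.liftAlternating
    (fun i => if h : i = N then
      (Matrix.detRowAlternating (n := Fin N) (R := ℂ)).domDomCongr (finCongr h.symm) else 0)

lemma om_prod (v : Fin N → Fin N → ℂ) :
    om N (List.ofFn fun q => ExteriorAlgebra.ι ℂ (v q)).prod = Matrix.det (Matrix.of v) := by
  rw [← ExteriorAlgebra.ιMulti_apply, om, ExteriorAlgebra.liftAlternating_apply_ιMulti]
  simp
  rfl

lemma det_single (g : Fin N → Fin N) :
    Matrix.det (Matrix.of fun q => (Pi.single (g q) (1 : ℂ) : Fin N → ℂ)) =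
      ∑ σ : Equiv.Perm (Fin N), if g = σ then ((Equiv.Perm.sign σ : ℤˣ) : ℂ) else 0 := by
  rw [← Matrix.det_transpose, Matrix.det_apply]
  refine Finset.sum_congr rfl fun σ _ => ?_
  split_ifs with h
  · subst h
    simp [Matrix.transpose_apply, Units.smul_def]
  · have : ∃ i, g i ≠ σ i := by
      by_contra hc; push_neg at hc; exact h (funext hc)
    obtain ⟨i, hi⟩ := this
    rw [Finset.prod_eq_zero (Finset.mem_univ i), smul_zero]
    simp [Matrix.transpose_apply, Pi.single_apply, hi.symm]

variable {R : Type*} [Ring R] [Algebra ℂ R]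

/-- Linear combination of Grassmann generators. -/
def kap (y : Fin N → R) : R ⊗[ℂ] Lam N := ∑ b, y b ⊗ₜ psi0 b

/-- Scalars. -/
def lft (r : R) : R ⊗[ℂ] Lam N := r ⊗ₜ 1

lemma lft_mul (r s : R) : (lft (r * s) : R ⊗[ℂ] Lam N) = lft r * lft s := by
  simp [lft]

lemma lft_one : (lft 1 : R ⊗[ℂ] Lam N) = 1 := rfl

lemma lft_sub (r s : R) : (lft (r - s) : R ⊗[ℂ] Lam N) = lft r - lft s := by
  simp [lft, TensorProduct.sub_tmul]

lemma lft_add (r s : R) : (lft (r + s) : R ⊗[ℂ] Lam N) = lft r + lft s := by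
  simp [lft, TensorProduct.add_tmul]

lemma lft_neg (r : R) : (lft (-r) : R ⊗[ℂ] Lam N) = -lft r := by
  simp [lft, TensorProduct.neg_tmul]

lemma lft_sum {ι : Type*} (s : Finset ι) (r : ι → R) :
    (lft (∑ i ∈ s, r i) : R ⊗[ℂ] Lam N) = ∑ i ∈ s, lft (r i) := by
  simp [lft, TensorProduct.sum_tmul]

lemma lft_pow (r : R) (k : ℕ) : (lft (r ^ k) : R ⊗[ℂ] Lam N) = lft r ^ k := by
  simp [lft, Algebra.TensorProduct.tmul_pow]

lemma lft_mul_kap (r : R) (y : Fin N → R) : lft r * kap y = kap (fun b => r * y b) := by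
  simp [lft, kap, Finset.mul_sum]

lemma kap_mul_lft (r : R) (y : Fin N → R) : kap y * lft r = kap (fun b => y b * r) := by
  simp [lft, kap, Finset.sum_mul]

lemma kap_add (y y' : Fin N → R) : kap (fun b => y b + y' b) = kap y + kap y' := by
  simp [kap, TensorProduct.add_tmul, Finset.sum_add_distrib]

lemma kap_sub (y y' : Fin N → R) : kap (fun b => y b - y' b) = kap y - kap y' := by
  simp [kap, TensorProduct.sub_tmul, Finset.sum_sub_distrib]

lemma kap_sum {ι : Type*} (s : Finset ι) (y : ι → Fin N → R) :
    kap (fun b => ∑ i ∈ s, y i b) = ∑ i ∈ s, kap (y i) := by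
  simp only [kap, TensorProduct.sum_tmul]
  exact Finset.sum_comm

lemma kap_mul_kap (y y' : Fin N → R) :
    kap y * kap y' = ∑ b, ∑ c, (y b * y' c) ⊗ₜ[ℂ] (psi0 b * psi0 c) := by
  simp [kap, Finset.sum_mul_sum]

lemma sym_zero (s : Fin N → Fin N → R) (hs : ∀ b c, s b c = s c b) :
    ∑ b, ∑ c, (s b c) ⊗ₜ[ℂ] (psi0 b * psi0 c) = 0 := by
  have h : ∑ b, ∑ c, (s b c) ⊗ₜ[ℂ] (psi0 b * psi0 c) =
      - ∑ b, ∑ c, (s b c) ⊗ₜ[ℂ] (psi0 b * psi0 c) := by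
    conv_lhs => rw [Finset.sum_comm]
    rw [← Finset.sum_neg_distrib]
    refine Finset.sum_congr rfl fun b _ => ?_
    rw [← Finset.sum_neg_distrib]
    refine Finset.sum_congr rfl fun c _ => ?_
    rw [psi0_mul c b, hs c b, TensorProduct.tmul_neg]
  rw [eq_neg_iff_add_eq_zero, ← two_smul ℂ] at h
  exact (smul_eq_zero.1 h).resolve_left two_ne_zero

lemma kap_anti (y y' : Fin N → R)
    (h : ∀ b c, y b * y' c - y' c * y b = y c * y' b - y' b * y c) :
    kap y * kap y' = -(kap y' * kap y) := by
  rw [eq_neg_iff_add_eq_zero, kap_mul_kap, kap_mul_kap]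
  have : ∑ b, ∑ c, (y' b * y c) ⊗ₜ[ℂ] (psi0 b * psi0 c) =
      ∑ b, ∑ c, (-(y' c * y b)) ⊗ₜ[ℂ] (psi0 b * psi0 c) := by
    rw [Finset.sum_comm]
    refine Finset.sum_congr rfl fun b _ => Finset.sum_congr rfl fun c _ => ?_
    rw [psi0_mul c b, TensorProduct.tmul_neg, TensorProduct.neg_tmul]
  rw [this, ← Finset.sum_add_distrib]
  simp only [← Finset.sum_add_distrib, ← TensorProduct.add_tmul, ← sub_eq_add_neg]
  exact sym_zero _ h

lemma kap_anti_of_comm (y y' : Fin N → R) (h : ∀ b c, y b * y' c = y' c * y b) :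
    kap y * kap y' = -(kap y' * kap y) :=
  kap_anti y y' fun b c => by rw [h, h, sub_self, sub_self]

lemma kap_sq (y : Fin N → R) (h : ∀ b c, y b * y c = y c * y b) : kap y * kap y = 0 := by
  rw [kap_mul_kap]; exact sym_zero _ h

/-- Determinant functional. -/
def Phi : R ⊗[ℂ] Lam N →ₗ[ℂ] R :=
  (TensorProduct.rid ℂ R).toLinearMap ∘ₗ LinearMap.lTensor R (om N)

lemma Phi_tmul (r : R) (x : Lam N) : Phi (r ⊗ₜ[ℂ] x) = om N x • r := by
  simp [Phi]

lemma Phi_lft_mul (r : R) (x : R ⊗[ℂ] Lam N) : Phi (lft r * x) = r * Phi x := by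
  induction x using TensorProduct.induction_on with
  | zero => simp
  | tmul s y => simp [lft, Phi_tmul]
  | add x y hx hy => rw [mul_add, map_add, map_add, hx, hy, mul_add]

lemma Phi_mul_lft (r : R) (x : R ⊗[ℂ] Lam N) : Phi (x * lft r) = Phi x * r := by
  induction x using TensorProduct.induction_on with
  | zero => simp
  | tmul s y => simp [lft, Phi_tmul]
  | add x y hx hy => rw [add_mul, map_add, map_add, hx, hy, add_mul]

lemma ofFn_tmul_prod : ∀ (k : ℕ) (y : Fin k → R) (x : Fin k → Lam N),
    (List.ofFn fun q => y q ⊗ₜ[ℂ] x q).prod = (List.ofFn y).prod ⊗ₜ[ℂ] (List.ofFn x).prod := by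
  intro k
  induction k with
  | zero => intro y x; simp; rfl
  | succ k ih =>
    intro y x
    simp only [List.ofFn_succ, List.prod_cons]
    rw [ih (fun q => y q.succ) (fun q => x q.succ), Algebra.TensorProduct.tmul_mul_tmul]

/-- Row determinant. -/
def rdet (y : Fin N → Fin N → R) : R :=
  ∑ σ : Equiv.Perm (Fin N), ((Equiv.Perm.sign σ : ℤˣ) : ℤ) • (List.ofFn fun q => y q (σ q)).prod

lemma Phi_prod (y : Fin N → Fin N → R) :
    Phi (List.ofFn fun q => kap (y q)).prod = rdet y := by
  have h1 : (List.ofFn fun q => kap (y q)).prod =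
      ∑ g : Fin N → Fin N, (List.ofFn fun q => y q (g q)).prod ⊗ₜ[ℂ]
        (List.ofFn fun q => psi0 (g q)).prod := by
    have := MultilinearMap.map_sum (MultilinearMap.mkPiAlgebraFin ℂ N (R ⊗[ℂ] Lam N))
      (fun q b => y q b ⊗ₜ[ℂ] psi0 b)
    simp only [MultilinearMap.mkPiAlgebraFin_apply] at this
    unfold kap
    rw [this]
    exact Finset.sum_congr rfl fun g _ => ofFn_tmul_prod N _ _
  rw [h1, map_sum]
  simp only [Phi_tmul]
  unfold psi0
  simp only [om_prod, det_single, Finset.sum_smul, ite_smul, zero_smul]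
  rw [Finset.sum_comm, rdet]
  refine Finset.sum_congr rfl fun σ _ => ?_
  rw [Finset.sum_ite_eq' Finset.univ (⇑σ) (fun g => ((Equiv.Perm.sign σ : ℤˣ) : ℂ) • (List.ofFn fun q => y q (g q)).prod)]
  simp [Int.cast_smul_eq_zsmul]

end Grass
end GaudinAux

set_option linter.unusedSectionVars false
set_option linter.unusedSimpArgs false
namespace GaudinAux
open scoped TensorProduct

/-- Abstract data in a ring: commuting copies of `gl_N`, a derivation `d` and
functions `p j = 1/(u - z_j)`. -/
structure GD {N : ℕ} {J R : Type*} [Ring R] (e : J → Fin N → Fin N → R) (p : J → R) (d : R) :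
    Prop where
  rel : ∀ j a b c f, e j a b * e j c f - e j c f * e j a b =
    (if b = c then e j a f else 0) - (if f = a then e j c b else 0)
  comm : ∀ i j, i ≠ j → ∀ a b c f, e i a b * e j c f = e j c f * e i a b
  pe : ∀ i j a b, p i * e j a b = e j a b * p i
  de : ∀ j a b, d * e j a b = e j a b * d
  pp : ∀ i j, p i * p j = p j * p i
  dp : ∀ j, d * p j = p j * d - p j * p j

section
variable {N : ℕ} {J R : Type*} [DecidableEq J] [Ring R]
  {e : J → Fin N → Fin N → R} {p : J → R} {d : R}

/-- The entries `X_{ab}`. -/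
def XX (e : J → Fin N → Fin N → R) (p : J → R) (d : R) (S : Finset J) (a b : Fin N) : R :=
  (if a = b then d else 0) - ∑ j ∈ S, p j * e j b a

lemma XX_comm_e (h : GD e p d) (S : Finset J) (j : J) (hj : j ∉ S) (a b c f : Fin N) :
    XX e p d S a b * e j c f = e j c f * XX e p d S a b := by
  rw [XX, sub_mul, mul_sub, Finset.sum_mul, Finset.mul_sum]
  congr 1
  · split_ifs
    · exact h.de _ _ _
    · simp
  · refine Finset.sum_congr rfl fun i hi => ?_
    have hij : i ≠ j := fun hij => hj (hij ▸ hi)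
    rw [mul_assoc, h.comm i j hij, ← mul_assoc, h.pe, mul_assoc]

lemma XX_p (h : GD e p d) (S : Finset J) (j : J) (a b : Fin N) :
    XX e p d S a b * p j = p j * XX e p d S a b - (if a = b then p j * p j else 0) := by
  rw [XX, sub_mul, mul_sub, Finset.sum_mul, Finset.mul_sum]
  have : ∑ i ∈ S, p i * e i b a * p j = ∑ i ∈ S, p j * (p i * e i b a) := by
    refine Finset.sum_congr rfl fun i hi => ?_
    rw [mul_assoc, ← h.pe, ← mul_assoc, ← mul_assoc, h.pp]
  rw [this]
  split_ifs
  · rw [h.dp]; abel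
  · simp

lemma XX_y (h : GD e p d) (S : Finset J) (j : J) (hj : j ∉ S) (a b c f : Fin N) :
    XX e p d S a b * (p j * e j c f) - (p j * e j c f) * XX e p d S a b =
      - (p j * p j * (if a = b then e j c f else 0)) := by
  rw [← mul_assoc, XX_p h, sub_mul, mul_assoc, XX_comm_e h S j hj]
  split_ifs <;> simp [mul_assoc]

lemma XX_insert (S : Finset J) (j : J) (hj : j ∉ S) (a b : Fin N) :
    XX e p d (insert j S) a b = XX e p d S a b - p j * e j b a := by
  rw [XX, XX, Finset.sum_insert hj]; abel

lemma XX_comm (h : GD e p d) (S : Finset J) (a b c f : Fin N) :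
    XX e p d S a b * XX e p d S c f - XX e p d S c f * XX e p d S a b =
      ∑ j ∈ S, p j * p j * ((if a = b then e j f c else 0) - (if c = f then e j b a else 0)
        + (if a = f then e j b c else 0) - (if c = b then e j f a else 0)) := by
  induction S using Finset.induction_on with
  | empty =>
    simp only [XX, Finset.sum_empty, sub_zero]
    split_ifs <;> simp
  | insert j S hj ih =>
    rw [XX_insert S j hj, XX_insert S j hj, Finset.sum_insert hj, ← ih]
    have h1 := XX_y h S j hj a b f c
    have h2 := XX_y h S j hj c f b a
    have h3 : p j * e j b a * (p j * e j f c) - p j * e j f c * (p j * e j b a) =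
        p j * p j * ((if a = f then e j b c else 0) - (if c = b then e j f a else 0)) := by
      rw [← h.rel, mul_sub]
      have : ∀ a b c f, p j * e j b a * (p j * e j f c) = p j * p j * (e j b a * e j f c) := by
        intro a b c f
        rw [mul_assoc, ← mul_assoc (e j b a), ← h.pe]
        simp only [mul_assoc]
      rw [this, this]
    generalize XX e p d S a b = x at *
    generalize XX e p d S c f = x' at *
    generalize p j * e j b a = y at *
    generalize p j * e j f c = y' at *
    have h4 : (x - y) * (x' - y') - (x' - y') * (x - y) =
      (x * x' - x' * x) - (x * y' - y' * x) + (x' * y - y * x') + (y * y' - y' * y) := by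
      noncomm_ring
    rw [h4, h1, h2, h3]
    noncomm_ring

lemma XX_manin (h : GD e p d) (S : Finset J) (a b c f : Fin N) :
    XX e p d S a b * XX e p d S c f - XX e p d S c f * XX e p d S a b =
    XX e p d S a f * XX e p d S c b - XX e p d S c b * XX e p d S a f := by
  rw [XX_comm h, XX_comm h]
  refine Finset.sum_congr rfl fun j _ => ?_
  congr 1
  abel

variable [Algebra ℂ R]

/-- Rows. -/
def Th (e : J → Fin N → Fin N → R) (p : J → R) (d : R) (S : Finset J) (a : Fin N) :
    R ⊗[ℂ] Lam N := kap (XX e p d S a)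

lemma Th_anti (h : GD e p d) (S : Finset J) (a c : Fin N) :
    Th e p d S a * Th e p d S c = -(Th e p d S c * Th e p d S a) :=
  kap_anti _ _ fun b f => XX_manin h S a b c f

lemma Th_sq (h : GD e p d) (S : Finset J) (a : Fin N) :
    Th e p d S a * Th e p d S a = 0 := by
  have := Th_anti h S a a
  rw [eq_neg_iff_add_eq_zero, ← two_smul ℂ] at this
  exact (smul_eq_zero.1 this).resolve_left two_ne_zero

/-- The determinant. -/
def DD (e : J → Fin N → Fin N → R) (p : J → R) (d : R) (S : Finset J) : R :=
  rdet (XX e p d S)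

lemma DD_eq_Phi (S : Finset J) :
    DD e p d S = Phi ((List.finRange N).map (Th e p d S)).prod := by
  rw [DD, ← Phi_prod, List.ofFn_eq_map]; rfl

/-- Leibniz rule. -/
lemma leibniz (t : R) : ∀ (k : ℕ) (y : Fin k → R), t * (List.ofFn y).prod - (List.ofFn y).prod * t =
    ∑ q, (List.ofFn (Function.update y q (t * y q - y q * t))).prod := by
  intro k
  induction k with
  | zero => intro y; simp
  | succ k ih =>
    intro y
    rw [Fin.sum_univ_succ]
    simp only [List.ofFn_succ, List.prod_cons]
    have h0 : ∀ x, (fun i : Fin k => Function.update y 0 x i.succ) = fun i => y i.succ := by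
      intro x; ext i; simp [Fin.succ_ne_zero]
    have h1 : ∀ (q : Fin k) x, (fun i : Fin k => Function.update y q.succ x i.succ)
        = Function.update (fun i => y i.succ) q x := by
      intro q x; ext i
      simp [Function.update_apply, Fin.succ_inj]
    simp only [h0, h1, Function.update_self]
    have h2 : ∀ q : Fin k, Function.update y q.succ (t * y q.succ - y q.succ * t) 0 = y 0 := by
      intro q; exact Function.update_of_ne (Fin.succ_ne_zero q).symm _ _
    simp only [h2, ← Finset.mul_sum]
    rw [← ih (fun i => y i.succ)]
    noncomm_ring

/-- `e^{tot}`. -/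
def etot (e : J → Fin N → Fin N → R) (S : Finset J) (a b : Fin N) : R := ∑ j ∈ S, e j a b

lemma etot_XX (h : GD e p d) (S : Finset J) (a b c f : Fin N) :
    etot e S a b * XX e p d S c f - XX e p d S c f * etot e S a b =
      (if b = f then XX e p d S c a else 0) - (if c = a then XX e p d S b f else 0) := by
  have h1 : ∀ i ∈ S, etot e S a b * (p i * e i f c) - (p i * e i f c) * etot e S a b =
      p i * ((if b = f then e i a c else 0) - (if c = a then e i f b else 0)) := by
    intro i hi
    rw [etot, Finset.sum_mul, Finset.mul_sum, ← Finset.sum_sub_distrib,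
      Finset.sum_eq_single_of_mem i hi, ← h.rel, mul_sub, ← mul_assoc, ← h.pe]
    · simp only [mul_assoc]
    · intro j _ hji
      rw [← mul_assoc, ← h.pe, mul_assoc, h.comm j i hji, mul_assoc, sub_self]
  have h2 : etot e S a b * d = d * etot e S a b := by
    rw [etot, Finset.sum_mul, Finset.mul_sum]
    exact Finset.sum_congr rfl fun j _ => (h.de j a b).symm
  have h3 : etot e S a b * (if c = f then d else 0) = (if c = f then d else 0) * etot e S a b := by
    split_ifs
    · exact h2
    · simp
  have h4 : etot e S a b * XX e p d S c f - XX e p d S c f * etot e S a b =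
      - ∑ i ∈ S, p i * ((if b = f then e i a c else 0) - (if c = a then e i f b else 0)) := by
    rw [← Finset.sum_congr rfl h1, Finset.sum_sub_distrib, ← Finset.mul_sum, ← Finset.sum_mul,
      XX, mul_sub, sub_mul, h3]
    abel
  rw [h4]
  simp only [mul_sub, Finset.sum_sub_distrib, XX]
  by_cases hb : b = f <;> by_cases hc : c = a
  · subst hb; subst hc
    simp only [if_true, eq_comm]; abel
  · subst hb; simp [hc]
  · subst hc; simp [hb, Ne.symm hb]
  · simp [hb, hc]

lemma sign_sum_swap (y : Fin N → Fin N → R) (a b : Fin N) (hab : a ≠ b) (g : Fin N → Fin N)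
    (hg : g a = g b) : rdet (fun q s => y q (g s)) = 0 := by
  rw [rdet]
  refine Finset.sum_involution (fun σ _ => Equiv.swap a b * σ) ?_ ?_ ?_ ?_
  · intro σ _
    have : ∀ s, g (Equiv.swap a b s) = g s := by
      intro s
      by_cases h1 : s = a
      · subst h1; simp [hg]
      · by_cases h2 : s = b
        · subst h2; simp [hg]
        · rw [Equiv.swap_apply_of_ne_of_ne h1 h2]
    simp [this, Equiv.Perm.sign_swap hab]
  · intro σ _ _ h
    have := congrArg (fun τ => τ * σ⁻¹) h
    simp [Equiv.swap_eq_one_iff] at this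
    exact hab this
  · intro σ _; exact Finset.mem_univ _
  · intro σ _; simp

/-- The determinant commutes with `gl_N`. -/
lemma DD_etot (h : GD e p d) (S : Finset J) (a b : Fin N) :
    etot e S a b * DD e p d S = DD e p d S * etot e S a b := by
  rw [← sub_eq_zero]
  set X := XX e p d S with hX
  set t := etot e S a b with ht
  have key : ∀ σ : Equiv.Perm (Fin N),
      t * (List.ofFn fun q => X q (σ q)).prod - (List.ofFn fun q => X q (σ q)).prod * t =
      (List.ofFn fun q => X q (Function.update id b a (σ q))).prod -
      (List.ofFn fun q => X (Function.update id a b q) (σ q)).prod := by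
    intro σ
    rw [leibniz]
    have h1 : ∀ q, (List.ofFn (Function.update (fun q => X q (σ q)) q
          (t * X q (σ q) - X q (σ q) * t))).prod
        = (if σ⁻¹ b = q then (List.ofFn fun q => X q (Function.update id b a (σ q))).prod else 0)
        - (if a = q then (List.ofFn fun q => X (Function.update id a b q) (σ q)).prod else 0) := by
      intro q
      have hm := (MultilinearMap.mkPiAlgebraFin ℂ N R).map_update_sub (fun q => X q (σ q)) q
        (if b = σ q then X q a else 0) (if q = a then X b (σ q) else 0)
      simp only [MultilinearMap.mkPiAlgebraFin_apply] at hm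
      rw [etot_XX h, hm]
      have hz : ∀ y : Fin N → R, (List.ofFn (Function.update y q 0)).prod = 0 := by
        intro y
        have := (MultilinearMap.mkPiAlgebraFin ℂ N R).map_update_zero y q
        simpa only [MultilinearMap.mkPiAlgebraFin_apply] using this
      congr 1
      · by_cases hq : b = σ q
        · rw [if_pos hq, if_pos (by rw [hq]; simp)]
          congr 2
          ext s
          by_cases hs : s = q
          · subst hs; simp [hq]
          · rw [Function.update_of_ne hs, Function.update_of_ne, id]
            rw [hq]; exact fun hh => hs (σ.injective hh)
        · rw [if_neg hq, if_neg (fun hh => hq (by rw [← hh]; simp)), hz]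
      · by_cases hq : a = q
        · subst hq
          rw [if_pos rfl, if_pos rfl]
          congr 2
          ext s
          by_cases hs : s = a
          · subst hs; simp
          · rw [Function.update_of_ne hs, Function.update_of_ne hs, id]
        · rw [if_neg hq, if_neg (fun hh => hq hh.symm), hz]
    rw [Finset.sum_congr rfl fun q _ => h1 q, Finset.sum_sub_distrib]
    simp
  have h2 : t * DD e p d S - DD e p d S * t =
      rdet (fun q s => X q (Function.update id b a s)) -
      rdet (fun q s => X (Function.update id a b q) s) := by
    rw [DD, rdet, rdet, rdet, Finset.mul_sum, Finset.sum_mul, ← Finset.sum_sub_distrib,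
      ← Finset.sum_sub_distrib]
    refine Finset.sum_congr rfl fun σ _ => ?_
    rw [mul_smul_comm, smul_mul_assoc, ← smul_sub, ← smul_sub, ← key]
  rw [h2]
  by_cases hab : a = b
  · subst hab
    have : Function.update (id : Fin N → Fin N) a a = id := Function.update_eq_self a id
    rw [this]; simp
  · rw [sign_sum_swap X a b hab (Function.update id b a) (by simp [hab]), ← Phi_prod]
    have h3 : (List.ofFn fun q => kap (X (Function.update id a b q)) : List (R ⊗[ℂ] Lam N))
        = (List.ofFn (Function.update id a b)).map (Th e p d S) := by
      rw [List.map_ofFn]; rfl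
    rw [h3, prod_eq_zero_of_not_nodup _ (Th_anti h S) (Th_sq h S), map_zero, sub_zero]
    rw [List.nodup_ofFn]
    intro hinj
    exact hab (hinj (a₁ := a) (a₂ := b) (by simp [Function.update_of_ne (Ne.symm hab)]))

/-- Oscillator relation: minuscule case. -/
def Osc (e : J → Fin N → Fin N → R) : Prop :=
  ∀ j a b c f, e j a b * e j c f = if b = c then e j a f else 0

/-- `psi` in the big algebra. -/
def psi (R : Type*) [Ring R] [Algebra ℂ R] (a : Fin N) : R ⊗[ℂ] Lam N := kap (Pi.single a (1 : R))

/-- `kappa`. -/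
def kk (e : J → Fin N → Fin N → R) (j : J) (a : Fin N) : R ⊗[ℂ] Lam N := kap (fun b => e j b a)

lemma psi_kk_gen (a : Fin N) (y : Fin N → R) : psi R a * kap y = -(kap y * psi R a) := by
  refine kap_anti_of_comm _ _ fun b c => ?_
  by_cases h : b = a
  · subst h; simp
  · simp [Pi.single_eq_of_ne h]

lemma kk_osc (ho : Osc e) (j : J) (a b : Fin N) :
    kk e j a * kk e j b = -(psi R a * kk e j b) := by
  rw [eq_neg_iff_add_eq_zero]
  simp only [kk, psi]
  rw [kap_mul_kap, kap_mul_kap]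
  simp only [← Finset.sum_add_distrib, ← TensorProduct.add_tmul]
  refine sym_zero _ fun c f => ?_
  rw [ho, ho]
  by_cases h1 : a = f <;> by_cases h2 : a = c
  · subst h1; subst h2; rfl
  · subst h1; simp [h2, Ne.symm h2]
  · subst h2; simp [h1, Ne.symm h1]
  · simp [h1, h2, Ne.symm h1, Ne.symm h2]

lemma kk_comm (h : GD e p d) (i j : J) (hij : i ≠ j) (a b : Fin N) :
    kk e i a * kk e j b = -(kk e j b * kk e i a) :=
  kap_anti_of_comm _ _ fun _ _ => h.comm i j hij _ _ _ _

lemma kk_Th (h : GD e p d) (S : Finset J) (j : J) (hj : j ∉ S) (a b : Fin N) :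
    kk e j a * Th e p d S b = -(Th e p d S b * kk e j a) :=
  kap_anti_of_comm _ _ fun _ _ => (XX_comm_e h S j hj _ _ _ _).symm

lemma Th_insert (S : Finset J) (j : J) (hj : j ∉ S) (a : Fin N) :
    Th e p d (insert j S) a = Th e p d S a - lft (p j) * kk e j a := by
  rw [Th, Th, kk, lft_mul_kap, ← kap_sub]
  congr 1
  ext b
  exact XX_insert S j hj a b

lemma Th_eq (S : Finset J) (a : Fin N) :
    Th e p d S a = psi R a * lft d - ∑ j ∈ S, lft (p j) * kk e j a := by
  simp only [Th, kk, psi, lft_mul_kap, kap_mul_lft]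
  rw [← kap_sum, ← kap_sub]
  congr 1
  ext b
  rw [XX]
  by_cases hab : a = b
  · subst hab; simp
  · simp [hab, Ne.symm hab]

lemma Th_p (h : GD e p d) (S : Finset J) (j : J) (a : Fin N) :
    Th e p d S a * lft (p j) = lft (p j) * Th e p d S a - lft (p j) * lft (p j) * psi R a := by
  rw [Th, psi, kap_mul_lft, ← lft_mul, lft_mul_kap, lft_mul_kap, ← kap_sub]
  congr 1
  ext b
  rw [XX_p h]
  by_cases hab : a = b
  · subst hab; simp
  · simp [hab, Ne.symm hab]

/-- The residue operator. -/
def CC (e : J → Fin N → Fin N → R) (p : J → R) (d : R) (S : Finset J) (j : J) : R :=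
  Phi (∑ i, kk e j i * Zr (Th e p d S) (List.finRange N) i)

lemma DD_insert (h : GD e p d) (ho : Osc e) (S : Finset J) (j : J) (hj : j ∉ S) :
    DD e p d (insert j S) = DD e p d S - p j * CC e p d S j := by
  rw [DD_eq_Phi, DD_eq_Phi, CC, ← Phi_lft_mul, ← map_sub]
  congr 1
  rw [← prod_sub_pole (Th e p d S) (kk e j) (psi R) (lft (p j)) (kk_Th h S j hj)
    (fun a b => psi_kk_gen a _) (kk_osc ho j) ?_ (Th_p h S j)]
  · congr 2
    ext a
    exact Th_insert S j hj a
  · intro a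
    rw [kk, lft_mul_kap, kap_mul_lft]
    congr 1
    ext b
    exact h.pe _ _ _ _

/-- The KZ-type operator. -/
def YY (e : J → Fin N → Fin N → R) (p : J → R) (d : R) (S : Finset J) (j : J) : R :=
  ∑ a, ∑ f, e j a f * XX e p d S a f

lemma YY_CC (h : GD e p d) (ho : Osc e) (S : Finset J) (j : J) (hj : j ∉ S)
    (h1 : ∑ a, e j a a = 1) : YY e p d S j * CC e p d S j = DD e p d S := by
  rw [CC, ← Phi_lft_mul, DD_eq_Phi]
  congr 1
  have key : ∀ i, lft (YY e p d S j) * kk e j i = ∑ a, lft (e j a i) * Th e p d S a := by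
    intro i
    simp only [kk, Th, lft_mul_kap]
    rw [← kap_sum]
    congr 1
    ext b
    rw [YY, Finset.sum_mul]
    refine Finset.sum_congr rfl fun a _ => ?_
    rw [Finset.sum_mul, Finset.sum_eq_single b]
    · rw [mul_assoc, XX_comm_e h S j hj, ← mul_assoc, ho, if_pos rfl]
    · intro f _ hf
      rw [mul_assoc, XX_comm_e h S j hj, ← mul_assoc, ho, if_neg hf, zero_mul]
    · simp
  rw [Finset.mul_sum]
  have : ∀ i, lft (YY e p d S j) * (kk e j i * Zr (Th e p d S) (List.finRange N) i) =
      lft (e j i i) * ((List.finRange N).map (Th e p d S)).prod := by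
    intro i
    rw [← mul_assoc, key, Finset.sum_mul, Finset.sum_eq_single i]
    · rw [mul_assoc, mul_Zr _ (Th_anti h S) (Th_sq h S) _ _ _ (List.nodup_finRange N)
        (List.mem_finRange _) (List.mem_finRange _), if_pos rfl]
    · intro a _ ha
      rw [mul_assoc, mul_Zr _ (Th_anti h S) (Th_sq h S) _ _ _ (List.nodup_finRange N)
        (List.mem_finRange _) (List.mem_finRange _), if_neg ha, mul_zero]
    · simp
  rw [Finset.sum_congr rfl fun i _ => this i, ← Finset.sum_mul, ← lft_sum, h1, lft_one, one_mul]

/-- Coefficient operators of the pole expansion. -/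
def AS (e : J → Fin N → Fin N → R) (S : Finset J) : R :=
  Phi (BS (psi R) (kk e) (List.finRange N) S)

lemma AS_eq_zero (S : Finset J) (hS : N < S.card) : AS e S = 0 := by
  rw [AS, BS_eq_zero _ _ _ _ (by simpa using hS), map_zero]

lemma DD_expand (h : GD e p d) (ho : Osc e) (P : Finset J → R)
    (hP0 : P ∅ = 1) (hPi : ∀ j S, j ∉ S → P (insert j S) = p j * P S) (S0 : Finset J) :
    DD e p d S0 = ∑ S ∈ S0.powerset, (-1 : R) ^ S.card * (P S * AS e S * d ^ (N - S.card)) := by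
  have hc : ∀ (r : R) (y : Fin N → R), (∀ b, r * y b = y b * r) →
      Commute (lft r) (kap y : R ⊗[ℂ] Lam N) := by
    intro r y hy
    rw [commute_iff_eq, lft_mul_kap, kap_mul_lft]
    congr 1
    ext b
    exact hy b
  have hc1 : ∀ (r : R) (a : Fin N), Commute (lft r) (psi R a) := by
    intro r a
    refine hc _ _ fun b => ?_
    by_cases hb : b = a
    · subst hb; simp
    · simp [hb]
  have := prod_expansion (psi R) (kk e) (fun a b => psi_kk_gen a _)
    (fun j a b => by rw [kk, psi_kk_gen, neg_neg]) (kk_osc ho)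
    (fun i j a b hij => kk_comm h i j hij a b) (fun j => lft (p j)) (lft d)
    (fun i j => by rw [commute_iff_eq, ← lft_mul, ← lft_mul, h.pp])
    (fun j => by rw [← lft_mul, ← lft_mul, ← lft_mul, h.dp, lft_sub])
    (fun a => hc1 _ _) (fun j a => hc _ _ fun b => h.de _ _ _)
    (fun j a => hc1 _ _) (fun i j a => hc _ _ fun b => h.pe _ _ _ _)
    (fun S => lft (P S)) (by simp only [hP0, lft_one]) (fun j S hj => by rw [hPi j S hj, lft_mul])
    S0 (List.finRange N)
  rw [DD_eq_Phi]
  have h2 : Th e p d S0 = fun a => psi R a * lft d - ∑ j ∈ S0, lft (p j) * kk e j a := by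
    ext a; exact Th_eq S0 a
  rw [h2, this, map_sum]
  refine Finset.sum_congr rfl fun S _ => ?_
  have h3 : ((-1 : R ⊗[ℂ] Lam N)) ^ S.card = lft ((-1) ^ S.card) := by
    rw [lft_pow, lft_neg, lft_one]
  rw [h3, ← lft_pow, Phi_lft_mul, Phi_mul_lft, Phi_lft_mul, AS, List.length_finRange]

lemma BS_map {A B ι : Type*} [Ring A] [Ring B] (f : A →+* B) (ψ : ι → A) (k : J → ι → A) :
    ∀ (l : List ι) (S : Finset J), f (BS ψ k l S) = BS (fun a => f (ψ a)) (fun j a => f (k j a)) l S := by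
  intro l
  induction l with
  | nil => intro S; simp only [BS]; split_ifs <;> simp
  | cons a l ih => intro S; simp [BS, ih]

lemma AS_map {R' : Type*} [Ring R'] [Algebra ℂ R'] (f : R →ₐ[ℂ] R') (S : Finset J) :
    f (AS e S) = AS (fun j a b => f (e j a b)) S := by
  let F : R ⊗[ℂ] Lam N →ₐ[ℂ] R' ⊗[ℂ] Lam N := Algebra.TensorProduct.map f (AlgHom.id ℂ _)
  have hk : ∀ y : Fin N → R, F (kap y) = kap (fun b => f (y b)) := by
    intro y; simp [F, kap]
  have hP : ∀ x, f (Phi x) = Phi (F x) := by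
    intro x
    induction x using TensorProduct.induction_on with
    | zero => simp
    | tmul s y => simp [F, Phi_tmul]
    | add x y hx hy => simp only [map_add, hx, hy]
  rw [AS, hP, AS]
  congr 1
  have := BS_map (F : R ⊗[ℂ] Lam N →+* R' ⊗[ℂ] Lam N) (psi R) (kk e) (List.finRange N) S
  refine this.trans ?_
  congr 1
  · ext a
    change F (kap _) = _
    rw [hk, psi]
    congr 1
    ext b
    by_cases hb : b = a
    · subst hb; simp
    · simp [hb]
  · ext j a
    exact hk _

end
end GaudinAux

set_option linter.unusedSectionVars false
set_option linter.unusedSimpArgs false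
set_option linter.unusedVariables false
namespace GaudinAux
open Filter Topology

section Hol
variable (U : TopologicalSpace.Opens ℂ) (M : Type*) [NormedAddCommGroup M] [NormedSpace ℂ M]

/-- Holomorphic functions on `U`, extended by zero. -/
def HolSub : Submodule ℂ (ℂ → M) where
  carrier := {f | AnalyticOnNhd ℂ f U ∧ ∀ u ∉ U, f u = 0}
  add_mem' := fun {f g} hf hg => ⟨hf.1.add hg.1, fun u hu => by simp [hf.2 u hu, hg.2 u hu]⟩
  zero_mem' := ⟨analyticOnNhd_const, fun _ _ => rfl⟩
  smul_mem' := fun c f hf => ⟨analyticOnNhd_const.smul hf.1, fun u hu => by simp [hf.2 u hu]⟩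

/-- The type of holomorphic functions on `U`, extended by zero. -/
def HolS : Type _ := HolSub U M

instance : AddCommGroup (HolS U M) := inferInstanceAs (AddCommGroup (HolSub U M))
instance : Module ℂ (HolS U M) := inferInstanceAs (Module ℂ (HolSub U M))

variable {U M}

lemma HolS.add_apply (F G : HolS U M) (u : ℂ) : (F + G).1 u = F.1 u + G.1 u := rfl
lemma HolS.sub_apply (F G : HolS U M) (u : ℂ) : (F - G).1 u = F.1 u - G.1 u := rfl
lemma HolS.neg_apply (F : HolS U M) (u : ℂ) : (-F).1 u = -F.1 u := rfl
lemma HolS.smul_apply (c : ℂ) (F : HolS U M) (u : ℂ) : (c • F).1 u = c • F.1 u := rfl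
lemma HolS.zero_apply (u : ℂ) : (0 : HolS U M).1 u = 0 := rfl

lemma HolS.ext' {F G : HolS U M} (h : ∀ u ∈ U, F.1 u = G.1 u) : F = G := by
  apply Subtype.ext
  ext u
  by_cases hu : u ∈ U
  · exact h u hu
  · rw [F.2.2 u hu, G.2.2 u hu]

open Classical in
/-- Restriction to `U`. -/
def resS (f : ℂ → M) (hf : AnalyticOnNhd ℂ f U) : HolS U M :=
  ⟨fun u => if u ∈ U then f u else 0, by
    constructor
    · intro u hu
      refine (hf u hu).congr ?_
      filter_upwards [U.isOpen.mem_nhds hu] with x hx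
      have : x ∈ U := hx
      simp [this]
    · intro u hu; simp [hu]⟩

lemma resS_apply (f : ℂ → M) (hf : AnalyticOnNhd ℂ f U) {u : ℂ} (hu : u ∈ U) :
    (resS f hf).1 u = f u := by simp [resS, hu]

lemma HolS.eventuallyEq {F G : ℂ → M} (h : ∀ u ∈ U, F u = G u) {u : ℂ} (hu : u ∈ U) :
    F =ᶠ[𝓝 u] G := by
  filter_upwards [U.isOpen.mem_nhds hu] with x hx using h x hx

variable [FiniteDimensional ℂ M] {M' : Type*} [NormedAddCommGroup M'] [NormedSpace ℂ M']
  [FiniteDimensional ℂ M']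

lemma analytic_deriv {f : ℂ → M} {s : Set ℂ} (hf : AnalyticOnNhd ℂ f s) :
    AnalyticOnNhd ℂ (deriv f) s := by
  have := FiniteDimensional.complete ℂ M
  exact hf.deriv

lemma analytic_lin (A : M →ₗ[ℂ] M') {f : ℂ → M} {s : Set ℂ} (hf : AnalyticOnNhd ℂ f s) :
    AnalyticOnNhd ℂ (fun u => A (f u)) s :=
  (LinearMap.toContinuousLinearMap A).comp_analyticOnNhd hf

lemma deriv_lin (A : M →ₗ[ℂ] M') {f : ℂ → M} {u : ℂ} (hf : AnalyticAt ℂ f u) :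
    deriv (fun u => A (f u)) u = A (deriv f u) :=
  ((LinearMap.toContinuousLinearMap A).hasFDerivAt.comp_hasDerivAt u
    hf.differentiableAt.hasDerivAt).deriv

/-- The derivation. -/
def dS : Module.End ℂ (HolS U M) where
  toFun F := resS (deriv F.1) (analytic_deriv F.2.1)
  map_add' F G := HolS.ext' fun u hu => by
    rw [resS_apply _ _ hu]
    simp only [HolS.add_apply]
    rw [resS_apply _ _ hu, resS_apply _ _ hu]
    exact deriv_add (F.2.1 u hu).differentiableAt (G.2.1 u hu).differentiableAt
  map_smul' c F := HolS.ext' fun u hu => by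
    rw [resS_apply _ _ hu]
    simp only [HolS.smul_apply, RingHom.id_apply]
    rw [resS_apply _ _ hu]
    exact deriv_const_smul c (F.2.1 u hu).differentiableAt

lemma dS_apply (F : HolS U M) {u : ℂ} (hu : u ∈ U) : (dS F).1 u = deriv F.1 u :=
  resS_apply _ (analytic_deriv F.2.1) hu

/-- Multiplication by a holomorphic function. -/
def mulS (q : ℂ → ℂ) (hq : AnalyticOnNhd ℂ q U) : Module.End ℂ (HolS U M) where
  toFun F := resS (fun u => q u • F.1 u) (hq.smul F.2.1)
  map_add' F G := HolS.ext' fun u hu => by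
    rw [resS_apply _ _ hu]
    simp only [HolS.add_apply]
    rw [resS_apply _ _ hu, resS_apply _ _ hu, smul_add]
  map_smul' c F := HolS.ext' fun u hu => by
    rw [resS_apply _ _ hu]
    simp only [HolS.smul_apply, RingHom.id_apply]
    rw [resS_apply _ _ hu, smul_comm]

lemma mulS_apply (q : ℂ → ℂ) (hq : AnalyticOnNhd ℂ q U) (F : HolS U M) {u : ℂ} (hu : u ∈ U) :
    (mulS q hq F).1 u = q u • F.1 u := resS_apply _ (hq.smul F.2.1) hu

/-- Postcomposition with a linear map. -/
def hS (A : M →ₗ[ℂ] M') : HolS U M →ₗ[ℂ] HolS U M' where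
  toFun F := ⟨fun u => A (F.1 u), analytic_lin A F.2.1, fun u hu => by
    show A (F.1 u) = 0
    rw [F.2.2 u hu, map_zero]⟩
  map_add' F G := HolS.ext' fun u hu => map_add A _ _
  map_smul' c F := HolS.ext' fun u hu => map_smul A _ _

lemma hS_apply (A : M →ₗ[ℂ] M') (F : HolS U M) (u : ℂ) : (hS A F).1 u = A (F.1 u) := rfl

/-- Pointwise action of endomorphisms. -/
def opS : Module.End ℂ M →ₐ[ℂ] Module.End ℂ (HolS U M) :=
  AlgHom.ofLinearMap
    { toFun := fun A => hS A
      map_add' := fun A B => rfl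
      map_smul' := fun c A => rfl } rfl (fun A B => rfl)

lemma opS_apply (A : Module.End ℂ M) (F : HolS U M) (u : ℂ) : (opS A F).1 u = A (F.1 u) := rfl

lemma dS_hS (A : M →ₗ[ℂ] M') (F : HolS U M) : dS (hS A F) = hS A (dS F) := by
  refine HolS.ext' fun u hu => ?_
  rw [dS_apply _ hu, hS_apply, dS_apply _ hu]
  exact deriv_lin A (F.2.1 u hu)

lemma mulS_hS (q : ℂ → ℂ) (hq : AnalyticOnNhd ℂ q U) (A : M →ₗ[ℂ] M') (F : HolS U M) :
    mulS q hq (hS A F) = hS A (mulS q hq F) := by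
  refine HolS.ext' fun u hu => ?_
  rw [mulS_apply _ _ _ hu, hS_apply, hS_apply, mulS_apply _ _ _ hu, map_smul]

lemma dS_mulS (q : ℂ → ℂ) (hq : AnalyticOnNhd ℂ q U) :
    (dS * mulS q hq : Module.End ℂ (HolS U M)) =
      mulS q hq * dS + mulS (deriv q) (analytic_deriv hq) := by
  refine LinearMap.ext fun F => HolS.ext' fun u hu => ?_
  simp only [Module.End.mul_apply, LinearMap.add_apply, HolS.add_apply]
  rw [dS_apply _ hu, mulS_apply _ _ _ hu, mulS_apply _ _ _ hu, dS_apply _ hu,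
    (HolS.eventuallyEq (fun x hx => mulS_apply q hq F hx) hu).deriv_eq]
  exact deriv_fun_smul (hq u hu).differentiableAt (F.2.1 u hu).differentiableAt

lemma analytic_pole (w : ℂ) (hw : w ∉ U) : AnalyticOnNhd ℂ (fun u => (u - w)⁻¹) U := by
  intro u hu
  refine (analyticAt_id.sub analyticAt_const).inv ?_
  intro h
  exact hw (by have : u = w := sub_eq_zero.1 h
               exact this ▸ hu)

/-- Multiplication by `1/(u-w)`. -/
def pS (w : ℂ) (hw : w ∉ U) : Module.End ℂ (HolS U M) := mulS _ (analytic_pole w hw)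

lemma pS_apply (w : ℂ) (hw : w ∉ U) (F : HolS U M) {u : ℂ} (hu : u ∈ U) :
    (pS w hw F).1 u = (u - w)⁻¹ • F.1 u := mulS_apply _ _ _ hu

lemma dS_pS (w : ℂ) (hw : w ∉ U) :
    (dS * pS w hw : Module.End ℂ (HolS U M)) = pS w hw * dS - pS w hw * pS w hw := by
  rw [pS, dS_mulS, sub_eq_add_neg]
  congr 1
  refine LinearMap.ext fun F => HolS.ext' fun u hu => ?_
  have hne : u - w ≠ 0 := fun h => hw (by
    have : u = w := sub_eq_zero.1 h
    exact this ▸ hu)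
  simp only [LinearMap.neg_apply, Module.End.mul_apply, HolS.neg_apply]
  rw [mulS_apply _ _ _ hu, mulS_apply _ _ _ hu, mulS_apply _ _ _ hu, smul_smul, ← neg_smul]
  congr 1
  have : HasDerivAt (fun u => (u - w)⁻¹) (-1 / (u - w) ^ 2) u :=
    ((hasDerivAt_id u).sub_const w).inv hne
  rw [this.deriv]
  field_simp

/-- Commuting actions of `gl_N`. -/
structure GLM {N : ℕ} {J : Type*} {M : Type*} [AddCommGroup M] [Module ℂ M]
    (e : J → Fin N → Fin N → Module.End ℂ M) : Prop where
  rel : ∀ j a b c f, e j a b * e j c f - e j c f * e j a b =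
    (if b = c then e j a f else 0) - (if f = a then e j c b else 0)
  comm : ∀ i j, i ≠ j → ∀ a b c f, e i a b * e j c f = e j c f * e i a b

variable {N : ℕ} {J : Type*}

/-- The operators on functions. -/
abbrev eS (e : J → Fin N → Fin N → Module.End ℂ M) :
    J → Fin N → Fin N → Module.End ℂ (HolS U M) := fun j a b => opS (e j a b)

/-- The poles. -/
abbrev zS (z : J → ℂ) (hz : ∀ j, z j ∉ U) : J → Module.End ℂ (HolS U M) := fun j => pS (z j) (hz j)

lemma GDS {e : J → Fin N → Fin N → Module.End ℂ M} (h : GLM e) (z : J → ℂ) (hz : ∀ j, z j ∉ U) :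
    GD (eS (U := U) e) (zS z hz) dS where
  rel j a b c f := by
    have := congrArg (opS (U := U)) (h.rel j a b c f)
    rw [map_sub, map_sub, map_mul, map_mul] at this
    rw [this]
    congr 1 <;> split_ifs <;> simp
  comm i j hij a b c f := by
    have := congrArg (opS (U := U)) (h.comm i j hij a b c f)
    rwa [map_mul, map_mul] at this
  pe i j a b := by
    refine LinearMap.ext fun F => ?_
    exact mulS_hS _ _ (e j a b) F
  de j a b := by
    refine LinearMap.ext fun F => ?_
    exact dS_hS (e j a b) F
  pp i j := by
    refine LinearMap.ext fun F => HolS.ext' fun u hu => ?_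
    simp only [Module.End.mul_apply]
    rw [pS_apply _ _ _ hu, pS_apply _ _ _ hu, pS_apply _ _ _ hu, pS_apply _ _ _ hu, smul_comm]
  dp j := dS_pS _ _

/-- The universal differential operator. -/
def DS [Fintype J] (e : J → Fin N → Fin N → Module.End ℂ M) (z : J → ℂ) (hz : ∀ j, z j ∉ U) :
    Module.End ℂ (HolS U M) := DD (eS e) (zS z hz) dS Finset.univ

lemma iter_dS (F : HolS U M) (i : ℕ) : ∀ {u : ℂ}, u ∈ U → ((dS ^ i) F).1 u = iteratedDeriv i F.1 u := by
  induction i with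
  | zero => intro u _; simp
  | succ i ih =>
    intro u hu
    rw [pow_succ', Module.End.mul_apply, dS_apply _ hu, iteratedDeriv_succ]
    exact (HolS.eventuallyEq (fun x hx => ih hx) hu).deriv_eq

lemma iter_resS (f : ℂ → M) (hf : AnalyticOnNhd ℂ f U) (i : ℕ) :
    ∀ {u : ℂ}, u ∈ U → ((dS ^ i) (resS f hf)).1 u = iteratedDeriv i f u := by
  induction i with
  | zero => intro u hu; simp [resS_apply _ _ hu]
  | succ i ih =>
    intro u hu
    rw [pow_succ', Module.End.mul_apply, dS_apply _ hu, iteratedDeriv_succ]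
    exact (HolS.eventuallyEq (fun x hx => ih hx) hu).deriv_eq

lemma list_prod_intertwine {A B : Type*} [AddCommGroup A] [Module ℂ A] [AddCommGroup B] [Module ℂ B]
    (h : A →ₗ[ℂ] B) : ∀ (k : ℕ) (x : Fin k → Module.End ℂ A) (y : Fin k → Module.End ℂ B),
    (∀ q F, y q (h F) = h (x q F)) → ∀ F, (List.ofFn y).prod (h F) = h ((List.ofFn x).prod F) := by
  intro k
  induction k with
  | zero => intro x y _ F; simp
  | succ k ih =>
    intro x y hxy F
    simp only [List.ofFn_succ, List.prod_cons, Module.End.mul_apply]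
    rw [ih (fun i => x i.succ) (fun i => y i.succ) (fun q F => hxy _ F), hxy]

lemma rdet_intertwine {A B : Type*} [AddCommGroup A] [Module ℂ A] [AddCommGroup B] [Module ℂ B]
    (h : A →ₗ[ℂ] B) (x : Fin N → Fin N → Module.End ℂ A) (y : Fin N → Fin N → Module.End ℂ B)
    (hxy : ∀ a b F, y a b (h F) = h (x a b F)) (F : A) : rdet y (h F) = h (rdet x F) := by
  simp only [rdet, LinearMap.sum_apply, map_sum, LinearMap.smul_apply]
  refine Finset.sum_congr rfl fun σ _ => ?_
  rw [list_prod_intertwine h N (fun q => x q (σ q)) (fun q => y q (σ q)) (fun q F => hxy _ _ F),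
    map_zsmul]

lemma DS_hS [Fintype J] (e : J → Fin N → Fin N → Module.End ℂ M)
    (e' : J → Fin N → Fin N → Module.End ℂ M') (z : J → ℂ) (hz : ∀ j, z j ∉ U)
    (A : M →ₗ[ℂ] M') (hA : ∀ j a b x, e' j a b (A x) = A (e j a b x)) (F : HolS U M) :
    DS e' z hz (hS A F) = hS A (DS e z hz F) := by
  refine rdet_intertwine (hS A) _ _ (fun a b F => ?_) F
  simp only [XX, LinearMap.sub_apply, LinearMap.sum_apply, map_sub, map_sum, Module.End.mul_apply]
  congr 1
  · split_ifs
    · exact dS_hS A F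
    · simp
  · refine Finset.sum_congr rfl fun j _ => ?_
    have : opS (U := U) (e' j b a) (hS A F) = hS A (opS (e j b a) F) := by
      refine HolS.ext' fun u hu => ?_
      exact hA j b a _
    rw [this]
    exact mulS_hS _ _ A _

/-- Filtration of operators. -/
def Fil (Y : Submodule ℂ M) (u0 : ℂ) (r : ℕ) : Submodule ℂ (Module.End ℂ (HolS U M)) where
  carrier := {O | ∀ F : HolS U M, (∀ i < r, ((dS ^ i) F).1 u0 ∈ Y) → (O F).1 u0 ∈ Y}
  add_mem' := fun {O O'} h h' F hF => Y.add_mem (h F hF) (h' F hF)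
  zero_mem' := fun F _ => Y.zero_mem
  smul_mem' := fun c O h F hF => Y.smul_mem c (h F hF)

section FilS
variable {Y : Submodule ℂ M} {u0 : ℂ}

lemma Fil_mono {r s : ℕ} (hrs : r ≤ s) {O : Module.End ℂ (HolS U M)} (h : O ∈ Fil Y u0 r) :
    O ∈ Fil Y u0 s := fun F hF => h F fun i hi => hF i (by omega)

lemma Fil_d {r : ℕ} {O : Module.End ℂ (HolS U M)} (h : O ∈ Fil Y u0 r) :
    O * dS ∈ Fil Y u0 (r + 1) := fun F hF => h (dS F) fun i hi => by
  have := hF (i + 1) (by omega)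
  rwa [pow_succ, Module.End.mul_apply] at this

lemma dpow_mem (i : ℕ) : (dS ^ i : Module.End ℂ (HolS U M)) ∈ Fil Y u0 (i + 1) :=
  fun F hF => hF i (by omega)

lemma dpow_mul_mem (hu : u0 ∈ U) (i : ℕ) : ∀ (q : ℂ → ℂ) (hq : AnalyticOnNhd ℂ q U),
    (dS ^ i * mulS q hq : Module.End ℂ (HolS U M)) ∈ Fil Y u0 (i + 1) := by
  induction i with
  | zero =>
    intro q hq F hF
    rw [pow_zero, one_mul, mulS_apply _ _ _ hu]
    exact Y.smul_mem _ (hF 0 (by omega))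
  | succ i ih =>
    intro q hq
    rw [pow_succ, mul_assoc, dS_mulS, mul_add, ← mul_assoc]
    exact Submodule.add_mem _ (Fil_d (ih q hq)) (Fil_mono (by omega) (ih _ _))

lemma Fil_mul (hu : u0 ∈ U) {r : ℕ} {O : Module.End ℂ (HolS U M)} (h : O ∈ Fil Y u0 r)
    (q : ℂ → ℂ) (hq : AnalyticOnNhd ℂ q U) : O * mulS q hq ∈ Fil Y u0 r := fun F hF =>
  h _ fun i hi => dpow_mul_mem hu i q hq F fun i' hi' => hF i' (by omega)

lemma dpow_hS (A : M →ₗ[ℂ] M') (i : ℕ) (F : HolS U M) :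
    (dS ^ i) (hS A F) = hS A ((dS ^ i) F) := by
  induction i with
  | zero => rfl
  | succ i ih => rw [pow_succ', Module.End.mul_apply, ih, dS_hS]; rw [pow_succ' (dS : Module.End ℂ (HolS U M)), Module.End.mul_apply]

lemma Fil_op {r : ℕ} {O : Module.End ℂ (HolS U M)} (h : O ∈ Fil Y u0 r)
    (A : Module.End ℂ M) (hA : ∀ x ∈ Y, A x ∈ Y) : O * opS A ∈ Fil Y u0 r := fun F hF =>
  h _ fun i hi => by
    have : (dS ^ i) (opS A F) = hS A ((dS ^ i) F) := dpow_hS A i F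
    rw [this]
    exact hA _ (hF i hi)

lemma Fil_XX (hu : u0 ∈ U) {e : J → Fin N → Fin N → Module.End ℂ M}
    (z : J → ℂ) (hz : ∀ j, z j ∉ U) (hY : ∀ j a b, ∀ x ∈ Y, e j a b x ∈ Y) (S : Finset J)
    {r : ℕ} {O : Module.End ℂ (HolS U M)} (h : O ∈ Fil Y u0 r) (a b : Fin N) :
    O * XX (eS e) (zS z hz) dS S a b - (if a = b then O * dS else 0) ∈ Fil Y u0 r := by
  have : O * XX (eS e) (zS z hz) dS S a b - (if a = b then O * dS else 0) =
      - ∑ j ∈ S, O * pS (z j) (hz j) * opS (e j b a) := by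
    rw [XX, mul_sub, Finset.mul_sum]
    simp only [mul_assoc]
    split_ifs
    · abel
    · simp
  rw [this]
  refine Submodule.neg_mem _ (Submodule.sum_mem _ fun j _ => ?_)
  exact Fil_op (Fil_mul hu h _ _) _ (hY j b a)

lemma Fil_prod (hu : u0 ∈ U) {e : J → Fin N → Fin N → Module.End ℂ M}
    (z : J → ℂ) (hz : ∀ j, z j ∉ U) (hY : ∀ j a b, ∀ x ∈ Y, e j a b x ∈ Y) (S : Finset J)
    (k : ℕ) (l : List (Fin N × Fin N)) :
    dS ^ k * (l.map fun x => XX (eS e) (zS z hz) dS S x.1 x.2).prod -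
      (if ∀ x ∈ l, x.1 = x.2 then dS ^ (k + l.length) else 0) ∈ Fil (U := U) Y u0 (k + l.length) := by
  induction l using List.reverseRecOn with
  | nil => simp
  | append_singleton l x ih =>
    rw [List.map_append, List.prod_append, List.length_append, ← mul_assoc]
    simp only [List.map_cons, List.map_nil, List.prod_cons, List.prod_nil, mul_one,
      List.length_cons, List.length_nil, zero_add]
    set O := dS ^ k * (l.map fun x => XX (eS e) (zS z hz) dS S x.1 x.2).prod with hO
    set X := XX (eS (U := U) e) (zS z hz) dS S x.1 x.2 with hX
    set T : Module.End ℂ (HolS U M) := (if ∀ x ∈ l, x.1 = x.2 then dS ^ (k + l.length) else 0) with hT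
    have hTm : T ∈ Fil Y u0 (k + l.length + 1) := by
      rw [hT]; split_ifs
      · exact dpow_mem _
      · exact Submodule.zero_mem _
    have h1 := Fil_XX hu z hz hY S ih x.1 x.2
    have h2 := Fil_XX hu z hz hY S hTm x.1 x.2
    have h3 := Fil_d ih
    have h4 : O * X - (if ∀ y ∈ l ++ [x], y.1 = y.2 then dS ^ (k + (l.length + 1)) else 0) =
        ((O - T) * X - (if x.1 = x.2 then (O - T) * dS else 0)) +
        (T * X - (if x.1 = x.2 then T * dS else 0)) +
        (if x.1 = x.2 then (O - T) * dS else 0) := by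
      have h5 : (if ∀ y ∈ l ++ [x], y.1 = y.2 then (dS ^ (k + (l.length + 1)) : Module.End ℂ (HolS U M)) else 0)
          = (if x.1 = x.2 then T * dS else 0) := by
        rw [hT]
        by_cases hx : x.1 = x.2
        · by_cases hl : ∀ y ∈ l, y.1 = y.2
          · rw [if_pos hx, if_pos hl, if_pos, ← pow_succ, add_assoc]
            intro y hy
            rcases List.mem_append.1 hy with h | h
            · exact hl y h
            · rw [List.mem_singleton.1 h]; exact hx
          · rw [if_pos hx, if_neg hl, if_neg, zero_mul]
            intro hh; exact hl fun y hy => hh y (List.mem_append_left _ hy)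
        · rw [if_neg hx, if_neg]
          intro hh; exact hx (hh x (by simp))
      rw [h5]
      rw [sub_mul]
      abel
    rw [h4, ← add_assoc]
    refine Submodule.add_mem _ (Submodule.add_mem _ (Fil_mono (by omega) h1) h2) ?_
    split_ifs
    · exact h3
    · exact Submodule.zero_mem _

lemma Fil_DS [Fintype J] (hu : u0 ∈ U) {e : J → Fin N → Fin N → Module.End ℂ M}
    (z : J → ℂ) (hz : ∀ j, z j ∉ U) (hY : ∀ j a b, ∀ x ∈ Y, e j a b x ∈ Y) (k : ℕ) :
    dS ^ k * DS e z hz - dS ^ (k + N) ∈ Fil (U := U) Y u0 (k + N) := by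
  have h1 : ∀ σ : Equiv.Perm (Fin N), dS ^ k * (List.ofFn fun q =>
      XX (eS e) (zS z hz) dS Finset.univ q (σ q)).prod - (if σ = 1 then dS ^ (k + N) else 0)
      ∈ Fil (U := U) Y u0 (k + N) := by
    intro σ
    have h0 := Fil_prod hu z hz hY Finset.univ k (List.ofFn fun q => (q, σ q))
    rw [List.map_ofFn, List.length_ofFn] at h0
    have : σ = 1 ↔ ∀ x ∈ List.ofFn fun q => (q, σ q), x.1 = x.2 := by
      rw [List.forall_mem_ofFn_iff]
      constructor
      · rintro rfl; simp
      · intro h; ext q; exact congrArg Fin.val (h q).symm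
    rw [if_congr this rfl rfl]
    exact h0
  have h2 : dS ^ k * DS e z hz - dS ^ (k + N) = ∑ σ : Equiv.Perm (Fin N),
      ((Equiv.Perm.sign σ : ℤˣ) : ℤ) • (dS ^ k * (List.ofFn fun q =>
      XX (eS (U := U) e) (zS z hz) dS Finset.univ q (σ q)).prod - (if σ = 1 then dS ^ (k + N) else 0)) := by
    simp only [smul_sub, Finset.sum_sub_distrib, smul_ite, smul_zero]
    rw [DS, DD, rdet, Finset.mul_sum]
    congr 1
    · exact Finset.sum_congr rfl fun σ _ => mul_smul_comm _ _ _
    · simp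
  rw [h2]
  exact Submodule.sum_mem _ fun σ _ => Submodule.smul_of_tower_mem _ _ (h1 σ)

/-- Solutions whose initial jet is in an invariant subspace have all jets there. -/
lemma jets_mem [Fintype J] (hu : u0 ∈ U) {e : J → Fin N → Fin N → Module.End ℂ M}
    (z : J → ℂ) (hz : ∀ j, z j ∉ U) (hY : ∀ j a b, ∀ x ∈ Y, e j a b x ∈ Y) (F : HolS U M)
    (hF : DS e z hz F = 0) (hj : ∀ i < N, ((dS ^ i) F).1 u0 ∈ Y) (i : ℕ) :
    ((dS ^ i) F).1 u0 ∈ Y := by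
  induction i using Nat.strong_induction_on with
  | _ i ih =>
    by_cases hi : i < N
    · exact hj i hi
    · obtain ⟨k, rfl⟩ := Nat.exists_eq_add_of_le (not_lt.1 hi)
      rw [add_comm]
      have := Fil_DS hu z hz hY k F fun i hi => ih i (by omega)
      rw [LinearMap.sub_apply, Module.End.mul_apply, hF, map_zero, zero_sub, HolS.neg_apply] at this
      simpa using this

lemma eqOn_of_jets (hU : IsPreconnected (U : Set ℂ)) (hu : u0 ∈ U) (F : HolS U M)
    (h : ∀ i, ((dS ^ i) F).1 u0 = 0) : F = 0 := by
  have := FiniteDimensional.complete ℂ M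
  have h1 : analyticOrderAt F.1 u0 = ⊤ := by
    rw [ENat.eq_top_iff_forall_ge]
    intro n
    rw [natCast_le_analyticOrderAt_iff_iteratedDeriv_eq_zero (F.2.1 u0 hu)]
    intro i _
    rw [← iter_dS F i hu, h]
  rw [analyticOrderAt_eq_top] at h1
  have h2 := F.2.1.eqOn_zero_of_preconnected_of_eventuallyEq_zero hU hu h1
  exact HolS.ext' fun u hu => h2 hu

/-- Uniqueness for the initial value problem. -/
lemma uniq [Fintype J] (hU : IsPreconnected (U : Set ℂ)) (hu : u0 ∈ U)
    {e : J → Fin N → Fin N → Module.End ℂ M}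
    (z : J → ℂ) (hz : ∀ j, z j ∉ U) (F : HolS U M)
    (hF : DS e z hz F = 0) (hj : ∀ i < N, ((dS ^ i) F).1 u0 = 0) : F = 0 := by
  refine eqOn_of_jets hU hu F fun i => ?_
  have := jets_mem (Y := ⊥) hu z hz (by intro j a b x hx; rw [Submodule.mem_bot] at hx ⊢; rw [hx, map_zero])
    F hF (fun i hi => by rw [Submodule.mem_bot]; exact hj i hi) i
  simpa using this

/-- Solutions with initial jet in an invariant subspace take values there. -/
lemma values_mem [Fintype J] (hU : IsPreconnected (U : Set ℂ)) (hu : u0 ∈ U)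
    {e : J → Fin N → Fin N → Module.End ℂ M}
    (z : J → ℂ) (hz : ∀ j, z j ∉ U) (hY : ∀ j a b, ∀ x ∈ Y, e j a b x ∈ Y) (F : HolS U M)
    (hF : DS e z hz F = 0) (hj : ∀ i < N, ((dS ^ i) F).1 u0 ∈ Y) (u : ℂ) : F.1 u ∈ Y := by
  obtain ⟨π, hπ⟩ : ∃ π : M →ₗ[ℂ] M, LinearMap.ker π = Y := by
    obtain ⟨Q, hQ⟩ := Submodule.exists_isCompl Y
    exact ⟨Q.projection Y hQ.symm, Submodule.ker_projection _⟩
  have h1 : hS π F = 0 := by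
    refine eqOn_of_jets hU hu _ fun i => ?_
    rw [dpow_hS, hS_apply]
    have := jets_mem hu z hz hY F hF hj i
    rwa [← hπ, LinearMap.mem_ker] at this
  rw [← hπ, LinearMap.mem_ker, ← hS_apply, h1]
  rfl

end FilS
end Hol
end GaudinAux

set_option linter.unusedSectionVars false
set_option linter.unusedSimpArgs false
set_option linter.unusedVariables false
namespace GaudinAux
open Filter Topology

section Pol
variable {M : Type*} [NormedAddCommGroup M] [NormedSpace ℂ M]

/-- Polynomial functions from coefficients. -/
def pfL (M : Type*) [NormedAddCommGroup M] [NormedSpace ℂ M] (D : ℕ) :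
    (Fin D → M) →ₗ[ℂ] (ℂ → M) where
  toFun c u := ∑ i : Fin D, u ^ (i : ℕ) • c i
  map_add' c c' := by ext u; simp [Finset.sum_add_distrib]
  map_smul' a c := by ext u; simp [Finset.smul_sum]; exact Finset.sum_congr rfl fun i _ => smul_comm _ _ _

lemma pfL_apply {D : ℕ} (c : Fin D → M) (u : ℂ) : pfL M D c u = ∑ i : Fin D, u ^ (i : ℕ) • c i := rfl

/-- Polynomial functions of degree `< D`. -/
def PolM (M : Type*) [NormedAddCommGroup M] [NormedSpace ℂ M] (D : ℕ) : Submodule ℂ (ℂ → M) :=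
  LinearMap.range (pfL M D)

lemma pfL_vanish {D : ℕ} (c : Fin D → M) (x : Fin D → ℂ) (hx : Function.Injective x)
    (h : ∀ i, pfL M D c (x i) = 0) : c = 0 := by
  ext i
  rw [Pi.zero_apply, ← Module.forall_dual_apply_eq_zero_iff ℂ]
  intro ℓ
  have : (fun i => ℓ (c i)) = 0 := by
    refine Matrix.eq_zero_of_forall_index_sum_mul_pow_eq_zero hx fun j => ?_
    have := congrArg ℓ (h j)
    rw [pfL_apply, map_sum, map_zero] at this
    rw [← this]
    exact Finset.sum_congr rfl fun i _ => by rw [map_smul, smul_eq_mul, mul_comm]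
  exact congrFun this i

lemma pfL_injective (D : ℕ) : Function.Injective (pfL M D) := by
  rw [← LinearMap.ker_eq_bot, LinearMap.ker_eq_bot']
  intro c hc
  refine pfL_vanish c (fun i => ((i : ℕ) : ℂ)) (fun i j h => Fin.ext (Nat.cast_injective (R := ℂ) h)) fun i => ?_
  rw [hc]; rfl

lemma mono_mem {D i : ℕ} (h : i < D) (v : M) : (fun u : ℂ => u ^ i • v) ∈ PolM M D := by
  refine ⟨Pi.single ⟨i, h⟩ v, ?_⟩
  ext u
  rw [pfL_apply, Finset.sum_eq_single ⟨i, h⟩]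
  · simp
  · intro b _ hb; simp [hb]
  · simp

lemma PolM_mono {D D' : ℕ} (h : D ≤ D') : PolM M D ≤ PolM M D' := by
  rintro _ ⟨c, rfl⟩
  have : pfL M D c = ∑ i : Fin D, fun u : ℂ => u ^ (i : ℕ) • c i := by
    ext u; simp [pfL_apply]
  rw [this]
  exact Submodule.sum_mem _ fun i _ => mono_mem (by omega) _

lemma PolM_mul_X {D : ℕ} {f : ℂ → M} (hf : f ∈ PolM M D) : (fun u => u • f u) ∈ PolM M (D + 1) := by
  obtain ⟨c, rfl⟩ := hf
  have : (fun u => u • pfL M D c u) = ∑ i : Fin D, fun u : ℂ => u ^ ((i : ℕ) + 1) • c i := by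
    ext u; simp [pfL_apply, Finset.smul_sum, smul_smul, pow_succ']
  rw [this]
  exact Submodule.sum_mem _ fun i _ => mono_mem (by omega) _

lemma PolM_mul_lin {D : ℕ} {f : ℂ → M} (hf : f ∈ PolM M D) (w : ℂ) :
    (fun u => (u - w) • f u) ∈ PolM M (D + 1) := by
  have : (fun u => (u - w) • f u) = (fun u => u • f u) - w • f := by
    ext u; simp [sub_smul]
  rw [this]
  exact Submodule.sub_mem _ (PolM_mul_X hf) (Submodule.smul_mem _ _ (PolM_mono (by omega) hf))

lemma PolM_mul_prod {J : Type*} [DecidableEq J] (z : J → ℂ) (S : Finset J) {D : ℕ} {f : ℂ → M}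
    (hf : f ∈ PolM M D) : (fun u => (∏ l ∈ S, (u - z l)) • f u) ∈ PolM M (D + S.card) := by
  induction S using Finset.induction_on with
  | empty => simpa using hf
  | insert j S hj ih =>
    rw [Finset.card_insert_of_notMem hj, ← add_assoc]
    convert PolM_mul_lin ih (z j) using 2 with u
    rw [Finset.prod_insert hj, smul_smul]

lemma PolM_lin {M' : Type*} [NormedAddCommGroup M'] [NormedSpace ℂ M'] (A : M →ₗ[ℂ] M') {D : ℕ} {f : ℂ → M} (hf : f ∈ PolM M D) :
    (fun u => A (f u)) ∈ PolM M' D := by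
  obtain ⟨c, rfl⟩ := hf
  refine ⟨fun i => A (c i), ?_⟩
  ext u; simp [pfL_apply]

lemma hasDerivAt_pfL {D : ℕ} (c : Fin D → M) (u : ℂ) :
    HasDerivAt (pfL M D c) (∑ i : Fin D, (((i : ℕ) : ℂ) * u ^ ((i : ℕ) - 1)) • c i) u := by
  have := HasDerivAt.fun_sum (u := Finset.univ) (A := fun (i : Fin D) (u : ℂ) => u ^ (i : ℕ) • c i)
    (A' := fun i => (((i : ℕ) : ℂ) * u ^ ((i : ℕ) - 1)) • c i) (x := u)
    (fun i _ => (hasDerivAt_pow (i : ℕ) u).smul_const (c i))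
  exact this

lemma PolM_deriv {D : ℕ} {f : ℂ → M} (hf : f ∈ PolM M D) : deriv f ∈ PolM M (D - 1) := by
  obtain ⟨c, rfl⟩ := hf
  have : deriv (pfL M D c) = ∑ i : Fin D, fun u : ℂ => u ^ ((i : ℕ) - 1) • (((i : ℕ) : ℂ) • c i) := by
    ext u; rw [(hasDerivAt_pfL c u).deriv]; simp [smul_smul, mul_comm]
  rw [this]
  refine Submodule.sum_mem _ fun i _ => ?_
  by_cases h : (i : ℕ) = 0
  · rw [h]; simp only [Nat.cast_zero, zero_smul, smul_zero]; exact Submodule.zero_mem _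
  · exact mono_mem (by omega) _

lemma PolM_iter {D : ℕ} {f : ℂ → M} (hf : f ∈ PolM M D) (i : ℕ) :
    iteratedDeriv i f ∈ PolM M (D - i) := by
  induction i with
  | zero => simpa using hf
  | succ i ih => rw [iteratedDeriv_succ]; exact PolM_deriv ih

lemma PolM_diff {D : ℕ} {f : ℂ → M} (hf : f ∈ PolM M D) : Differentiable ℂ f := by
  obtain ⟨c, rfl⟩ := hf
  exact fun u => (hasDerivAt_pfL c u).differentiableAt

lemma PolM_analytic [FiniteDimensional ℂ M] {D : ℕ} {f : ℂ → M} (hf : f ∈ PolM M D) (s : Set ℂ) :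
    AnalyticOnNhd ℂ f s := by
  have := FiniteDimensional.complete ℂ M
  exact fun u _ => (PolM_diff hf).analyticAt u

lemma PolM_deriv_cont {D : ℕ} {f : ℂ → M} (hf : f ∈ PolM M D) : Continuous (deriv f) :=
  (PolM_diff (PolM_deriv hf)).continuous

lemma iter_add_pol {D : ℕ} {f g : ℂ → M} (hf : f ∈ PolM M D) (hg : g ∈ PolM M D) (i : ℕ) :
    iteratedDeriv i (f + g) = iteratedDeriv i f + iteratedDeriv i g := by
  induction i with
  | zero => simp
  | succ i ih =>
    rw [iteratedDeriv_succ, ih, iteratedDeriv_succ, iteratedDeriv_succ]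
    ext u
    exact deriv_add (PolM_diff (PolM_iter hf i) u) (PolM_diff (PolM_iter hg i) u)

lemma iter_smul_pol {D : ℕ} {f : ℂ → M} (hf : f ∈ PolM M D) (c : ℂ) (i : ℕ) :
    iteratedDeriv i (c • f) = c • iteratedDeriv i f := by
  induction i with
  | zero => simp
  | succ i ih =>
    rw [iteratedDeriv_succ, ih, iteratedDeriv_succ]
    ext u
    exact deriv_const_smul c (PolM_diff (PolM_iter hf i) u)

/-- Polynomial functions vanishing at enough points vanish. -/
lemma PolM_eq_zero {D : ℕ} {f : ℂ → M} (hf : f ∈ PolM M D) (x : Fin D → ℂ)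
    (hx : Function.Injective x) (h : ∀ i, f (x i) = 0) : f = 0 := by
  obtain ⟨c, rfl⟩ := hf
  rw [pfL_vanish c x hx h, map_zero]

lemma PolM_eq_zero' {D : ℕ} {f : ℂ → M} (hf : f ∈ PolM M D) (s : Set ℂ)
    (hs : s.Infinite) (h : ∀ u ∈ s, f u = 0) : f = 0 := by
  obtain ⟨t, ht, hc⟩ := hs.exists_subset_card_eq D
  refine PolM_eq_zero hf (fun i => (t.equivFin.symm (Fin.cast hc.symm i) : ℂ)) ?_ fun i => ?_
  · intro i j hij
    have := t.equivFin.symm.injective (Subtype.ext hij)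
    simpa using this
  · exact h _ (ht (Subtype.coe_prop _))

lemma PolM_finrank [FiniteDimensional ℂ M] (D : ℕ) :
    Module.finrank ℂ (PolM M D) = D * Module.finrank ℂ M := by
  rw [PolM, LinearMap.finrank_range_of_inj (pfL_injective D), Module.finrank_pi_fintype]
  simp

instance PolM_fd [FiniteDimensional ℂ M] (D : ℕ) : FiniteDimensional ℂ (PolM M D) := by
  unfold PolM; infer_instance

end Pol
end GaudinAux

set_option linter.unusedSectionVars false
set_option linter.unusedSimpArgs false
set_option linter.unusedVariables false
namespace GaudinAux
open Filter Topology

section Cal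
variable {M : Type*} [NormedAddCommGroup M] [NormedSpace ℂ M] [FiniteDimensional ℂ M]
  {N : ℕ} {J : Type*} [DecidableEq J] {U : TopologicalSpace.Opens ℂ}

/-- Evaluation. -/
def evS (u : ℂ) : HolS U M →ₗ[ℂ] M where
  toFun F := F.1 u
  map_add' _ _ := rfl
  map_smul' _ _ := rfl

lemma evS_apply (u : ℂ) (F : HolS U M) : evS u F = F.1 u := rfl

/-- The polynomial form of the universal operator. -/
def calD (e : J → Fin N → Fin N → Module.End ℂ M) (z : J → ℂ) (S0 : Finset J) (f : ℂ → M) (u : ℂ) :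
    M := ∑ S ∈ S0.powerset,
  (-1 : ℂ) ^ S.card • (∏ l ∈ S0 \ S, (u - z l)) • AS e S (iteratedDeriv (N - S.card) f u)

lemma analytic_prodpole (z : J → ℂ) (hz : ∀ j, z j ∉ U) (S : Finset J) :
    AnalyticOnNhd ℂ (fun u => ∏ j ∈ S, (u - z j)⁻¹) U :=
  Finset.analyticOnNhd_fun_prod _ fun j _ => analytic_pole (z j) (hz j)

lemma calD_eq {e : J → Fin N → Fin N → Module.End ℂ M} (hG : GLM e) (ho : Osc e) (z : J → ℂ)
    (hz : ∀ j, z j ∉ U) (S0 : Finset J) (f : ℂ → M) (hf : AnalyticOnNhd ℂ f U) {u : ℂ} (hu : u ∈ U) :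
    (∏ l ∈ S0, (u - z l)) • (DD (eS e) (zS z hz) dS S0 (resS f hf)).1 u = calD e z S0 f u := by
  have ho' : Osc (eS (U := U) e) := by
    intro j a b c f
    have := congrArg (opS (U := U)) (ho j a b c f)
    rw [map_mul] at this
    rw [this]; split_ifs <;> simp
  have hne : ∀ l, u - z l ≠ 0 := fun l h => hz l (by
    have : u = z l := sub_eq_zero.1 h
    exact this ▸ hu)
  rw [DD_expand (GDS hG z hz) ho' (fun S => mulS _ (analytic_prodpole z hz S)) ?_ ?_ S0, calD,
    LinearMap.sum_apply, ← evS_apply, map_sum, Finset.smul_sum]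
  · refine Finset.sum_congr rfl fun S hS => ?_
    have h1 : ((-1 : Module.End ℂ (HolS U M)) ^ S.card) = algebraMap ℂ _ ((-1) ^ S.card) := by simp
    have h2 : AS (eS (U := U) e) S = opS (AS e S) := (AS_map opS S).symm
    rw [h1, h2, Module.End.mul_apply, Module.algebraMap_end_apply, map_smul, smul_comm]
    congr 1
    rw [Module.End.mul_apply, Module.End.mul_apply, evS_apply, mulS_apply _ _ _ hu, opS_apply,
      iter_resS _ _ _ hu, smul_smul]
    congr 1
    rw [← Finset.prod_sdiff (Finset.mem_powerset.1 hS), mul_assoc, ← Finset.prod_mul_distrib,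
      Finset.prod_congr rfl (fun l _ => mul_inv_cancel₀ (hne l)), Finset.prod_const_one, mul_one]
  · refine LinearMap.ext fun F => HolS.ext' fun u hu => ?_
    rw [mulS_apply _ _ _ hu]; simp
  · intro j S hj
    refine LinearMap.ext fun F => HolS.ext' fun u hu => ?_
    rw [mulS_apply _ _ _ hu, Module.End.mul_apply, pS_apply _ _ _ hu, mulS_apply _ _ _ hu,
      Finset.prod_insert hj, smul_smul]

lemma calD_mem (e : J → Fin N → Fin N → Module.End ℂ M) (z : J → ℂ) (S0 : Finset J) {f : ℂ → M}
    {L : ℕ} (hL : N ≤ L) (hf : f ∈ PolM M L) : calD e z S0 f ∈ PolM M (L + S0.card - N) := by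
  have : calD e z S0 f = ∑ S ∈ S0.powerset, (-1 : ℂ) ^ S.card • fun u =>
      (∏ l ∈ S0 \ S, (u - z l)) • AS e S (iteratedDeriv (N - S.card) f u) := by
    ext u; simp [calD]
  rw [this]
  refine Submodule.sum_mem _ fun S hS => Submodule.smul_mem _ _ ?_
  by_cases h : N < S.card
  · rw [AS_eq_zero S h]
    simp only [LinearMap.zero_apply, smul_zero]
    exact Submodule.zero_mem _
  · have h1 := PolM_mul_prod z (S0 \ S) (PolM_lin (AS e S) (PolM_iter hf (N - S.card)))
    rw [Finset.card_sdiff_of_subset (Finset.mem_powerset.1 hS)] at h1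
    have := Finset.card_le_card (Finset.mem_powerset.1 hS)
    exact PolM_mono (by omega) h1

/-- Interaction operators. -/
def PP (e : J → Fin N → Fin N → Module.End ℂ M) (j l : J) : Module.End ℂ M :=
  ∑ a, ∑ f, e j a f * e l f a

lemma YY_apply {e : J → Fin N → Fin N → Module.End ℂ M} (hG : GLM e) (z : J → ℂ)
    (hz : ∀ j, z j ∉ U) (S : Finset J) (j : J) (h1 : ∑ a, e j a a = 1) (F : HolS U M) {u : ℂ}
    (hu : u ∈ U) : (YY (eS e) (zS z hz) dS S j F).1 u =
      deriv F.1 u - ∑ l ∈ S, (u - z l)⁻¹ • PP e j l (F.1 u) := by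
  have h2 : YY (eS e) (zS z hz) dS S j = opS (U := U) (∑ a, e j a a) * dS -
      ∑ l ∈ S, zS z hz l * opS (PP e j l) := by
    simp only [YY, XX, mul_sub, Finset.sum_sub_distrib, PP, map_sum, map_mul]
    congr 1
    · rw [Finset.sum_mul]
      refine Finset.sum_congr rfl fun a _ => ?_
      simp [eS]
    · simp only [Finset.mul_sum]
      rw [Finset.sum_congr rfl fun a _ => Finset.sum_comm, Finset.sum_comm]
      refine Finset.sum_congr rfl fun l _ => Finset.sum_congr rfl fun a _ =>
        Finset.sum_congr rfl fun f _ => ?_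
      rw [← mul_assoc, ← mul_assoc, (GDS hG z hz).pe]
  rw [h2, h1, map_one, one_mul, LinearMap.sub_apply, HolS.sub_apply, dS_apply _ hu,
    LinearMap.sum_apply, ← evS_apply, map_sum]
  congr 1
  refine Finset.sum_congr rfl fun l _ => ?_
  rw [Module.End.mul_apply, evS_apply, pS_apply _ _ _ hu, opS_apply]

/-- The linear condition satisfied by the image at `z j`. -/
def Cond (e : J → Fin N → Fin N → Module.End ℂ M) (z : J → ℂ) (S : Finset J) (j : J) (G : ℂ → M) : M :=
  (∏ l ∈ S, (z j - z l)) • deriv G (z j) - deriv (fun u => ∏ l ∈ S, (u - z l)) (z j) • G (z j) -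
    ∑ l ∈ S, (∏ i ∈ S.erase l, (z j - z i)) • PP e j l (G (z j))

/-- The complement of the poles. -/
def Om [Finite J] (z : J → ℂ) : TopologicalSpace.Opens ℂ :=
  ⟨(Set.range z)ᶜ, (Set.finite_range z).isClosed.isOpen_compl⟩

lemma Om_not [Finite J] (z : J → ℂ) (j : J) : z j ∉ Om z := fun h => h ⟨j, rfl⟩

lemma Om_dense [Finite J] (z : J → ℂ) : Dense (Om z : Set ℂ) :=
  (Set.finite_range z).countable.dense_compl ℂ

lemma Om_preconn [Finite J] (z : J → ℂ) : IsPreconnected (Om z : Set ℂ) :=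
  ((Set.finite_range z).countable.isPathConnected_compl_of_one_lt_rank (by simp)).isConnected.isPreconnected

lemma Cond_calD [Finite J] {e : J → Fin N → Fin N → Module.End ℂ M} (hG : GLM e) (ho : Osc e)
    (h1 : ∀ j, ∑ a, e j a a = 1) (z : J → ℂ) (S : Finset J) (j : J) (hj : j ∉ S) {f : ℂ → M} {L : ℕ}
    (hL : N ≤ L) (hf : f ∈ PolM M L) : Cond e z S j (calD e z (insert j S) f) = 0 := by
  set U := Om z with hU
  have hz : ∀ j, z j ∉ U := Om_not z
  set F : HolS U M := resS f (PolM_analytic hf _) with hF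
  set G := calD e z (insert j S) f with hGd
  set H := calD e z S f with hHd
  have hGm := calD_mem e z (insert j S) hL hf
  have hHm := calD_mem e z S hL hf
  rw [Finset.card_insert_of_notMem hj] at hGm
  have ho' : Osc (eS (U := U) e) := by
    intro j a b c f
    have := congrArg (opS (U := U)) (ho j a b c f)
    rw [map_mul] at this
    rw [this]; split_ifs <;> simp
  have h1' : ∑ a, eS (U := U) e j a a = 1 := by
    rw [← map_sum, h1, map_one]
  set κ := CC (eS e) (zS z hz) dS S j F with hκ
  set r : ℂ → ℂ := fun u => ∏ l ∈ S, (u - z l) with hr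
  have hrm : r ∈ PolM ℂ (1 + S.card) := by
    have := PolM_mul_prod z S (mono_mem (D := 1) (i := 0) (by omega) (1 : ℂ))
    simpa using this
  set K : ℂ → M := fun u => (u - z j) • H u - G u with hK
  have hKm : K ∈ PolM M (L + S.card - N + 1) :=
    Submodule.sub_mem _ (PolM_mul_lin hHm (z j)) (PolM_mono (by omega) hGm)
  have hKκ : ∀ u ∈ U, K u = r u • κ.1 u := by
    intro u hu
    have hne : u - z j ≠ 0 := fun h => hz j (by
      have : u = z j := sub_eq_zero.1 h
      exact this ▸ hu)
    have e1 := calD_eq hG ho z hz (insert j S) f (PolM_analytic hf _) hu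
    have e2 := calD_eq hG ho z hz S f (PolM_analytic hf _) hu
    rw [DD_insert (GDS hG z hz) ho' S j hj, LinearMap.sub_apply, HolS.sub_apply,
      Module.End.mul_apply, pS_apply _ _ _ hu, Finset.prod_insert hj] at e1
    show (u - z j) • calD e z S f u - calD e z (insert j S) f u = _
    rw [← e1, ← e2, smul_sub, smul_smul, sub_sub_cancel, smul_smul]
    congr 1
    field_simp
    rfl
  have hYC : ∀ u ∈ U, r u • (deriv κ.1 u - ∑ l ∈ S, (u - z l)⁻¹ • PP e j l (κ.1 u)) = H u := by
    intro u hu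
    have e2 := calD_eq hG ho z hz S f (PolM_analytic hf _) hu
    rw [← YY_CC (GDS hG z hz) ho' S j hj h1', Module.End.mul_apply, YY_apply hG z hz S j (h1 j) _ hu] at e2
    exact e2
  have hid : ∀ u ∈ (U : Set ℂ), r u • deriv K u - deriv r u • K u -
      ∑ l ∈ S, (∏ i ∈ S.erase l, (u - z i)) • PP e j l (K u) = r u • H u := by
    intro u hu
    have e3 : deriv K u = r u • deriv κ.1 u + deriv r u • κ.1 u := by
      rw [(HolS.eventuallyEq hKκ hu).deriv_eq]
      exact deriv_fun_smul (PolM_diff hrm u) (κ.2.1 u hu).differentiableAt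
    rw [e3, hKκ u hu, ← hYC u hu]
    simp only [map_smul, smul_sub, smul_add, Finset.smul_sum, smul_smul]
    have e4 : ∀ l ∈ S, ((∏ i ∈ S.erase l, (u - z i)) * r u) • PP e j l (κ.1 u) =
        (r u * (r u * (u - z l)⁻¹)) • PP e j l (κ.1 u) := by
      intro l hl
      have hne : u - z l ≠ 0 := fun h => hz l (by
        have : u = z l := sub_eq_zero.1 h
        exact this ▸ hu)
      congr 1
      have : r u = (u - z l) * ∏ i ∈ S.erase l, (u - z i) := (Finset.mul_prod_erase _ _ hl).symm
      rw [this]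
      field_simp
    rw [Finset.sum_congr rfl e4, mul_comm (deriv r u)]
    abel
  have hc1 : Continuous fun u => r u • deriv K u - deriv r u • K u -
      ∑ l ∈ S, (∏ i ∈ S.erase l, (u - z i)) • PP e j l (K u) := by
    have c1 := (PolM_diff hrm).continuous
    have c2 := PolM_deriv_cont hKm
    have c3 := PolM_deriv_cont hrm
    have c4 := (PolM_diff hKm).continuous
    have c5 : ∀ l, Continuous fun u => PP e j l (K u) := fun l =>
      (LinearMap.continuous_of_finiteDimensional _).comp c4
    refine ((c1.smul c2).sub (c3.smul c4)).sub ?_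
    refine continuous_finsetSum _ fun l _ => ?_
    refine Continuous.smul ?_ (c5 l)
    fun_prop
  have hc2 : Continuous fun u => r u • H u :=
    (PolM_diff hrm).continuous.smul (PolM_diff hHm).continuous
  have key := congrFun (hc1.ext_on (Om_dense z) hc2 hid) (z j)
  have hKz : K (z j) = - G (z j) := by simp [hK]
  have hKd : deriv K (z j) = H (z j) - deriv G (z j) := by
    have := (((hasDerivAt_id (z j)).sub_const (z j)).smul (PolM_diff hHm (z j)).hasDerivAt).sub
      (PolM_diff hGm (z j)).hasDerivAt
    have h3 := this.deriv
    simp only [id, sub_self, zero_smul, one_smul, zero_add] at h3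
    exact h3
  rw [hKz, hKd] at key
  rw [Cond]
  simp only [map_neg, smul_neg, smul_sub, Finset.sum_neg_distrib] at key
  have := sub_eq_zero.2 key
  rw [← neg_eq_zero, ← this]
  abel

end Cal
end GaudinAux

set_option linter.unusedSectionVars false
set_option linter.unusedSimpArgs false
set_option linter.unusedVariables false
namespace GaudinAux
open Filter Topology

section Dim
variable {M : Type*} [NormedAddCommGroup M] [NormedSpace ℂ M] [FiniteDimensional ℂ M]
  {N : ℕ} {J : Type*} [DecidableEq J] [Fintype J]

/-- `calD` on coefficients. -/
def calDL (e : J → Fin N → Fin N → Module.End ℂ M) (z : J → ℂ) (L : ℕ) :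
    (Fin L → M) →ₗ[ℂ] (ℂ → M) where
  toFun c := calD e z Finset.univ (pfL M L c)
  map_add' c c' := by
    ext u
    simp only [calD, map_add, iter_add_pol (D := L) ⟨c, rfl⟩ ⟨c', rfl⟩, Pi.add_apply, smul_add,
      Finset.sum_add_distrib]
  map_smul' a c := by
    ext u
    simp only [calD, map_smul, iter_smul_pol (D := L) ⟨c, rfl⟩, Pi.smul_apply, RingHom.id_apply,
      Finset.smul_sum]
    refine Finset.sum_congr rfl fun S _ => ?_
    rw [smul_comm a, smul_comm a]

lemma calDL_mem (e : J → Fin N → Fin N → Module.End ℂ M) (z : J → ℂ) {L : ℕ} (hL : N ≤ L)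
    (c : Fin L → M) : calDL e z L c ∈ PolM M (L + Fintype.card J - N) :=
  calD_mem e z Finset.univ hL ⟨c, rfl⟩

/-- The conditions as a linear map. -/
def CondL (e : J → Fin N → Fin N → Module.End ℂ M) (z : J → ℂ) (Q : ℕ) :
    PolM M Q →ₗ[ℂ] (J → M) where
  toFun G j := Cond e z (Finset.univ.erase j) j G.1
  map_add' F G := by
    ext j
    have : deriv (F.1 + G.1) (z j) = deriv F.1 (z j) + deriv G.1 (z j) :=
      deriv_add (PolM_diff F.2 _) (PolM_diff G.2 _)
    simp only [Cond, Submodule.coe_add, Pi.add_apply, this, map_add, smul_add, Finset.sum_add_distrib]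
    abel
  map_smul' c F := by
    ext j
    have : deriv (c • F.1) (z j) = c • deriv F.1 (z j) :=
      deriv_const_smul c (PolM_diff F.2 _)
    simp only [Cond, Submodule.coe_smul, Pi.smul_apply, this, map_smul, smul_sub, Finset.smul_sum,
      RingHom.id_apply]
    congr 1
    · rw [smul_comm c, smul_comm c]
    · refine Finset.sum_congr rfl fun S _ => ?_
      rw [smul_comm c]

lemma Cond_lin (e : J → Fin N → Fin N → Module.End ℂ M) (z : J → ℂ) (S : Finset J) (l : J)
    (h : ℂ → M) (hh : Differentiable ℂ h) :
    Cond e z S l (fun u => (u - z l) • h u) = (∏ i ∈ S, (z l - z i)) • h (z l) := by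
  have hd : deriv (fun u => (u - z l) • h u) (z l) = h (z l) := by
    have := (((hasDerivAt_id (z l)).sub_const (z l)).smul (hh (z l)).hasDerivAt).deriv
    simp only [id, sub_self, zero_smul, one_smul, zero_add] at this
    exact this
  rw [Cond, hd]
  simp

lemma CondL_surj (e : J → Fin N → Fin N → Module.End ℂ M) (z : J → ℂ) (hz : Function.Injective z)
    (Q : ℕ) (hQ : 2 * Fintype.card J ≤ Q) : Function.Surjective (CondL e z Q) := by
  have hmem : ∀ j (w : M), (fun u => (∏ i, (u - z i)) • (∏ i ∈ Finset.univ.erase j, (u - z i)) • w) ∈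
      PolM M Q := by
    intro j w
    have h1 := PolM_mul_prod z Finset.univ (PolM_mul_prod z (Finset.univ.erase j)
      (mono_mem (D := 1) (i := 0) (by omega) w))
    simp only [pow_zero, one_smul] at h1
    refine PolM_mono ?_ h1
    rw [Finset.card_erase_of_mem (Finset.mem_univ _), Finset.card_univ]
    have : 0 < Fintype.card J := Fintype.card_pos_iff.2 ⟨j⟩
    omega
  have hval : ∀ j l (w : M), CondL e z Q ⟨_, hmem j w⟩ l =
      if l = j then (∏ i ∈ Finset.univ.erase j, (z j - z i)) ^ 3 • w else 0 := by
    intro j l w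
    have h1 : CondL e z Q ⟨_, hmem j w⟩ l = Cond e z (Finset.univ.erase l) l
      (fun u => (u - z l) • ((∏ i ∈ Finset.univ.erase l, (u - z i)) •
        (∏ i ∈ Finset.univ.erase j, (u - z i)) • w)) := by
      show Cond e z _ l _ = _
      congr 1
      ext u
      rw [smul_smul (u - z l), Finset.mul_prod_erase _ (fun i => u - z i) (Finset.mem_univ l)]
    rw [h1, Cond_lin]
    · split_ifs with h
      · subst h
        rw [smul_smul, smul_smul]; congr 1; ring
      · have : ∏ i ∈ Finset.univ.erase j, (z l - z i) = 0 :=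
          Finset.prod_eq_zero (i := l) (by simp [h]) (sub_self _)
        rw [this]; simp
    · fun_prop
  intro y
  refine ⟨∑ j, ⟨_, hmem j (((∏ i ∈ Finset.univ.erase j, (z j - z i)) ^ 3)⁻¹ • y j)⟩, ?_⟩
  rw [map_sum]
  ext l
  rw [Finset.sum_apply, Finset.sum_eq_single l]
  · rw [hval, if_pos rfl, smul_smul, mul_inv_cancel₀, one_smul]
    refine pow_ne_zero _ (Finset.prod_ne_zero_iff.2 fun i hi => ?_)
    exact sub_ne_zero.2 fun h => (Finset.ne_of_mem_erase hi) (hz h).symm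
  · intro j _ hj
    rw [hval, if_neg hj.symm]
  · simp

lemma rank_inj {e : J → Fin N → Fin N → Module.End ℂ M} (hG : GLM e) (ho : Osc e)
    (h1 : ∀ j, ∑ a, e j a a = 1) (z : J → ℂ) (hz : Function.Injective z) {L : ℕ}
    (hL : Fintype.card J + N ≤ L) :
    Module.finrank ℂ (LinearMap.range (calDL e z L)) ≤ (L - N) * Module.finrank ℂ M := by
  set Q := L + Fintype.card J - N with hQ
  have hs := CondL_surj e z hz Q (by omega)
  have h2 := LinearMap.finrank_range_add_finrank_ker (CondL e z Q)
  rw [LinearMap.range_eq_top.2 hs, finrank_top, PolM_finrank, Module.finrank_pi_fintype] at h2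
  simp only [Finset.sum_const, Finset.card_univ, smul_eq_mul] at h2
  have h3 : LinearMap.range (calDL e z L) ≤ (LinearMap.ker (CondL e z Q)).map (PolM M Q).subtype := by
    rintro _ ⟨c, rfl⟩
    refine ⟨⟨_, calDL_mem e z (by omega) c⟩, ?_, rfl⟩
    show CondL e z Q _ = 0
    ext j
    have := Cond_calD hG ho h1 z (Finset.univ.erase j) j (by simp) (L := L) (by omega)
      (f := pfL M L c) ⟨c, rfl⟩
    rw [Finset.insert_erase (Finset.mem_univ j)] at this
    exact this
  have h4 := Submodule.finrank_mono h3
  rw [Submodule.finrank_map_subtype_eq] at h4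
  refine h4.trans ?_
  have h5 : Q = Fintype.card J + (L - N) := by omega
  have h6 : Q * Module.finrank ℂ M = Fintype.card J * Module.finrank ℂ M +
    (L - N) * Module.finrank ℂ M := by rw [← add_mul, ← h5]
  rw [h6] at h2
  omega

lemma rank_all {e : J → Fin N → Fin N → Module.End ℂ M} (hG : GLM e) (ho : Osc e)
    (h1 : ∀ j, ∑ a, e j a a = 1) (z : J → ℂ) {L : ℕ}
    (hL : Fintype.card J + N ≤ L) :
    Module.finrank ℂ (LinearMap.range (calDL e z L)) ≤ (L - N) * Module.finrank ℂ M := by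
  set Q := L + Fintype.card J - N with hQ
  set r := Module.finrank ℂ (LinearMap.range (calDL e z L)) with hr
  let b := Module.finBasis ℂ (LinearMap.range (calDL e z L))
  have hb : ∀ i, ∃ c, calDL e z L c = (b i : ℂ → M) := fun i => (b i).2
  choose c hc using hb
  let w : J → ℂ := fun j => ((Fintype.equivFin J j : ℕ) : ℂ)
  have hw : Function.Injective w := fun i j h => (Fintype.equivFin J).injective
    (Fin.ext (Nat.cast_injective (R := ℂ) h))
  let zt : ℂ → J → ℂ := fun t j => z j + t * w j
  let ev : (ℂ → M) →ₗ[ℂ] (Fin Q → M) := LinearMap.funLeft ℂ M (fun i : Fin Q => ((i : ℕ) : ℂ))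
  have hcont : Continuous fun t => fun i => ev (calDL e (zt t) L (c i)) := by
    refine continuous_pi fun i => continuous_pi fun q => ?_
    show Continuous fun t => calD e (zt t) Finset.univ (pfL M L (c i)) ((q : ℕ) : ℂ)
    unfold calD
    refine continuous_finsetSum _ fun S _ => ?_
    refine Continuous.const_smul ?_ _
    refine Continuous.smul ?_ continuous_const
    fun_prop
  have hz0 : zt 0 = z := by ext j; simp [zt]
  have hli : LinearIndependent ℂ (fun i => ev (calDL e (zt 0) L (c i))) := by
    rw [hz0]
    simp only [hc]
    have := b.linearIndependent.map' ((ev.comp (Submodule.subtype _))) ?_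
    · exact this
    · rw [LinearMap.ker_eq_bot']
      rintro ⟨f, hf⟩ h0
      obtain ⟨c', rfl⟩ := hf
      apply Subtype.ext
      refine PolM_eq_zero (calDL_mem e z (by omega) c') (fun i => ((i : ℕ) : ℂ))
        (fun i j h => Fin.ext (Nat.cast_injective (R := ℂ) h)) fun i => ?_
      exact congrFun h0 i
  have hev : ∀ᶠ t in 𝓝 (0 : ℂ), LinearIndependent ℂ (fun i => ev (calDL e (zt t) L (c i))) :=
    hcont.continuousAt.eventually (LinearIndependent.eventually hli)
  have hinj : ∀ᶠ t in 𝓝[≠] (0 : ℂ), Function.Injective (zt t) := by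
    have hfin : (Set.range fun p : J × J => (z p.2 - z p.1) / (w p.1 - w p.2)).Finite :=
      Set.finite_range _
    have := nhdsNE_le_cofinite (0 : ℂ) hfin.compl_mem_cofinite
    filter_upwards [this] with t ht i j hij
    by_contra hne
    apply ht
    refine ⟨(i, j), ?_⟩
    have h2 : w i - w j ≠ 0 := sub_ne_zero.2 fun h => hne (hw h)
    simp only [zt] at hij
    rw [div_eq_iff h2]
    linear_combination -hij
  obtain ⟨t, ht1, ht2⟩ := ((hev.filter_mono nhdsWithin_le_nhds).and hinj).exists
  refine le_trans ?_ (rank_inj hG ho h1 (zt t) ht2 hL)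
  have h3 : LinearIndependent ℂ (fun i => (⟨calDL e (zt t) L (c i), ⟨_, rfl⟩⟩ :
      LinearMap.range (calDL e (zt t) L))) :=
    LinearIndependent.of_comp (ev.comp (Submodule.subtype _)) ht1
  simpa using h3.fintype_card_le_finrank

/-- Every jet is realized by a polynomial solution. -/
def PK (e : J → Fin N → Fin N → Module.End ℂ M) (z : J → ℂ) : Prop :=
  ∃ L, ∀ u0 ∈ Om z, ∀ c : Fin N → M, ∃ f, ∃ hf : f ∈ PolM M L,
    DS e z (Om_not z) (resS f (PolM_analytic hf _)) = 0 ∧ ∀ i : Fin N, iteratedDeriv i f u0 = c i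

lemma PK_osc {e : J → Fin N → Fin N → Module.End ℂ M} (hG : GLM e) (ho : Osc e)
    (h1 : ∀ j, ∑ a, e j a a = 1) (z : J → ℂ) : PK e z := by
  set L := Fintype.card J + N with hL
  refine ⟨L, fun u0 hu0 c => ?_⟩
  have hsol : ∀ x ∈ LinearMap.ker (calDL e z L), DS e z (Om_not z)
      (resS (pfL M L x) (PolM_analytic (D := L) ⟨x, rfl⟩ _)) = 0 := by
    intro x hx
    refine HolS.ext' fun u hu => ?_
    have h2 := calD_eq hG ho z (Om_not z) Finset.univ (pfL M L x) (PolM_analytic (D := L) ⟨x, rfl⟩ _) hu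
    have h3 : calD e z Finset.univ (pfL M L x) u = 0 := congrFun hx u
    rw [h3] at h2
    refine (smul_eq_zero.1 h2).resolve_left ?_
    refine Finset.prod_ne_zero_iff.2 fun l _ h => Om_not z l ?_
    have : u = z l := sub_eq_zero.1 h
    exact this ▸ hu
  let jet : LinearMap.ker (calDL e z L) →ₗ[ℂ] (Fin N → M) :=
    { toFun := fun x i => iteratedDeriv i (pfL M L x.1) u0
      map_add' := fun x y => by
        ext i
        simp only [Submodule.coe_add, map_add, iter_add_pol (D := L) ⟨x.1, rfl⟩ ⟨y.1, rfl⟩, Pi.add_apply]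
      map_smul' := fun a x => by
        ext i
        simp only [Submodule.coe_smul, map_smul, iter_smul_pol (D := L) ⟨x.1, rfl⟩, Pi.smul_apply,
          RingHom.id_apply] }
  have hinj : Function.Injective jet := by
    rw [← LinearMap.ker_eq_bot, LinearMap.ker_eq_bot']
    intro x hx
    have h2 := uniq (Om_preconn z) hu0 z (Om_not z) _ (hsol x.1 x.2) (fun i hi => by
      rw [iter_resS _ _ _ hu0]
      exact congrFun hx ⟨i, hi⟩)
    have h3 : pfL M L x.1 = 0 := by
      refine (PolM_diff (D := L) ⟨x.1, rfl⟩).continuous.ext_on (Om_dense z) continuous_const ?_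
      intro u hu
      have := congrArg (evS u) h2
      rw [evS_apply, resS_apply _ _ hu] at this
      exact this
    apply Subtype.ext
    exact pfL_injective L (by rw [h3]; simp)
  have hdim : Module.finrank ℂ (Fin N → M) ≤ Module.finrank ℂ (LinearMap.ker (calDL e z L)) := by
    have h2 := LinearMap.finrank_range_add_finrank_ker (calDL e z L)
    have h3 := rank_all hG ho h1 z hL.ge
    rw [Module.finrank_pi_fintype] at h2 ⊢
    simp only [Finset.sum_const, Finset.card_univ, smul_eq_mul, Fintype.card_fin] at h2 ⊢
    have : L = (L - N) + N := by omega
    rw [this, add_mul, ← this] at h2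
    omega
  have hsurj : Function.Surjective jet := by
    refine (LinearMap.injective_iff_surjective_of_finrank_eq_finrank ?_).1 hinj
    exact le_antisymm (LinearMap.finrank_le_finrank_of_injective hinj) hdim
  obtain ⟨x, hx⟩ := hsurj c
  exact ⟨pfL M L x.1, ⟨x.1, rfl⟩, hsol x.1 x.2, fun i => congrFun hx i⟩

end Dim
end GaudinAux

set_option linter.unusedSectionVars false
set_option linter.unusedSimpArgs false
set_option linter.unusedVariables false
namespace GaudinAux
open Filter Topology

section Model
variable {N : ℕ} {J : Type*} [DecidableEq J] [Fintype J]

/-- The tensor power of the vector representation. -/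
abbrev TT (N : ℕ) (J : Type*) : Type _ := (J → Fin N) → ℂ

/-- Action on the `j`-th factor. -/
def eT (j : J) (a b : Fin N) : Module.End ℂ (TT N J) where
  toFun g w := if w j = a then g (Function.update w j b) else 0
  map_add' g g' := by ext w; simp only [Pi.add_apply]; split_ifs <;> simp
  map_smul' c g := by ext w; simp

lemma eT_apply (j : J) (a b : Fin N) (g : TT N J) (w : J → Fin N) :
    eT j a b g w = if w j = a then g (Function.update w j b) else 0 := rfl

lemma eT_osc : Osc (eT (N := N) (J := J)) := by
  intro j a b c f
  refine LinearMap.ext fun g => ?_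
  ext w
  rw [Module.End.mul_apply, eT_apply, eT_apply]
  by_cases hbc : b = c
  · simp [hbc, eT_apply]
  · simp [hbc, eT_apply]

lemma eT_one (j : J) : ∑ a, eT (N := N) j a a = 1 := by
  refine LinearMap.ext fun g => ?_
  ext w
  rw [LinearMap.sum_apply, Finset.sum_apply, Finset.sum_eq_single (w j)]
  · simp [eT_apply]
  · intro b _ hb; simp [eT_apply, hb.symm]
  · simp

lemma eT_glm : GLM (eT (N := N) (J := J)) where
  rel j a b c f := by rw [eT_osc, eT_osc]
  comm i j hij a b c f := by
    refine LinearMap.ext fun g => ?_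
    ext w
    simp only [Module.End.mul_apply, eT_apply, Function.update_of_ne hij, Function.update_of_ne hij.symm]
    rw [Function.update_comm hij]
    split_ifs <;> rfl

lemma PK_T (z : J → ℂ) : PK (eT (N := N) (J := J)) z := PK_osc eT_glm eT_osc eT_one z

end Model

section Transfer
variable {N : ℕ} {I : Type*} [DecidableEq I] [Fintype I]
variable {M : Type*} [NormedAddCommGroup M] [NormedSpace ℂ M] [FiniteDimensional ℂ M]
  {Z : Type*} [NormedAddCommGroup Z] [NormedSpace ℂ Z] [FiniteDimensional ℂ Z]

lemma iter_lin_pol (A : M →ₗ[ℂ] Z) {D : ℕ} {f : ℂ → M} (hf : f ∈ PolM M D) (i : ℕ) :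
    iteratedDeriv i (fun u => A (f u)) = fun u => A (iteratedDeriv i f u) := by
  induction i with
  | zero => simp
  | succ i ih =>
    rw [iteratedDeriv_succ, ih, iteratedDeriv_succ]
    ext u
    exact deriv_lin A (PolM_analytic (PolM_iter hf i) Set.univ u (Set.mem_univ u))

lemma PK_surj {e : I → Fin N → Fin N → Module.End ℂ Z} {e' : I → Fin N → Fin N → Module.End ℂ M}
    (z : I → ℂ) (A : Z →ₗ[ℂ] M) (hA : ∀ j a b x, e' j a b (A x) = A (e j a b x))
    (hs : Function.Surjective A) (h : PK e z) : PK e' z := by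
  obtain ⟨L, hL⟩ := h
  refine ⟨L, fun u0 hu0 c => ?_⟩
  obtain ⟨f, hf, h1, h2⟩ := hL u0 hu0 (fun i => Function.surjInv hs (c i))
  refine ⟨fun u => A (f u), PolM_lin A hf, ?_, fun i => ?_⟩
  · have h3 : resS (fun u => A (f u)) (PolM_analytic (PolM_lin A hf) _) =
        hS (U := Om z) A (resS f (PolM_analytic hf _)) := by
      refine HolS.ext' fun u hu => ?_
      rw [resS_apply _ _ hu, hS_apply, resS_apply _ _ hu]
    rw [h3, DS_hS e e' z (Om_not z) A hA, h1, map_zero]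
  · rw [iter_lin_pol A hf]
    show A _ = _
    rw [h2]; exact Function.surjInv_eq hs _

lemma PK_inj {e : I → Fin N → Fin N → Module.End ℂ Z} {e' : I → Fin N → Fin N → Module.End ℂ M}
    (z : I → ℂ) (A : Z →ₗ[ℂ] M) (hA : ∀ j a b x, e' j a b (A x) = A (e j a b x))
    (hs : Function.Injective A) (h : PK e' z) : PK e z := by
  obtain ⟨L, hL⟩ := h
  obtain ⟨B, hB⟩ := A.exists_leftInverse_of_injective (LinearMap.ker_eq_bot.2 hs)
  have hBA : ∀ x, B (A x) = x := fun x => LinearMap.congr_fun hB x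
  refine ⟨L, fun u0 hu0 c => ?_⟩
  obtain ⟨f, hf, h1, h2⟩ := hL u0 hu0 (fun i => A (c i))
  have hval : ∀ u ∈ Om z, f u ∈ LinearMap.range A := by
    intro u hu
    have := values_mem (Y := LinearMap.range A) (Om_preconn z) hu0 z (Om_not z)
      (by rintro j a b _ ⟨x, rfl⟩; exact ⟨_, (hA j a b x).symm⟩) _ h1 (fun i hi => by
        rw [iter_resS _ _ _ hu0, h2 ⟨i, hi⟩]; exact ⟨_, rfl⟩) u
    rwa [resS_apply _ _ hu] at this
  refine ⟨fun u => B (f u), PolM_lin B hf, ?_, fun i => ?_⟩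
  · have h3 : hS (U := Om z) A (resS (fun u => B (f u)) (PolM_analytic (PolM_lin B hf) _)) =
        resS f (PolM_analytic hf _) := by
      refine HolS.ext' fun u hu => ?_
      rw [resS_apply _ _ hu, hS_apply, resS_apply _ _ hu]
      obtain ⟨x, hx⟩ := hval u hu
      rw [← hx, hBA]
    have h4 := DS_hS e e' z (Om_not z) A hA (resS (fun u => B (f u)) (PolM_analytic (PolM_lin B hf) _))
    rw [h3, h1] at h4
    refine HolS.ext' fun u hu => hs ?_
    rw [← hS_apply, ← h4, HolS.zero_apply, HolS.zero_apply, map_zero]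
  · rw [iter_lin_pol B hf]
    show B _ = _
    rw [h2, hBA]

/-- Restriction to a smaller open set. -/
def rhoS {U U' : TopologicalSpace.Opens ℂ} (hU : U ≤ U') : HolS U' M →ₗ[ℂ] HolS U M where
  toFun F := resS F.1 (fun u hu => F.2.1 u (hU hu))
  map_add' F G := HolS.ext' fun u hu => by
    rw [HolS.add_apply]
    refine (resS_apply (F + G).1 _ hu).trans ?_
    rw [resS_apply F.1 (fun u hu => F.2.1 u (hU hu)) hu, resS_apply G.1 (fun u hu => G.2.1 u (hU hu)) hu]
    rfl
  map_smul' c F := HolS.ext' fun u hu => by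
    rw [RingHom.id_apply, HolS.smul_apply]
    refine (resS_apply (c • F).1 _ hu).trans ?_
    rw [resS_apply F.1 (fun u hu => F.2.1 u (hU hu)) hu]
    rfl

lemma rhoS_apply {U U' : TopologicalSpace.Opens ℂ} (hU : U ≤ U') (F : HolS U' M) {u : ℂ} (hu : u ∈ U) :
    (rhoS hU F).1 u = F.1 u := resS_apply _ (fun u hu => F.2.1 u (hU hu)) hu

variable {J : Type*} [DecidableEq J] [Fintype J]

/-- Sums of operators over blocks. -/
def blkE (blk : J → I) (e : J → Fin N → Fin N → Module.End ℂ M) (i : I) (a b : Fin N) :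
    Module.End ℂ M := ∑ j with blk j = i, e j a b

lemma XX_apply {U : TopologicalSpace.Opens ℂ} (e : J → Fin N → Fin N → Module.End ℂ M) (z : J → ℂ)
    (hz : ∀ j, z j ∉ U) (a b : Fin N) (F : HolS U M) {u : ℂ} (hu : u ∈ U) :
    (XX (eS e) (zS z hz) dS Finset.univ a b F).1 u =
      (if a = b then deriv F.1 u else 0) - ∑ j, (u - z j)⁻¹ • e j b a (F.1 u) := by
  rw [XX, LinearMap.sub_apply, HolS.sub_apply, LinearMap.sum_apply, ← evS_apply (u := u) (∑ d, _), map_sum]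
  congr 1
  · split_ifs
    · exact dS_apply _ hu
    · rfl
  · refine Finset.sum_congr rfl fun j _ => ?_
    rw [Module.End.mul_apply, evS_apply, pS_apply _ _ _ hu, opS_apply]

lemma PK_blk (blk : J → I) (e : J → Fin N → Fin N → Module.End ℂ M) (z : I → ℂ)
    (h : PK e (z ∘ blk)) : PK (blkE blk e) z := by
  obtain ⟨L, hL⟩ := h
  have hle : Om z ≤ Om (z ∘ blk) := by
    rintro u hu ⟨j, hj⟩
    exact hu ⟨blk j, hj⟩
  refine ⟨L, fun u0 hu0 c => ?_⟩
  obtain ⟨f, hf, h1, h2⟩ := hL u0 (hle hu0) c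
  refine ⟨f, hf, ?_, h2⟩
  have h3 : resS f (PolM_analytic hf _) = rhoS hle (resS f (PolM_analytic hf _)) := by
    refine HolS.ext' fun u hu => ?_
    rw [resS_apply _ _ hu, rhoS_apply _ _ hu, resS_apply _ _ (hle hu)]
  rw [h3]
  have h4 : ∀ F, DS (blkE blk e) z (Om_not z) (rhoS hle F) =
      rhoS hle (DS e (z ∘ blk) (Om_not (z ∘ blk)) F) := by
    intro F
    refine rdet_intertwine (rhoS hle) _ _ (fun a b F => ?_) F
    refine HolS.ext' fun u hu => ?_
    rw [XX_apply _ _ _ _ _ _ hu, rhoS_apply _ _ hu, rhoS_apply _ _ hu,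
      XX_apply _ _ _ _ _ _ (hle hu), (HolS.eventuallyEq (fun x hx => rhoS_apply hle F hx) hu).deriv_eq]
    congr 1
    rw [← Finset.sum_fiberwise Finset.univ blk]
    refine Finset.sum_congr rfl fun i _ => ?_
    rw [blkE, LinearMap.sum_apply, Finset.smul_sum]
    refine Finset.sum_congr rfl fun j hj => ?_
    rw [Function.comp_apply, (Finset.mem_filter.1 hj).2]
  rw [h4, h1, map_zero]

lemma sum_sum_ite_ne {A : Type*} [AddCommGroup A] (s : Finset J) (x y : J → J → A)
    (h : ∀ i j, i ≠ j → x i j = y i j) :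
    ∑ i ∈ s, ∑ j ∈ s, x i j - ∑ i ∈ s, ∑ j ∈ s, y i j = ∑ i ∈ s, (x i i - y i i) := by
  rw [← Finset.sum_sub_distrib]
  refine Finset.sum_congr rfl fun i hi => ?_
  rw [← Finset.sum_sub_distrib, Finset.sum_eq_single_of_mem i hi]
  intro j _ hj
  rw [h i j hj.symm, sub_self]

lemma blkE_glm (blk : J → I) {e : J → Fin N → Fin N → Module.End ℂ M} (h : GLM e) :
    GLM (blkE blk e) where
  rel i a b c f := by
    set s := Finset.univ.filter fun j => blk j = i with hs
    have h1 : blkE blk e i a b * blkE blk e i c f = ∑ j ∈ s, ∑ k ∈ s, e j a b * e k c f := by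
      simp only [blkE, Finset.sum_mul, Finset.mul_sum]; exact Finset.sum_comm
    have h2 : blkE blk e i c f * blkE blk e i a b = ∑ j ∈ s, ∑ k ∈ s, e k c f * e j a b := by
      simp only [blkE, Finset.sum_mul, Finset.mul_sum]; rfl
    rw [h1, h2, sum_sum_ite_ne s (fun j k => e j a b * e k c f) (fun j k => e k c f * e j a b)
      (fun j k hjk => h.comm j k hjk a b c f), Finset.sum_congr rfl fun j _ => h.rel j a b c f,
      Finset.sum_sub_distrib]
    congr 1 <;> split_ifs <;> simp [blkE, hs]
  comm i i' hii a b c f := by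
    simp only [blkE, Finset.sum_mul, Finset.mul_sum]
    rw [Finset.sum_comm]
    refine Finset.sum_congr rfl fun j hj => Finset.sum_congr rfl fun j' hj' => ?_
    refine h.comm _ _ ?_ _ _ _ _
    rintro rfl
    exact hii (((Finset.mem_filter.1 hj').2).symm.trans (Finset.mem_filter.1 hj).2).symm

end Transfer
end GaudinAux

set_option linter.unusedSectionVars false
set_option linter.unusedSimpArgs false
set_option linter.unusedVariables false
namespace GaudinAux

section Tv
variable {N : ℕ} {C : Type} [DecidableEq C] [Fintype C] (h : C → ℕ) (hh : ∀ c, h c ≤ N)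

/-- Column matrices. -/
def colM (w : (Σ c, Fin (h c)) → Fin N) (c : C) : Matrix (Fin (h c)) (Fin (h c)) ℂ :=
  fun p q => if w ⟨c, p⟩ = Fin.castLE (hh c) q then 1 else 0

/-- The highest weight vector. -/
def tvec : TT N (Σ c, Fin (h c)) := fun w => ∏ c, (colM h hh w c).det

lemma tvec_ne : tvec h hh ≠ 0 := by
  intro h0
  have h1 := congrFun h0 (fun x => Fin.castLE (hh x.1) x.2)
  have h2 : ∀ c, colM h hh (fun x => Fin.castLE (hh x.1) x.2) c = 1 := by
    intro c
    ext p q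
    simp only [colM, Matrix.one_apply]
    congr 1
    simp [Fin.ext_iff]
  simp [tvec, h2] at h1

lemma colM_update_ne (w : (Σ c, Fin (h c)) → Fin N) (c c' : C) (hc : c' ≠ c) (p : Fin (h c)) (b : Fin N) :
    colM h hh (Function.update w ⟨c, p⟩ b) c' = colM h hh w c' := by
  ext p' q
  rw [colM, colM, Function.update_of_ne]
  intro h; exact hc (congrArg Sigma.fst h)

lemma colM_update (w : (Σ c, Fin (h c)) → Fin N) (c : C) (p : Fin (h c)) (b : Fin N) :
    colM h hh (Function.update w ⟨c, p⟩ b) c =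
      (colM h hh w c).updateRow p (fun q => if b = Fin.castLE (hh c) q then 1 else 0) := by
  ext p' q
  by_cases hp : p' = p
  · subst hp; simp [colM]
  · rw [Matrix.updateRow_ne hp, colM, colM, Function.update_of_ne]
    intro h
    apply hp
    simpa using h

lemma tvec_update (w : (Σ c, Fin (h c)) → Fin N) (c : C) (p : Fin (h c)) (b : Fin N) :
    tvec h hh (Function.update w ⟨c, p⟩ b) =
      ((colM h hh w c).updateRow p (fun q => if b = Fin.castLE (hh c) q then 1 else 0)).det *
      ∏ c' ∈ Finset.univ.erase c, (colM h hh w c').det := by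
  rw [tvec, ← Finset.mul_prod_erase _ _ (Finset.mem_univ c), colM_update]
  congr 1
  refine Finset.prod_congr rfl fun c' hc' => ?_
  rw [colM_update_ne _ _ _ _ _ (Finset.ne_of_mem_erase hc')]

lemma col_act (c : C) (a b : Fin N) (hab : a ≤ b) :
    ∑ p : Fin (h c), eT (⟨c, p⟩ : Σ c, Fin (h c)) a b (tvec h hh) =
      if a = b ∧ (a : ℕ) < h c then tvec h hh else 0 := by
  ext w
  rw [Finset.sum_apply]
  simp only [eT_apply, tvec_update]
  set B := colM h hh w c with hB
  set R := ∏ c' ∈ Finset.univ.erase c, (colM h hh w c').det with hR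
  have ht : tvec h hh w = B.det * R := by
    rw [tvec, ← Finset.mul_prod_erase _ _ (Finset.mem_univ c)]
  by_cases hb : (b : ℕ) < h c
  · have ha : (a : ℕ) < h c := lt_of_le_of_lt hab hb
    have h1 : (fun q => if b = Fin.castLE (hh c) q then (1 : ℂ) else 0) = Pi.single ⟨b, hb⟩ 1 := by
      ext q
      by_cases hq : q = ⟨b, hb⟩
      · subst hq; simp
      · rw [Pi.single_eq_of_ne hq, if_neg]
        intro hx; apply hq; exact Fin.ext (by simpa using (congrArg Fin.val hx).symm)
    rw [h1]
    have h2 : ∀ p, (if w ⟨c, p⟩ = a then (B.updateRow p (Pi.single ⟨b, hb⟩ 1)).det * R else 0) =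
        B.adjugate ⟨b, hb⟩ p * B p ⟨a, ha⟩ * R := by
      intro p
      rw [Matrix.adjugate_apply, hB]
      have : colM h hh w c p ⟨a, ha⟩ = if w ⟨c, p⟩ = a then 1 else 0 := rfl
      rw [this]
      split_ifs <;> simp
    rw [Finset.sum_congr rfl fun p _ => h2 p, ← Finset.sum_mul, ← Matrix.mul_apply,
      Matrix.adjugate_mul, Matrix.smul_apply, Matrix.one_apply, smul_eq_mul]
    by_cases hab' : a = b
    · subst hab'; simp [ha, ht]
    · have h3 : ¬ ((⟨b, hb⟩ : Fin (h c)) = ⟨a, ha⟩) := by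
        intro hx; apply hab'; exact Fin.ext (by simpa using congrArg Fin.val hx.symm)
      simp [hab', h3]
  · have h1 : (fun q => if b = Fin.castLE (hh c) q then (1 : ℂ) else 0) = 0 := by
      ext q
      rw [if_neg]; rfl
      intro h; apply hb; rw [h]; exact q.2
    rw [h1]
    have h2 : ¬ (a = b ∧ (a : ℕ) < h c) := by rintro ⟨rfl, h⟩; exact hb h
    rw [if_neg h2]
    refine Finset.sum_eq_zero fun p _ => ?_
    split_ifs
    · rw [Matrix.det_eq_zero_of_row_eq_zero p (by intro j; simp), zero_mul]
    · rfl

end Tv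

lemma exists_T {N n : ℕ} (hN : 0 < N) (Λ : Fin n → Fin N → ℤ)
    (hdom : ∀ i, ∀ a b : Fin N, a ≤ b → Λ i b ≤ Λ i a) (hpoly : ∀ i a, 0 ≤ Λ i a) :
    ∃ (J : Type) (_ : DecidableEq J) (_ : Fintype J) (blk : J → Fin n) (t : TT N J), t ≠ 0 ∧
      (∀ i a b, a < b → blkE blk (eT (N := N)) i a b t = 0) ∧
      (∀ i a, blkE blk (eT (N := N)) i a a t = (Λ i a : ℂ) • t) := by
  let C := Σ i : Fin n, Fin (Λ i ⟨0, hN⟩).toNat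
  let h : C → ℕ := fun c => (Finset.univ.filter fun a : Fin N => ((c.2 : ℕ) : ℤ) < Λ c.1 a).card
  have hh : ∀ c, h c ≤ N := fun c => (Finset.card_le_univ _).trans (by simp)
  have hlt : ∀ (c : C) (a : Fin N), (a : ℕ) < h c ↔ ((c.2 : ℕ) : ℤ) < Λ c.1 a := by
    intro c a
    constructor
    · intro h1
      by_contra h2
      have : (Finset.univ.filter fun a : Fin N => ((c.2 : ℕ) : ℤ) < Λ c.1 a) ⊆ Finset.Iio a := by
        intro b hb
        rw [Finset.mem_Iio]
        by_contra h3
        exact h2 (lt_of_lt_of_le (Finset.mem_filter.1 hb).2 (hdom c.1 a b (not_lt.1 h3)))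
      have := Finset.card_le_card this
      rw [Fin.card_Iio] at this
      exact absurd h1 (not_lt.2 this)
    · intro h1
      have : Finset.Iic a ⊆ (Finset.univ.filter fun a : Fin N => ((c.2 : ℕ) : ℤ) < Λ c.1 a) := by
        intro b hb
        rw [Finset.mem_filter]
        exact ⟨Finset.mem_univ _, lt_of_lt_of_le h1 (hdom c.1 b a (Finset.mem_Iic.1 hb))⟩
      have := Finset.card_le_card this
      rw [Fin.card_Iic] at this
      exact Nat.lt_of_succ_le this
  have hsum : ∀ i a b, a ≤ b → blkE (fun x : Σ c, Fin (h c) => x.1.1) (eT (N := N)) i a b (tvec h hh) =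
      ∑ k : Fin (Λ i ⟨0, hN⟩).toNat, if a = b ∧ (((k : ℕ) : ℤ) < Λ i a) then tvec h hh else 0 := by
    intro i a b hab
    rw [blkE, LinearMap.sum_apply, Finset.sum_filter, Fintype.sum_sigma, Fintype.sum_sigma,
      Finset.sum_eq_single i]
    · refine Finset.sum_congr rfl fun k _ => ?_
      simp only [if_true]
      rw [col_act h hh ⟨i, k⟩ a b hab]
      simp only [hlt]
    · intro i' _ hi'
      refine Finset.sum_eq_zero fun k _ => Finset.sum_eq_zero fun p _ => ?_
      rw [if_neg hi']
    · simp
  refine ⟨Σ c, Fin (h c), inferInstance, inferInstance, fun x => x.1.1, tvec h hh, tvec_ne h hh, ?_, ?_⟩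
  · intro i a b hab
    rw [hsum i a b hab.le]
    simp [hab.ne]
  · intro i a
    rw [hsum i a a le_rfl]
    simp only [true_and]
    rw [← Finset.sum_filter, Finset.sum_const, ← Nat.cast_smul_eq_nsmul ℂ]
    congr 1
    have h1 : (Finset.univ.filter fun k : Fin (Λ i ⟨0, hN⟩).toNat => ((k : ℕ) : ℤ) < Λ i a).card = (Λ i a).toNat := by
      have h2 := hdom i ⟨0, hN⟩ a (Nat.zero_le _)
      have h3 := hpoly i a
      have h4 : ∀ k : Fin (Λ i ⟨0, hN⟩).toNat, ((k : ℕ) : ℤ) < Λ i a ↔ (k : ℕ) < (Λ i a).toNat := by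
        intro k; omega
      simp only [h4]
      rw [Fin.card_filter_val_lt]
      omega
    rw [h1]
    have := Int.toNat_of_nonneg (hpoly i a)
    exact_mod_cast congrArg (Int.cast (R := ℂ)) this
end GaudinAux

set_option linter.unusedSectionVars false
set_option linter.unusedSimpArgs false
set_option linter.unusedVariables false
namespace GaudinAux

section Words
variable {N : ℕ} {I : Type*} [DecidableEq I] [Fintype I]
variable {W : Type*} [AddCommGroup W] [Module ℂ W]
variable (e : I → Fin N → Fin N → Module.End ℂ W) (ζ : W) (Λ : I → Fin N → ℤ)

/-- Lowering words applied to `ζ`. -/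
def lw : List (I × Fin N × Fin N) → W
  | [] => ζ
  | x :: l => e x.1 x.2.2 x.2.1 (lw l)

/-- Weights of lowering words. -/
def lwt : List (I × Fin N × Fin N) → I → Fin N → ℤ
  | [] => Λ
  | x :: l => fun j c => lwt l j c + (if j = x.1 ∧ c = x.2.2 then 1 else 0)
      - (if j = x.1 ∧ c = x.2.1 then 1 else 0)

/-- All letters are lowering. -/
def lgood (l : List (I × Fin N × Fin N)) : Prop := ∀ x ∈ l, x.2.1 < x.2.2

/-- Span of lowering words. -/
def lspan : Submodule ℂ W := Submodule.span ℂ {w | ∃ l, lgood l ∧ w = lw e ζ l}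

lemma lw_mem (l : List (I × Fin N × Fin N)) (hl : lgood l) : lw e ζ l ∈ lspan e ζ :=
  Submodule.subset_span ⟨l, hl, rfl⟩

variable {e ζ Λ}

lemma lw_wt (h : GLM e) (hΛ : ∀ i a, e i a a ζ = (Λ i a : ℂ) • ζ) (l : List (I × Fin N × Fin N)) :
    ∀ i a, e i a a (lw e ζ l) = (lwt Λ l i a : ℂ) • lw e ζ l := by
  induction l with
  | nil => exact hΛ
  | cons x l ih =>
    intro i a
    obtain ⟨j, c, d⟩ := x
    simp only [lw, lwt]
    by_cases hij : i = j
    · subst hij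
      have h1 := LinearMap.congr_fun (h.rel i a a d c) (lw e ζ l)
      simp only [LinearMap.sub_apply, Module.End.mul_apply] at h1
      rw [ih, map_smul] at h1
      rw [sub_eq_iff_eq_add.1 h1]
      by_cases had : a = d <;> by_cases hac : a = c
      · subst had; subst hac; simp
      · subst had; simp [hac, Ne.symm hac, add_smul, add_comm]
      · subst hac; simp [had, Ne.symm had, add_smul, sub_smul]; abel
      · simp [had, hac, Ne.symm had, Ne.symm hac]
    · have h1 := LinearMap.congr_fun (h.comm i j hij a a d c) (lw e ζ l)
      simp only [Module.End.mul_apply] at h1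
      rw [h1, ih, map_smul]
      simp [hij]

lemma lspan_low (i : I) (a b : Fin N) (hab : a < b) {w : W} (hw : w ∈ lspan e ζ) :
    e i b a w ∈ lspan e ζ := by
  have : lspan e ζ ≤ (lspan e ζ).comap (e i b a) := by
    refine Submodule.span_le.2 ?_
    rintro _ ⟨l, hl, rfl⟩
    refine lw_mem e ζ ((i, a, b) :: l) ?_
    intro x hx
    rcases List.mem_cons.1 hx with rfl | hx
    · exact hab
    · exact hl x hx
  exact this hw

lemma lspan_stable (h : GLM e) (hs : ∀ i a b, a < b → e i a b ζ = 0)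
    (hΛ : ∀ i a, e i a a ζ = (Λ i a : ℂ) • ζ) (i : I) (a b : Fin N) {w : W} (hw : w ∈ lspan e ζ) :
    e i a b w ∈ lspan e ζ := by
  have key : ∀ l : List (I × Fin N × Fin N), lgood l → ∀ i a b, e i a b (lw e ζ l) ∈ lspan e ζ := by
    intro l
    induction l with
    | nil =>
      intro hl i a b
      rcases lt_trichotomy a b with hab | rfl | hab
      · rw [lw, hs i a b hab]; exact zero_mem _
      · rw [lw, hΛ]; exact Submodule.smul_mem _ _ (lw_mem e ζ [] hl)
      · exact lspan_low i b a hab (lw_mem e ζ [] hl)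
    | cons x l ih =>
      intro hl i a b
      obtain ⟨j, c, d⟩ := x
      have hcd : c < d := hl (j, c, d) (by simp)
      have hl' : lgood l := fun y hy => hl y (List.mem_cons_of_mem _ hy)
      have ih' := ih hl'
      simp only [lw]
      by_cases hij : i = j
      · subst hij
        have h1 := LinearMap.congr_fun (h.rel i a b d c) (lw e ζ l)
        simp only [LinearMap.sub_apply, Module.End.mul_apply] at h1
        rw [sub_eq_iff_eq_add.1 h1]
        refine add_mem (sub_mem ?_ ?_) (lspan_low _ _ _ hcd (ih' _ _ _))
        · split_ifs
          · exact ih' _ _ _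
          · exact zero_mem _
        · split_ifs
          · exact ih' _ _ _
          · exact zero_mem _
      · have h1 := LinearMap.congr_fun (h.comm i j hij a b d c) (lw e ζ l)
        simp only [Module.End.mul_apply] at h1
        rw [h1]
        exact lspan_low _ _ _ hcd (ih' _ _ _)
  have : lspan e ζ ≤ (lspan e ζ).comap (e i a b) := by
    refine Submodule.span_le.2 ?_
    rintro _ ⟨l, hl, rfl⟩
    exact key l hl i a b
  exact this hw

end Words

section Cas
variable {N : ℕ} {I : Type*} [DecidableEq I] [Fintype I]
variable {W : Type*} [AddCommGroup W] [Module ℂ W]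

/-- Casimir operator. -/
def Cas (e : I → Fin N → Fin N → Module.End ℂ W) : Module.End ℂ W :=
  ∑ i, ∑ a, ∑ b, e i a b * e i b a

variable {e : I → Fin N → Fin N → Module.End ℂ W}

lemma Cas_comm (h : GLM e) (j : I) (c d : Fin N) : e j c d * Cas e = Cas e * e j c d := by
  rw [← sub_eq_zero, Cas, Finset.mul_sum, Finset.sum_mul, ← Finset.sum_sub_distrib]
  refine Finset.sum_eq_zero fun i _ => ?_
  by_cases hij : j = i
  · subst hij
    have h1 : ∀ a b, e j c d * (e j a b * e j b a) - (e j a b * e j b a) * e j c d =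
        (if d = a then e j c b * e j b a else 0) - (if b = c then e j a d * e j b a else 0) +
        ((if d = b then e j a b * e j c a else 0) - (if a = c then e j a b * e j b d else 0)) := by
      intro a b
      have e1 := congrArg (· * e j b a) (h.rel j c d a b)
      have e2 := congrArg (e j a b * ·) (h.rel j c d b a)
      simp only [sub_mul, mul_sub, ite_mul, mul_ite, zero_mul, mul_zero] at e1 e2
      rw [← e1, ← e2]
      noncomm_ring
    simp only [Finset.mul_sum, Finset.sum_mul, ← Finset.sum_sub_distrib]
    simp only [h1, Finset.sum_add_distrib, Finset.sum_sub_distrib]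
    rw [Finset.sum_comm (f := fun a b => if d = a then e j c b * e j b a else 0),
      Finset.sum_comm (f := fun a b => if a = c then e j a b * e j b d else 0)]
    simp
  · simp only [Finset.mul_sum, Finset.sum_mul, ← Finset.sum_sub_distrib]
    refine Finset.sum_eq_zero fun a _ => Finset.sum_eq_zero fun b _ => ?_
    rw [← mul_assoc, h.comm j i hij, mul_assoc, h.comm j i hij, mul_assoc, sub_self]

/-- Casimir eigenvalue. -/
def cc (μ : I → Fin N → ℂ) : ℂ :=
  ∑ i, ∑ a, ∑ b, (if a = b then μ i a * μ i a else if a < b then μ i a - μ i b else 0)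

lemma Cas_sing (h : GLM e) {x : W} {μ : I → Fin N → ℂ} (hs : ∀ i a b, a < b → e i a b x = 0)
    (hμ : ∀ i a, e i a a x = μ i a • x) : Cas e x = cc μ • x := by
  simp only [Cas, cc, LinearMap.sum_apply, Finset.sum_smul]
  refine Finset.sum_congr rfl fun i _ => Finset.sum_congr rfl fun a _ =>
    Finset.sum_congr rfl fun b _ => ?_
  rw [Module.End.mul_apply]
  rcases lt_trichotomy a b with hab | rfl | hab
  · rw [if_neg hab.ne, if_pos hab]
    have h1 := LinearMap.congr_fun (h.rel i a b b a) x
    simp only [LinearMap.sub_apply, Module.End.mul_apply, if_true, hs i a b hab, map_zero,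
      sub_zero, hμ] at h1
    rw [h1, sub_smul]
  · rw [if_pos rfl, hμ, map_smul, hμ, smul_smul]
  · rw [if_neg hab.ne', if_neg hab.not_gt, hs i b a hab, map_zero, zero_smul]

lemma sum_lt_conv (f : Fin N → ℤ) :
    ∑ a, ∑ b, (if a < b then f a - f b else 0) = ∑ a : Fin N, f a * ((N : ℤ) - 1 - 2 * (a : ℕ)) := by
  have h1 : ∀ a b : Fin N, (if a < b then f a - f b else 0) =
      (if a < b then f a else 0) - (if a < b then f b else 0) := by
    intro a b; split_ifs <;> simp
  simp only [h1, Finset.sum_sub_distrib]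
  rw [Finset.sum_comm (f := fun a b => if a < b then f b else 0), ← Finset.sum_sub_distrib]
  refine Finset.sum_congr rfl fun a _ => ?_
  rw [← Finset.sum_filter, ← Finset.sum_filter, Finset.sum_const, Finset.sum_const]
  have h2 : (Finset.univ.filter fun b => a < b) = Finset.Ioi a := by ext; simp
  have h3 : (Finset.univ.filter fun b => b < a) = Finset.Iio a := by ext; simp
  rw [h2, h3, Fin.card_Ioi, Fin.card_Iio]
  have := a.2
  simp only [nsmul_eq_mul]
  rw [Nat.cast_sub (by omega), Nat.cast_sub (by omega)]
  push_cast; ring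

lemma cc_int (μ : I → Fin N → ℤ) : cc (fun i a => (μ i a : ℂ)) =
    ((∑ i, ∑ a : Fin N, μ i a * (μ i a + ((N : ℤ) - 1 - 2 * (a : ℕ))) : ℤ) : ℂ) := by
  have : (∑ i, ∑ a : Fin N, μ i a * (μ i a + ((N : ℤ) - 1 - 2 * (a : ℕ))) : ℤ) =
      ∑ i, ∑ a, ∑ b, (if a = b then μ i a * μ i a else if a < b then μ i a - μ i b else 0) := by
    refine Finset.sum_congr rfl fun i _ => ?_
    simp only [mul_add, Finset.sum_add_distrib]
    rw [← sum_lt_conv, ← Finset.sum_add_distrib]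
    refine Finset.sum_congr rfl fun a _ => ?_
    have h1 : ∀ b, (if a = b then μ i a * μ i a else if a < b then μ i a - μ i b else 0) =
        (if a = b then μ i a * μ i a else 0) + (if a < b then μ i a - μ i b else 0) := by
      intro b
      by_cases hab : a = b
      · subst hab; simp
      · simp [hab]
    simp only [h1, Finset.sum_add_distrib]
    simp
  rw [this, cc]
  push_cast
  rfl

lemma pair_le (Λ : I → Fin N → ℤ) (y : I → Fin N → ℤ) (hy : ∀ i a b, a < b → y i b + 1 ≤ y i a)
    (l : List (I × Fin N × Fin N)) (hl : lgood l) :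
    (l.length : ℤ) ≤ ∑ i, ∑ a, (Λ i a - lwt Λ l i a) * y i a := by
  induction l with
  | nil => simp [lwt]
  | cons x l ih =>
    obtain ⟨j, c, d⟩ := x
    have hcd : c < d := hl (j, c, d) (by simp)
    have ih' := ih fun y hy => hl y (List.mem_cons_of_mem _ hy)
    have h1 : ∑ i, ∑ a, (Λ i a - lwt Λ ((j, c, d) :: l) i a) * y i a =
        ∑ i, ∑ a, (Λ i a - lwt Λ l i a) * y i a + (y j c - y j d) := by
      have h2 : ∀ i a, (Λ i a - lwt Λ ((j, c, d) :: l) i a) * y i a =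
          (Λ i a - lwt Λ l i a) * y i a + ((if a = c then (if i = j then y i a else 0) else 0)
            - (if a = d then (if i = j then y i a else 0) else 0)) := by
        intro i a
        simp only [lwt]
        by_cases h1 : i = j
        · simp only [h1, true_and, if_true]
          split_ifs <;> ring
        · simp [h1]
      simp only [h2, Finset.sum_add_distrib, Finset.sum_sub_distrib]
      simp
    rw [h1]
    have := hy j c d hcd
    push_cast [List.length_cons]
    linarith

lemma cc_lt (Λ : I → Fin N → ℤ) (l : List (I × Fin N × Fin N)) (hl : lgood l)
    (hΛ : ∀ i a b, a < b → Λ i b ≤ Λ i a) (hμ : ∀ i a b, a < b → lwt Λ l i b ≤ lwt Λ l i a)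
    (hc : cc (fun i a => (Λ i a : ℂ)) = cc (fun i a => (lwt Λ l i a : ℂ))) : l = [] := by
  rw [cc_int, cc_int, Int.cast_inj] at hc
  have h1 := pair_le Λ (fun i a => Λ i a + lwt Λ l i a + ((N : ℤ) - 1 - 2 * (a : ℕ))) (by
    intro i a b hab
    have := hΛ i a b hab
    have := hμ i a b hab
    have : (a : ℕ) < b := hab
    omega) l hl
  have h2 : ∑ i, ∑ a : Fin N, (Λ i a - lwt Λ l i a) *
      (Λ i a + lwt Λ l i a + ((N : ℤ) - 1 - 2 * (a : ℕ))) = 0 := by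
    rw [← sub_eq_zero.2 hc, ← Finset.sum_sub_distrib]
    refine Finset.sum_congr rfl fun i _ => ?_
    rw [← Finset.sum_sub_distrib]
    refine Finset.sum_congr rfl fun a _ => ?_
    ring
  rw [h2] at h1
  exact List.length_eq_zero_iff.1 (by omega)

end Cas
end GaudinAux

set_option linter.unusedSectionVars false
set_option linter.unusedSimpArgs false
set_option linter.unusedVariables false
namespace GaudinAux

section Irr
variable {W : Type*} [AddCommGroup W] [Module ℂ W] [FiniteDimensional ℂ W]

/-- An operator on a nonzero stable subspace has an eigenvector there. -/
lemma eig_sub (T : Module.End ℂ W) (Q : Submodule ℂ W) (hQ : Q ≠ ⊥) (hT : ∀ x ∈ Q, T x ∈ Q) :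
    ∃ x ∈ Q, x ≠ 0 ∧ ∃ μ : ℂ, T x = μ • x := by
  have : Nontrivial Q := Submodule.nontrivial_iff_ne_bot.2 hQ
  obtain ⟨μ, hμ⟩ := Module.End.exists_eigenvalue (T.restrict hT)
  obtain ⟨x, hx⟩ := hμ.exists_hasEigenvector
  refine ⟨x, x.2, fun h => hx.2 (Subtype.ext h), μ, ?_⟩
  exact congrArg Subtype.val hx.apply_eq_smul

lemma common_eig {κ : Type*} (s : Finset κ) (T : κ → Module.End ℂ W)
    (hc : ∀ i j, T i * T j = T j * T i) (Q : Submodule ℂ W) (hQ : Q ≠ ⊥)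
    (hT : ∀ k, ∀ x ∈ Q, T k x ∈ Q) :
    ∃ Q' ≤ Q, Q' ≠ ⊥ ∧ (∀ k, ∀ x ∈ Q', T k x ∈ Q') ∧ ∀ k ∈ s, ∃ μ : ℂ, ∀ x ∈ Q', T k x = μ • x := by
  classical
  induction s using Finset.induction_on with
  | empty => exact ⟨Q, le_rfl, hQ, hT, by simp⟩
  | insert k s hk ih =>
    obtain ⟨Q', h1, h2, h3, h4⟩ := ih
    obtain ⟨x, hx, hx0, μ, hμ⟩ := eig_sub (T k) Q' h2 (h3 k)
    refine ⟨Q' ⊓ LinearMap.ker (T k - μ • 1), inf_le_left.trans h1, ?_, ?_, ?_⟩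
    · refine (Submodule.ne_bot_iff _).2 ⟨x, ⟨hx, ?_⟩, hx0⟩
      simp [LinearMap.mem_ker, hμ]
    · rintro l y ⟨hy1, hy2⟩
      refine ⟨h3 l y hy1, ?_⟩
      have hy3 : T k y = μ • y := by
        simpa [LinearMap.mem_ker, sub_eq_zero] using hy2
      have h5 := LinearMap.congr_fun (hc k l) y
      simp only [Module.End.mul_apply, hy3, map_smul] at h5
      simp [LinearMap.mem_ker, h5]
    · intro l hl
      rcases Finset.mem_insert.1 hl with rfl | hl
      · refine ⟨μ, fun y hy => ?_⟩
        simpa [LinearMap.mem_ker, sub_eq_zero] using hy.2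
      · obtain ⟨ν, hν⟩ := h4 l hl
        exact ⟨ν, fun y hy => hν y hy.1⟩

lemma max_eig (T : Module.End ℂ W) (Q : Submodule ℂ W) (hQ : Q ≠ ⊥) (hT : ∀ x ∈ Q, T x ∈ Q) :
    ∃ x ∈ Q, x ≠ 0 ∧ ∃ μ : ℂ, T x = μ • x ∧ ∀ y ∈ Q, ∀ r : ℕ, 0 < r → T y = (μ + r) • y → y = 0 := by
  have : Nontrivial Q := Submodule.nontrivial_iff_ne_bot.2 hQ
  let S : Module.End ℂ Q := T.restrict hT
  obtain ⟨μ0, hμ0⟩ := Module.End.exists_eigenvalue S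
  have hfin : Set.Finite {μ | S.HasEigenvalue μ} := Module.End.finite_hasEigenvalue S
  obtain ⟨μ, hμ, hmax⟩ := hfin.exists_maximalFor Complex.re _ ⟨μ0, hμ0⟩
  obtain ⟨x, hx⟩ := Module.End.HasEigenvalue.exists_hasEigenvector hμ
  refine ⟨x, x.2, fun h => hx.2 (Subtype.ext h), μ, congrArg Subtype.val hx.apply_eq_smul, ?_⟩
  intro y hy r hr hy2
  by_contra hy0
  have h1 : S.HasEigenvalue (μ + r) := by
    refine Module.End.hasEigenvalue_of_hasEigenvector (x := ⟨y, hy⟩) ⟨?_, ?_⟩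
    · rw [Module.End.mem_eigenspace_iff]; exact Subtype.ext hy2
    · intro h; exact hy0 (congrArg Subtype.val h)
  have h2 := hmax h1 (by simp)
  simp at h2
  omega

variable {N : ℕ} {I : Type*} [DecidableEq I] [Fintype I]
variable {e : I → Fin N → Fin N → Module.End ℂ W}

lemma exists_sing (h : GLM e) (Q : Submodule ℂ W) (hQ : Q ≠ ⊥) (hT : ∀ i a b, ∀ x ∈ Q, e i a b x ∈ Q) :
    ∃ x ∈ Q, x ≠ 0 ∧ (∀ i a b, a < b → e i a b x = 0) ∧ ∃ μ : I → Fin N → ℂ, ∀ i a, e i a a x = μ i a • x := by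
  let H : Module.End ℂ W := ∑ i, ∑ a : Fin N, (-((a : ℕ) : ℂ)) • e i a a
  have hH : ∀ i a b, ∀ x, H (e i a b x) = e i a b (H x) + (((b : ℕ) : ℂ) - ((a : ℕ) : ℂ)) • e i a b x := by
    intro i a b x
    have h1 : ∀ j c, e j c c (e i a b x) = e i a b (e j c c x) +
        if j = i then ((if c = a then e i a b x else 0) - (if c = b then e i a b x else 0)) else 0 := by
      intro j c
      by_cases hji : j = i
      · subst hji
        have h2 := LinearMap.congr_fun (h.rel j c c a b) x
        simp only [LinearMap.sub_apply, Module.End.mul_apply] at h2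
        rw [sub_eq_iff_eq_add.1 h2, if_pos rfl, add_comm]
        congr 1
        by_cases hca : c = a <;> by_cases hcb : c = b
        · subst hca; subst hcb; simp
        · subst hca; simp [hcb, Ne.symm hcb]
        · subst hcb; simp [hca]
        · simp [hca, hcb, Ne.symm hcb]
      · have h2 := LinearMap.congr_fun (h.comm j i hji c c a b) x
        simp only [Module.End.mul_apply] at h2
        rw [h2, if_neg hji, add_zero]
    simp only [H, LinearMap.sum_apply, LinearMap.smul_apply, h1, smul_add, Finset.sum_add_distrib,
      map_sum, map_smul, smul_ite, smul_zero, smul_sub]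
    congr 1
    have h3 : ∀ j, (∑ c : Fin N, if j = i then
        ((if c = a then (-((c : ℕ) : ℂ)) • e i a b x else 0) - (if c = b then (-((c : ℕ) : ℂ)) • e i a b x else 0)) else 0)
        = if j = i then (((b : ℕ) : ℂ) - ((a : ℕ) : ℂ)) • e i a b x else 0 := by
      intro j
      split_ifs
      · rw [Finset.sum_sub_distrib]
        simp [sub_smul]; abel
      · simp
    rw [Finset.sum_congr rfl fun j _ => h3 j]
    simp
  have hHQ : ∀ x ∈ Q, H x ∈ Q := by
    intro x hx
    simp only [H, LinearMap.sum_apply, LinearMap.smul_apply]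
    exact Submodule.sum_mem _ fun i _ => Submodule.sum_mem _ fun a _ => Submodule.smul_mem _ _ (hT _ _ _ _ hx)
  obtain ⟨x, hxQ, hx0, ν, hν, hmax⟩ := max_eig H Q hQ hHQ
  have hx1 : ∀ i a b, a < b → e i a b x = 0 := by
    intro i a b hab
    have hab' : (a : ℕ) < b := hab
    refine hmax _ (hT _ _ _ _ hxQ) ((b : ℕ) - a) (by omega) ?_
    rw [hH, hν, map_smul, ← add_smul, Nat.cast_sub hab'.le]
  let K : Submodule ℂ W := Q ⊓ ⨅ (i : I) (a : Fin N) (b : Fin N) (_ : a < b), LinearMap.ker (e i a b)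
  have hK : ∀ y, y ∈ K ↔ y ∈ Q ∧ ∀ i a b, a < b → e i a b y = 0 := by
    intro y; simp [K, Submodule.mem_iInf]
  have hcom : ∀ p q : I × Fin N, e p.1 p.2 p.2 * e q.1 q.2 q.2 = e q.1 q.2 q.2 * e p.1 p.2 p.2 := by
    rintro ⟨i, a⟩ ⟨j, b⟩
    by_cases hij : i = j
    · subst hij
      have := h.rel i a a b b
      rw [← sub_eq_zero]
      dsimp only
      rw [this]
      by_cases hab : a = b
      · subst hab; simp
      · simp [hab, Ne.symm hab]
    · exact h.comm i j hij _ _ _ _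
  have hKT : ∀ p : I × Fin N, ∀ y ∈ K, e p.1 p.2 p.2 y ∈ K := by
    rintro ⟨i, a⟩ y hy
    rw [hK] at hy ⊢
    refine ⟨hT _ _ _ _ hy.1, fun j c d hcd => ?_⟩
    by_cases hij : j = i
    · subst hij
      have h2 := LinearMap.congr_fun (h.rel j c d a a) y
      simp only [LinearMap.sub_apply, Module.End.mul_apply, hy.2 j c d hcd, map_zero, sub_zero] at h2
      rw [h2]
      by_cases hda : d = a <;> by_cases hca : a = c
      · subst hda; subst hca; exact absurd hcd (lt_irrefl _)
      · subst hda; simp [hca, hy.2 j c d hcd]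
      · subst hca; simp [hda, hy.2 j a d hcd]
      · simp [hda, hca]
    · have h2 := LinearMap.congr_fun (h.comm j i hij c d a a) y
      simp only [Module.End.mul_apply, hy.2 j c d hcd, map_zero] at h2
      exact h2
  obtain ⟨Q', h1, h2, h3, h4⟩ := common_eig Finset.univ (fun p : I × Fin N => e p.1 p.2 p.2) hcom K
    ((Submodule.ne_bot_iff _).2 ⟨x, (hK x).2 ⟨hxQ, hx1⟩, hx0⟩) hKT
  obtain ⟨y, hy, hy0⟩ := (Submodule.ne_bot_iff _).1 h2
  choose μ hμ using fun p => h4 p (Finset.mem_univ p)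
  have hy' := (hK y).1 (h1 hy)
  exact ⟨y, hy'.1, hy0, hy'.2, fun i a => μ (i, a), fun i a => hμ (i, a) y hy⟩

lemma sing_dom (h : GLM e) {x : W} (hx : x ≠ 0) (hs : ∀ i a b, a < b → e i a b x = 0)
    {μ : I → Fin N → ℤ} (hμ : ∀ i a, e i a a x = (μ i a : ℂ) • x) (i : I) (a b : Fin N) (hab : a < b) :
    μ i b ≤ μ i a := by
  letI : LieRing (Module.End ℂ W) := LieRing.ofAssociativeRing
  let hh : Module.End ℂ W := e i a a - e i b b
  have h1 : hh x = ((μ i a : ℂ) - μ i b) • x := by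
    simp [hh, hμ, sub_smul]
  by_cases h0 : hh = 0
  · rw [h0, LinearMap.zero_apply, eq_comm, smul_eq_zero, sub_eq_zero, Int.cast_inj] at h1
    rcases h1 with h1 | h1
    · exact h1.ge
    · exact absurd h1 hx
  · have t : IsSl2Triple hh (e i a b) (e i b a) := by
      refine ⟨h0, ?_, ?_, ?_⟩
      · rw [Ring.lie_def, h.rel]; simp [hh]
      · rw [Ring.lie_def]
        have e1 := h.rel i a a a b
        have e2 := h.rel i b b a b
        simp only [if_true, if_neg hab.ne, if_neg hab.ne', sub_zero, zero_sub] at e1 e2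
        have : hh * e i a b - e i a b * hh = (e i a a * e i a b - e i a b * e i a a) -
          (e i b b * e i a b - e i a b * e i b b) := by simp only [hh]; noncomm_ring
        rw [this, e1, e2, two_nsmul]; abel
      · rw [Ring.lie_def]
        have e1 := h.rel i a a b a
        have e2 := h.rel i b b b a
        simp only [if_true, if_neg hab.ne, if_neg hab.ne', sub_zero, zero_sub] at e1 e2
        have : hh * e i b a - e i b a * hh = (e i a a * e i b a - e i b a * e i a a) -
          (e i b b * e i b a - e i b a * e i b b) := by simp only [hh]; noncomm_ring
        rw [this, e1, e2, two_nsmul]; abel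
    have P : t.HasPrimitiveVectorWith x ((μ i a : ℂ) - μ i b) := ⟨hx, h1, hs i a b hab⟩
    obtain ⟨r, hr⟩ := P.exists_nat
    have : μ i a - μ i b = (r : ℤ) := by exact_mod_cast hr
    omega

lemma wt_indep {κ : Type*} (T : κ → Module.End ℂ W) (hc : ∀ i j, T i * T j = T j * T i)
    (χ : κ → ℂ) (x : W) (hx : ∀ k, T k x = χ k • x) (S : Set W)
    (hS : ∀ s ∈ S, ∃ χ' : κ → ℂ, χ' ≠ χ ∧ ∀ k, T k s = χ' k • s) (hxS : x ∈ Submodule.span ℂ S) :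
    x = 0 := by
  have ind := Module.End.independent_iInf_maxGenEigenspace_of_forall_mapsTo T (fun i j φ =>
    Module.End.mapsTo_maxGenEigenspace_of_comm (hc j i) φ)
  have hm : ∀ (χ : κ → ℂ) (y : W), (∀ k, T k y = χ k • y) → y ∈ ⨅ i, (T i).maxGenEigenspace (χ i) := by
    intro χ y hy
    rw [Submodule.mem_iInf]
    intro k
    exact (Module.End.genEigenspace (T k) (χ k)).mono le_top (Module.End.mem_eigenspace_iff.2 (hy k))
  have h1 := (ind χ)
  refine Submodule.disjoint_def.1 h1 x (hm χ x hx) ?_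
  refine (Submodule.span_le.2 ?_) hxS
  intro s hs
  obtain ⟨χ', hχ, h2⟩ := hS s hs
  have := le_iSup₂ (f := fun (j : κ → ℂ) (_ : j ≠ χ) => ⨅ i, (T i).maxGenEigenspace (j i)) χ' hχ
  exact this (hm χ' s h2)

/-- Irreducibility of a highest weight module. -/
lemma irr (h : GLM e) {ζ : W} {Λ : I → Fin N → ℤ} (hs : ∀ i a b, a < b → e i a b ζ = 0)
    (hΛ : ∀ i a, e i a a ζ = (Λ i a : ℂ) • ζ) (hdom : ∀ i a b, a < b → Λ i b ≤ Λ i a)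
    (Q : Submodule ℂ W) (hQ : Q ≤ lspan e ζ) (hQ0 : Q ≠ ⊥) (hT : ∀ i a b, ∀ x ∈ Q, e i a b x ∈ Q) :
    ζ ∈ Q := by
  obtain ⟨x, hxQ, hx0, hxs, μ, hμ⟩ := exists_sing h Q hQ0 hT
  have hcom : ∀ p q : I × Fin N, e p.1 p.2 p.2 * e q.1 q.2 q.2 = e q.1 q.2 q.2 * e p.1 p.2 p.2 := by
    rintro ⟨i, a⟩ ⟨j, b⟩
    by_cases hij : i = j
    · subst hij
      have := h.rel i a a b b
      rw [← sub_eq_zero]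
      dsimp only
      rw [this]
      by_cases hab : a = b
      · subst hab; simp
      · simp [hab, Ne.symm hab]
    · exact h.comm i j hij _ _ _ _
  -- Casimir
  have hcas : cc (fun i a => (Λ i a : ℂ)) = cc μ := by
    have h1 : lspan e ζ ≤ LinearMap.ker (Cas e - cc (fun i a => (Λ i a : ℂ)) • (1 : Module.End ℂ W)) := by
      refine Submodule.span_le.2 ?_
      rintro _ ⟨l, -, rfl⟩
      induction l with
      | nil => simp [lw, Cas_sing h hs hΛ]
      | cons y l ih =>
        have ih' : Cas e (lw e ζ l) = cc (fun i a => (Λ i a : ℂ)) • lw e ζ l := by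
          simpa [sub_eq_zero] using ih
        have h2 := LinearMap.congr_fun (Cas_comm h y.1 y.2.2 y.2.1) (lw e ζ l)
        simp only [Module.End.mul_apply, ih', map_smul] at h2
        simp [lw, ← h2]
    have h2 := h1 (hQ hxQ)
    rw [LinearMap.mem_ker, LinearMap.sub_apply, Cas_sing h hxs hμ, LinearMap.smul_apply,
      Module.End.one_apply, ← sub_smul, smul_eq_zero, sub_eq_zero] at h2
    exact (h2.resolve_right hx0).symm
  have key : ∀ l : List (I × Fin N × Fin N), lgood l → (∀ i a, (lwt Λ l i a : ℂ) = μ i a) → l = [] := by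
    intro l hl hlμ
    refine cc_lt Λ l hl hdom (fun i a b hab => sing_dom h hx0 hxs (fun i a => ?_) i a b hab) ?_
    · rw [hμ, hlμ]
    · rw [hcas]; congr 1; ext i a; rw [hlμ]
  have hx2 : x ∈ Submodule.span ℂ {ζ} ⊔ Submodule.span ℂ {w | ∃ l, lgood l ∧
      (¬ ∀ i a, (lwt Λ l i a : ℂ) = μ i a) ∧ w = lw e ζ l} := by
    refine (Submodule.span_le.2 ?_) (hQ hxQ)
    rintro _ ⟨l, hl, rfl⟩
    by_cases hlμ : ∀ i a, (lwt Λ l i a : ℂ) = μ i a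
    · rw [key l hl hlμ]
      exact Submodule.mem_sup_left (Submodule.subset_span rfl)
    · exact Submodule.mem_sup_right (Submodule.subset_span ⟨l, hl, hlμ, rfl⟩)
  by_cases hΛμ : ∀ i a, (Λ i a : ℂ) = μ i a
  · obtain ⟨y, hy, w, hw, rfl⟩ := Submodule.mem_sup.1 hx2
    obtain ⟨c, rfl⟩ := Submodule.mem_span_singleton.1 hy
    have hw0 : w = 0 := by
      refine wt_indep (fun p : I × Fin N => e p.1 p.2 p.2) hcom (fun p => μ p.1 p.2) w ?_ _ ?_ hw
      · rintro ⟨i, a⟩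
        have h1 := hμ i a
        rw [map_add, map_smul, hΛ, hΛμ, smul_add, smul_comm] at h1
        exact add_left_cancel h1
      · rintro _ ⟨l, hl, hl2, rfl⟩
        refine ⟨fun p => (lwt Λ l p.1 p.2 : ℂ), fun h3 => hl2 fun i a => congrFun h3 (i, a), fun p => lw_wt h hΛ l _ _⟩
    subst hw0
    rw [add_zero] at hxQ hx0
    have hc : c ≠ 0 := by rintro rfl; simp at hx0
    exact (Submodule.smul_mem_iff _ hc).1 hxQ
  · exfalso
    refine hx0 (wt_indep (fun p : I × Fin N => e p.1 p.2 p.2) hcom (fun p => μ p.1 p.2) x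
      (fun p => hμ _ _) {w | ∃ l, lgood l ∧ (¬ ∀ i a, (lwt Λ l i a : ℂ) = μ i a) ∧ w = lw e ζ l} ?_ ?_)
    · rintro _ ⟨l, hl, hl2, rfl⟩
      refine ⟨fun p => (lwt Λ l p.1 p.2 : ℂ), fun h3 => hl2 fun i a => congrFun h3 (i, a), fun p => lw_wt h hΛ l _ _⟩
    · refine (show _ ≤ _ from sup_le (Submodule.span_le.2 ?_) le_rfl : _ ≤ Submodule.span ℂ _) hx2
      rintro _ rfl
      refine Submodule.subset_span ⟨[], ?_, hΛμ, rfl⟩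
      intro y hy; simp at hy

end Irr
end GaudinAux

set_option linter.unusedSectionVars false
set_option linter.unusedSimpArgs false
set_option linter.unusedVariables false
namespace GaudinAux
open GaudinModel

section Tens
variable {N n : ℕ} (V : Fin n → Type*) [∀ i, AddCommGroup (V i)] [∀ i, Module ℂ (V i)]
  (M : Type*) [NormedAddCommGroup M] [NormedSpace ℂ M]
  (E : ∀ i : Fin n, Fin N → Fin N → (V i →ₗ[ℂ] V i))
  (φ : M ≃ₗ[ℂ] PiTensorProduct ℂ V)

lemma EE_tprod (j : Fin n) (a b : Fin N) (x : ∀ i, V i) :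
    EE V M E φ j a b (φ.symm (PiTensorProduct.tprod ℂ x)) =
      φ.symm (PiTensorProduct.tprod ℂ (Function.update x j (E j a b (x j)))) := by
  simp only [EE, LinearMap.comp_apply, LinearEquiv.coe_coe, LinearEquiv.apply_symm_apply,
    PiTensorProduct.map_tprod]
  congr 2
  ext i
  by_cases hij : i = j
  · subst hij; simp
  · simp [hij]

/-- Vary one component. -/
def tcomp (j : Fin n) (x : ∀ i, V i) : V j →ₗ[ℂ] M :=
  φ.symm.toLinearMap ∘ₗ (PiTensorProduct.tprod ℂ).toLinearMap x j

lemma tcomp_apply (j : Fin n) (x : ∀ i, V i) (y : V j) :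
    tcomp V M φ j x y = φ.symm (PiTensorProduct.tprod ℂ (Function.update x j y)) := rfl

lemma EE_tcomp (j : Fin n) (a b : Fin N) (x : ∀ i, V i) (y : V j) :
    EE V M E φ j a b (tcomp V M φ j x y) = tcomp V M φ j x (E j a b y) := by
  rw [tcomp_apply, EE_tprod, tcomp_apply]
  simp

lemma span_tp : Submodule.span ℂ (Set.range fun x : ∀ i, V i => φ.symm (PiTensorProduct.tprod ℂ x)) = ⊤ := by
  have h1 := PiTensorProduct.span_tprod_eq_top (R := ℂ) (s := V)
  have h2 := congrArg (Submodule.map φ.symm.toLinearMap) h1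
  rw [Submodule.map_span, ← Set.range_comp, Submodule.map_top, LinearEquiv.range] at h2
  exact h2

lemma end_ext {A B : Module.End ℂ M}
    (h : ∀ x, A (φ.symm (PiTensorProduct.tprod ℂ x)) = B (φ.symm (PiTensorProduct.tprod ℂ x))) : A = B := by
  refine LinearMap.ext_on_range (span_tp V M φ) ?_
  exact h

lemma EE_glm (hrel : GlRel V E) : GLM (EE V M E φ) where
  rel j a b c f := by
    refine end_ext V M φ fun x => ?_
    have h0 : φ.symm (PiTensorProduct.tprod ℂ x) = tcomp V M φ j x (x j) := by
      rw [tcomp_apply]; simp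
    rw [h0]
    have h1 := congrArg (tcomp V M φ j x) (LinearMap.congr_fun (hrel j a b c f) (x j))
    simp only [LinearMap.sub_apply, LinearMap.comp_apply, LinearMap.smul_apply, map_sub, map_smul] at h1
    simp only [LinearMap.sub_apply, Module.End.mul_apply, EE_tcomp]
    rw [h1]
    congr 1 <;> split_ifs <;> simp [EE_tcomp]
  comm i j hij a b c f := by
    refine end_ext V M φ fun x => ?_
    simp only [Module.End.mul_apply, EE_tprod]
    rw [Function.update_of_ne hij, Function.update_of_ne hij.symm, Function.update_comm hij]

lemma EE_cyc (v : ∀ i, V i)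
    (hv : ∀ i, ∀ W : Submodule ℂ (V i), (∀ a b : Fin N, ∀ x ∈ W, E i a b x ∈ W) → v i ∈ W →
      ∀ x : V i, x ∈ W)
    (W : Submodule ℂ M) (hW : ∀ i a b, ∀ x ∈ W, EE V M E φ i a b x ∈ W)
    (hvW : φ.symm (PiTensorProduct.tprod ℂ v) ∈ W) : W = ⊤ := by
  classical
  have key : ∀ s : Finset (Fin n), ∀ x : ∀ i, V i, (∀ i, i ∉ s → x i = v i) →
      φ.symm (PiTensorProduct.tprod ℂ x) ∈ W := by
    intro s
    induction s using Finset.induction_on with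
    | empty =>
      intro x hx
      have : x = v := by ext i; exact hx i (by simp)
      rw [this]; exact hvW
    | insert k s hk ih =>
      intro x hx
      have h1 := hv k (W.comap (tcomp V M φ k x)) (by
        intro a b y hy
        rw [Submodule.mem_comap, ← EE_tcomp]
        exact hW _ _ _ _ hy) (by
        rw [Submodule.mem_comap, tcomp_apply]
        refine ih _ fun i hi => ?_
        by_cases hik : i = k
        · subst hik; simp
        · rw [Function.update_of_ne hik]
          exact hx i (by simp [hik, hi])) (x k)
      rw [Submodule.mem_comap, tcomp_apply, Function.update_eq_self] at h1
      exact h1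
  rw [eq_top_iff, ← span_tp V M φ]
  refine Submodule.span_le.2 ?_
  rintro _ ⟨x, rfl⟩
  exact key Finset.univ x (by simp)

variable [FiniteDimensional ℂ M]

lemma PK_EE (hN : 0 < N) (Λ : Fin n → Fin N → ℤ)
    (hdom : ∀ i, ∀ a b : Fin N, a ≤ b → Λ i b ≤ Λ i a) (hpoly : ∀ i a, 0 ≤ Λ i a)
    (hrel : GlRel V E) (hhw : IsHW V E Λ) (z : Fin n → ℂ) : PK (EE V M E φ) z := by
  obtain ⟨J, _, _, blk, t, ht0, hts, htw⟩ := exists_T hN Λ hdom hpoly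
  choose v hv0 hvs hvw hvc using hhw
  let eM := EE V M E φ
  let eTT : Fin n → Fin N → Fin N → Module.End ℂ (TT N J) := blkE blk (eT (N := N))
  have gM : GLM eM := EE_glm V M E φ hrel
  have gT : GLM eTT := blkE_glm blk eT_glm
  let e : Fin n → Fin N → Fin N → Module.End ℂ (M × TT N J) := fun i a b => (eM i a b).prodMap (eTT i a b)
  have ge : GLM e := by
    constructor
    · intro j a b c f
      have h1 := gM.rel j a b c f
      have h2 := gT.rel j a b c f
      refine LinearMap.ext fun x => ?_
      have h1' := LinearMap.congr_fun h1 x.1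
      have h2' := LinearMap.congr_fun h2 x.2
      refine Prod.ext ?_ ?_
      · refine Eq.trans h1' ?_
        simp only [e]
        split_ifs <;> simp
      · refine Eq.trans h2' ?_
        simp only [e]
        split_ifs <;> simp
    · intro i j hij a b c f
      refine LinearMap.ext fun x => Prod.ext ?_ ?_
      · exact LinearMap.congr_fun (gM.comm i j hij a b c f) x.1
      · exact LinearMap.congr_fun (gT.comm i j hij a b c f) x.2
  let vv : M := φ.symm (PiTensorProduct.tprod ℂ v)
  have hvv : ∀ i, vv = tcomp V M φ i v (v i) := by
    intro i; rw [tcomp_apply]; simp [vv]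
  let ζ : M × TT N J := (vv, t)
  have hζs : ∀ i a b, a < b → e i a b ζ = 0 := by
    intro i a b hab
    refine Prod.ext ?_ (hts i a b hab)
    show EE V M E φ i a b vv = 0
    rw [hvv i, EE_tcomp, hvs i a b hab, map_zero]
  have hζw : ∀ i a, e i a a ζ = (Λ i a : ℂ) • ζ := by
    intro i a
    refine Prod.ext ?_ (htw i a)
    show EE V M E φ i a a vv = (Λ i a : ℂ) • vv
    rw [hvv i, EE_tcomp, hvw i a, map_smul]
  let Z : Submodule ℂ (M × TT N J) := lspan e ζ
  have hZ : ∀ i a b, ∀ x ∈ Z, e i a b x ∈ Z := fun i a b x hx => lspan_stable ge hζs hζw i a b hx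
  have hζZ : ζ ∈ Z := lw_mem e ζ [] (by intro x hx; simp at hx)
  let eZ : Fin n → Fin N → Fin N → Module.End ℂ Z := fun i a b => (e i a b).restrict (hZ i a b)
  have hT : PK eTT z := PK_blk blk _ z (PK_T _)
  have hPZ : PK eZ z := by
    refine PK_inj z ((LinearMap.snd ℂ M (TT N J)) ∘ₗ Z.subtype) (fun j a b x => rfl) ?_ hT
    rw [← LinearMap.ker_eq_bot]
    by_contra hne
    have h1 := irr ge hζs hζw (fun i a b hab => hdom i a b hab.le)
      (Submodule.map Z.subtype (LinearMap.ker ((LinearMap.snd ℂ M (TT N J)) ∘ₗ Z.subtype)))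
      (Submodule.map_subtype_le _ _) (by
        intro h; apply hne
        exact (Submodule.map_injective_of_injective Z.injective_subtype)
          (h.trans (Submodule.map_bot _).symm)) (by
        rintro i a b _ ⟨x, hx, rfl⟩
        refine ⟨eZ i a b x, ?_, rfl⟩
        have hx' : (x : M × TT N J).2 = 0 := hx
        show eTT i a b (x : M × TT N J).2 = 0
        rw [hx', map_zero])
    obtain ⟨x, hx, hxζ⟩ := h1
    have hx' : (x : M × TT N J).2 = 0 := hx
    have hx2 : (x : M × TT N J) = ζ := hxζ
    rw [hx2] at hx'
    exact ht0 hx'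
  refine PK_surj z ((LinearMap.fst ℂ M (TT N J)) ∘ₗ Z.subtype) (fun j a b x => rfl) ?_ hPZ
  rw [← LinearMap.range_eq_top]
  refine EE_cyc V M E φ v hvc _ ?_ ⟨⟨ζ, hζZ⟩, rfl⟩
  rintro i a b _ ⟨x, rfl⟩
  exact ⟨eZ i a b x, rfl⟩

end Tens
end GaudinAux

set_option linter.unusedSectionVars false
set_option linter.unusedSimpArgs false
set_option linter.unusedVariables false
namespace GaudinAux
open Filter Topology

section Asym
variable {M : Type*} [NormedAddCommGroup M] [NormedSpace ℂ M] [FiniteDimensional ℂ M]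

/-- `F(u) ~ u^s w` at infinity, with a Taylor expansion. -/
def Asy (F : ℂ → M) (s : ℤ) (w : M) : Prop :=
  ∃ h : ℂ → M, AnalyticAt ℂ h 0 ∧ h 0 = w ∧ ∀ᶠ t in 𝓝[≠] (0 : ℂ), F t⁻¹ = t ^ (-s) • h t

lemma Asy_add {F G : ℂ → M} {s : ℤ} {w v : M} (hF : Asy F s w) (hG : Asy G s v) :
    Asy (fun u => F u + G u) s (w + v) := by
  obtain ⟨h, h1, h2, h3⟩ := hF
  obtain ⟨g, g1, g2, g3⟩ := hG
  refine ⟨fun t => h t + g t, h1.add g1, by simp [h2, g2], ?_⟩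
  filter_upwards [h3, g3] with t ht gt
  rw [ht, gt, smul_add]

lemma Asy_smul {F : ℂ → M} {s : ℤ} {w : M} (c : ℂ) (hF : Asy F s w) :
    Asy (fun u => c • F u) s (c • w) := by
  obtain ⟨h, h1, h2, h3⟩ := hF
  refine ⟨fun t => c • h t, analyticAt_const.smul h1, by simp [h2], ?_⟩
  filter_upwards [h3] with t ht
  rw [ht, smul_comm]

lemma Asy_zero (s : ℤ) : Asy (fun _ => (0 : M)) s 0 :=
  ⟨fun _ => 0, analyticAt_const, rfl, by simp⟩

lemma Asy_sum {κ : Type*} (T : Finset κ) {F : κ → ℂ → M} {s : ℤ} {w : κ → M}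
    (h : ∀ k ∈ T, Asy (F k) s (w k)) : Asy (fun u => ∑ k ∈ T, F k u) s (∑ k ∈ T, w k) := by
  classical
  induction T using Finset.induction_on with
  | empty => simpa using Asy_zero s
  | insert k T hk ih =>
    simp only [Finset.sum_insert hk]
    exact Asy_add (h k (by simp)) (ih fun l hl => h l (Finset.mem_insert_of_mem hl))

lemma Asy_lin {F : ℂ → M} {s : ℤ} {w : M} (A : Module.End ℂ M) (hF : Asy F s w) :
    Asy (fun u => A (F u)) s (A w) := by
  obtain ⟨h, h1, h2, h3⟩ := hF
  refine ⟨fun t => A (h t), ?_, by simp [h2], ?_⟩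
  · exact (LinearMap.toContinuousLinearMap A).analyticAt _ |>.comp h1
  filter_upwards [h3] with t ht
  rw [ht, map_smul]

lemma Asy_pole {F : ℂ → M} {s : ℤ} {w : M} (z : ℂ) (hF : Asy F s w) :
    Asy (fun u => (u - z)⁻¹ • F u) (s - 1) w := by
  obtain ⟨h, h1, h2, h3⟩ := hF
  refine ⟨fun t => (1 - z * t)⁻¹ • h t, ?_, by simp [h2], ?_⟩
  · refine AnalyticAt.smul (AnalyticAt.inv (by fun_prop) (by simp)) h1
  have h0 : ∀ᶠ t in 𝓝[≠] (0 : ℂ), t ≠ 0 := eventually_mem_nhdsWithin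
  filter_upwards [h3, h0] with t ht ht0
  rw [ht, smul_smul, smul_smul]
  congr 1
  have e1 : t⁻¹ - z = t⁻¹ * (1 - z * t) := by field_simp
  rw [e1, mul_inv, inv_inv, show -(s - 1) = -s + 1 by ring, zpow_add_one₀ ht0]
  ring

lemma Asy_deriv {F : ℂ → M} {s : ℤ} {w : M} (hF : Asy F s w) :
    Asy (deriv F) (s - 1) ((s : ℂ) • w) := by
  obtain ⟨h, h1, h2, h3⟩ := hF
  refine ⟨fun t => (s : ℂ) • h t - t • deriv h t, ?_, by simp [h2], ?_⟩
  · have := FiniteDimensional.complete ℂ M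
    exact (analyticAt_const.smul h1).sub (analyticAt_id.smul h1.deriv)
  have h0 : ∀ᶠ t in 𝓝[≠] (0 : ℂ), t ≠ 0 := eventually_mem_nhdsWithin
  have h4 : ∀ᶠ t in 𝓝[≠] (0 : ℂ), AnalyticAt ℂ h t := h1.eventually_analyticAt.filter_mono nhdsWithin_le_nhds
  have h5 := eventually_eventually_nhdsWithin.2 h3
  filter_upwards [h0, h4, h5] with t ht0 ht4 ht5
  have hopen : IsOpen ({0}ᶜ : Set ℂ) := isOpen_compl_singleton
  rw [hopen.nhdsWithin_eq ht0] at ht5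
  have hinv : Tendsto (fun u : ℂ => u⁻¹) (𝓝 t⁻¹) (𝓝 t) := by
    have := (continuousAt_inv₀ (inv_ne_zero ht0)).tendsto
    rwa [inv_inv] at this
  have h6 : F =ᶠ[𝓝 t⁻¹] fun u => u ^ s • h u⁻¹ := by
    filter_upwards [hinv.eventually ht5] with u hu
    rw [inv_inv] at hu
    rw [hu]
    simp
  rw [h6.deriv_eq]
  have d1 : HasDerivAt (fun u : ℂ => u ^ s) ((s : ℂ) * t⁻¹ ^ (s - 1)) t⁻¹ :=
    hasDerivAt_zpow s t⁻¹ (Or.inl (inv_ne_zero ht0))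
  have d2 : HasDerivAt (fun u : ℂ => u⁻¹) (-(t⁻¹ ^ 2)⁻¹) t⁻¹ := hasDerivAt_inv (inv_ne_zero ht0)
  have d3 : HasDerivAt h (deriv h t) (t⁻¹)⁻¹ := by
    rw [inv_inv]; exact ht4.differentiableAt.hasDerivAt
  have d4 := d1.smul (d3.scomp t⁻¹ d2)
  have d5 : deriv (fun u : ℂ => u ^ s • h u⁻¹) t⁻¹ = _ := d4.deriv
  rw [d5]
  simp only [Function.comp, inv_inv]
  have hA : t⁻¹ ^ s * -(t⁻¹ ^ 2)⁻¹ = -(t ^ (-(s - 1)) * t) := by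
    rw [inv_zpow', show -(s - 1) = -s + 1 by ring, zpow_add_one₀ ht0]
    field_simp
  have hB : (s : ℂ) * t⁻¹ ^ (s - 1) = t ^ (-(s - 1)) * s := by
    rw [inv_zpow', mul_comm]
  rw [smul_sub, smul_smul, smul_smul, smul_smul, hA, hB, neg_smul]
  abel

lemma Asy_congr {F G : ℂ → M} {s : ℤ} {w : M} (hF : Asy F s w)
    (hFG : ∀ᶠ t in 𝓝[≠] (0 : ℂ), G t⁻¹ = F t⁻¹) : Asy G s w := by
  obtain ⟨h, h1, h2, h3⟩ := hF
  refine ⟨h, h1, h2, ?_⟩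
  filter_upwards [h3, hFG] with t ht1 ht2
  rw [ht2, ht1]

lemma Asy_unique {s : ℤ} {w : M} (hF : Asy (fun _ => (0 : M)) s w) : w = 0 := by
  obtain ⟨h, h1, h2, h3⟩ := hF
  have h0 : ∀ᶠ t in 𝓝[≠] (0 : ℂ), t ≠ 0 := eventually_mem_nhdsWithin
  have h4 : Tendsto h (𝓝[≠] 0) (𝓝 w) := by
    rw [← h2]; exact h1.continuousAt.tendsto.mono_left nhdsWithin_le_nhds
  refine tendsto_nhds_unique h4 (tendsto_const_nhds.congr' ?_)
  filter_upwards [h3, h0] with t ht ht0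
  rw [eq_comm, smul_eq_zero] at ht
  exact (ht.resolve_left (zpow_ne_zero _ ht0)).symm

lemma Asy_pol {D : ℕ} (c : Fin D → M) (s : Fin D) (hs : ∀ i, s < i → c i = 0) :
    Asy (pfL M D c) ((s : ℕ) : ℤ) (c s) := by
  refine ⟨fun t => ∑ i : Fin D, t ^ ((s : ℕ) - (i : ℕ)) • (if i ≤ s then c i else 0), ?_, ?_, ?_⟩
  · have := FiniteDimensional.complete ℂ M
    refine Differentiable.analyticAt (f := fun t : ℂ => ∑ i : Fin D, t ^ ((s : ℕ) - (i : ℕ)) • (if i ≤ s then c i else 0)) ?_ 0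
    fun_prop
  · show ∑ i : Fin D, (0 : ℂ) ^ ((s : ℕ) - (i : ℕ)) • (if i ≤ s then c i else 0) = c s
    rw [Finset.sum_eq_single s]
    · simp
    · intro i _ hi
      by_cases his : i ≤ s
      · have : (i : ℕ) < s := lt_of_le_of_ne his (Fin.val_ne_of_ne hi)
        rw [zero_pow (by omega), zero_smul]
      · simp [his]
    · simp
  · have h0 : ∀ᶠ t in 𝓝[≠] (0 : ℂ), t ≠ 0 := eventually_mem_nhdsWithin
    filter_upwards [h0] with t ht0
    rw [pfL_apply, Finset.smul_sum]
    refine Finset.sum_congr rfl fun i _ => ?_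
    by_cases his : i ≤ s
    · have his' : (i : ℕ) ≤ s := his
      rw [if_pos his, smul_smul]
      congr 1
      rw [← zpow_natCast t ((s : ℕ) - i), ← zpow_add₀ ht0, Nat.cast_sub his', inv_pow, ← zpow_natCast, ← zpow_neg]
      congr 1; ring
    · rw [if_neg his, smul_zero, hs i (not_le.1 his), smul_zero, smul_zero]

lemma Om_event {J : Type*} [Finite J] (z : J → ℂ) : ∀ᶠ t in 𝓝[≠] (0 : ℂ), t⁻¹ ∈ Om z := by
  have h1 : Tendsto (fun t : ℂ => t⁻¹) (𝓝[≠] 0) (Bornology.cobounded ℂ) := tendsto_inv₀_nhdsNE_zero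
  have h2 : ∀ᶠ u in Bornology.cobounded ℂ, u ∈ Om z := by
    have : (Set.range z)ᶜ ∈ Bornology.cobounded ℂ := Bornology.isBounded_def.1 (Set.finite_range z).isBounded
    exact this
  exact h1.eventually h2

variable {N : ℕ} {J : Type*} [DecidableEq J] [Fintype J]
  (e : J → Fin N → Fin N → Module.End ℂ M)

lemma Asy_XX (z : J → ℂ) (a b : Fin N) {F : HolS (Om z) M} {s : ℤ} {w : M} (hF : Asy F.1 s w) :
    Asy (XX (eS e) (zS z (Om_not z)) dS Finset.univ a b F).1 (s - 1)
      ((if a = b then (s : ℂ) • w else 0) - etot e Finset.univ b a w) := by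
  have h1 : Asy (fun u => (if a = b then deriv F.1 u else 0) +
      (-1 : ℂ) • ∑ j, (u - z j)⁻¹ • e j b a (F.1 u)) (s - 1)
      ((if a = b then (s : ℂ) • w else 0) + (-1 : ℂ) • ∑ j, e j b a w) := by
    refine Asy_add ?_ (Asy_smul _ (Asy_sum _ fun j _ => Asy_pole _ (Asy_lin _ hF)))
    split_ifs
    · exact Asy_deriv hF
    · exact Asy_zero _
  have h2 : (if a = b then (s : ℂ) • w else 0) - etot e Finset.univ b a w
      = (if a = b then (s : ℂ) • w else 0) + (-1 : ℂ) • ∑ j, e j b a w := by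
    rw [etot, LinearMap.sum_apply, neg_one_smul, sub_eq_add_neg]
  rw [h2]
  refine Asy_congr h1 ?_
  filter_upwards [Om_event z] with t ht
  rw [XX_apply e z _ a b F ht, neg_one_smul, sub_eq_add_neg]

/-- Leading coefficients. -/
def lead (s : ℤ) (w : M) : List (Fin N × Fin N) → M
  | [] => w
  | x :: l => (if x.1 = x.2 then (((s - l.length : ℤ)) : ℂ) • lead s w l else 0)
      - etot e Finset.univ x.2 x.1 (lead s w l)

lemma Asy_prod (z : J → ℂ) {F : HolS (Om z) M} {s : ℤ} {w : M} (hF : Asy F.1 s w)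
    (l : List (Fin N × Fin N)) :
    Asy ((l.map fun x => XX (eS e) (zS z (Om_not z)) dS Finset.univ x.1 x.2).prod F).1 (s - l.length)
      (lead e s w l) := by
  induction l with
  | nil => simpa [lead] using hF
  | cons x l ih =>
    have := Asy_XX e z x.1 x.2 ih
    rw [List.map_cons, List.prod_cons, Module.End.mul_apply, lead]
    convert this using 1
    push_cast [List.length_cons]; ring

/-- The scalar. -/
def lsc (s : ℤ) (m : Fin N → ℤ) : List (Fin N × Fin N) → ℂ
  | [] => 1
  | x :: l => (((s - l.length - m x.1 : ℤ)) : ℂ) * lsc s m l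

open Classical in
lemma lead_sing {s : ℤ} {w : M} {m : Fin N → ℤ} (hm : ∀ a, etot e Finset.univ a a w = (m a : ℂ) • w)
    (hs : ∀ a b, a < b → etot e Finset.univ a b w = 0) (l : List (Fin N × Fin N))
    (H : ∀ l1 x l2, l = l1 ++ x :: l2 → (∀ y ∈ l2, y.1 = y.2) → x.2 ≤ x.1) :
    lead e s w l = if ∀ y ∈ l, y.1 = y.2 then lsc s m l • w else 0 := by
  induction l with
  | nil => simp [lead, lsc]
  | cons x l ih =>
    have ih' := ih fun l1 y l2 h => H (x :: l1) y l2 (by rw [h]; rfl)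
    rw [lead, ih']
    by_cases hl : ∀ y ∈ l, y.1 = y.2
    · rw [if_pos hl]
      have hx := H [] x l rfl hl
      by_cases hxx : x.1 = x.2
      · have h1 : ∀ y ∈ x :: l, y.1 = y.2 := by
          intro y hy
          rcases List.mem_cons.1 hy with rfl | hy
          · exact hxx
          · exact hl y hy
        rw [if_pos h1, if_pos hxx, ← hxx, map_smul, hm, lsc, smul_smul, smul_smul, ← sub_smul]
        congr 1
        push_cast; ring
      · have h1 : ¬ ∀ y ∈ x :: l, y.1 = y.2 := fun h => hxx (h x (by simp))
        rw [if_neg h1, if_neg hxx, map_smul, hs _ _ (lt_of_le_of_ne hx (Ne.symm hxx)), smul_zero, sub_zero]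
    · have h1 : ¬ ∀ y ∈ x :: l, y.1 = y.2 := fun h => hl fun y hy => h y (List.mem_cons_of_mem _ hy)
      rw [if_neg hl, if_neg h1]
      simp

lemma lsc_zero {s : ℤ} {m : Fin N → ℤ} (l : List (Fin N × Fin N)) (h : lsc s m l = 0) :
    ∃ l1 x l2, l = l1 ++ x :: l2 ∧ s - l2.length - m x.1 = 0 := by
  induction l with
  | nil => simp [lsc] at h
  | cons x l ih =>
    rw [lsc, mul_eq_zero] at h
    rcases h with h | h
    · exact ⟨[], x, l, rfl, by exact_mod_cast h⟩
    · obtain ⟨l1, y, l2, h1, h2⟩ := ih h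
      exact ⟨x :: l1, y, l2, by rw [h1]; rfl, h2⟩

/-- List of index pairs of a permutation. -/
def plist (σ : Equiv.Perm (Fin N)) : List (Fin N × Fin N) := List.ofFn fun q => (q, σ q)

lemma plist_split (σ : Equiv.Perm (Fin N)) (l1 l2 : List (Fin N × Fin N)) (x : Fin N × Fin N)
    (h : plist σ = l1 ++ x :: l2) : x.2 = σ x.1 ∧ (x.1 : ℕ) = l1.length ∧ l2.length + l1.length + 1 = N ∧
      ∀ q, x.1 < q → (q, σ q) ∈ l2 := by
  have hlen : l2.length + l1.length + 1 = N := by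
    have := congrArg List.length h
    simp [plist] at this; omega
  have hget : ∀ (k : ℕ) (hk : k < N), (l1 ++ x :: l2)[k]? = some (⟨k, hk⟩, σ ⟨k, hk⟩) := by
    intro k hk
    rw [← h, plist, List.getElem?_ofFn]; simp [hk]
  have h1 := hget l1.length (by omega)
  rw [List.getElem?_append_right le_rfl] at h1
  simp at h1
  refine ⟨by rw [h1], by rw [h1], hlen, fun q hq => ?_⟩
  have h2 := hget q q.2
  have hq' : l1.length < (q : ℕ) := by
    have : (x.1 : ℕ) < q := hq
    rw [h1] at this; exact this
  rw [List.getElem?_append_right hq'.le, show (q : ℕ) - l1.length = ((q : ℕ) - l1.length - 1) + 1 by omega,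
    List.getElem?_cons_succ] at h2
  exact List.mem_of_getElem? h2

lemma exps {z : J → ℂ} {w : M} {m : Fin N → ℤ} (hm : ∀ a, etot e Finset.univ a a w = (m a : ℂ) • w)
    (hs : ∀ a b, a < b → etot e Finset.univ a b w = 0) (hw : w ≠ 0) {F : HolS (Om z) M} {s : ℤ}
    (hF : Asy F.1 s w) (hD : DS e z (Om_not z) F = 0) :
    ∃ a : Fin N, s = m a + ((N : ℤ) - 1 - (a : ℕ)) := by
  classical
  have h1 : Asy (fun u => ∑ σ : Equiv.Perm (Fin N), (((Equiv.Perm.sign σ : ℤˣ) : ℤ) : ℂ) •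
      (((plist σ).map fun x => XX (eS e) (zS z (Om_not z)) dS Finset.univ x.1 x.2).prod F).1 u) (s - N)
      (∑ σ : Equiv.Perm (Fin N), (((Equiv.Perm.sign σ : ℤˣ) : ℤ) : ℂ) • lead e s w (plist σ)) := by
    refine Asy_sum _ fun σ _ => Asy_smul _ ?_
    have := Asy_prod e z hF (plist σ)
    rwa [show ((plist σ).length : ℤ) = N by simp [plist]] at this
  have h2 : (fun u => ∑ σ : Equiv.Perm (Fin N), (((Equiv.Perm.sign σ : ℤˣ) : ℤ) : ℂ) •
      (((plist σ).map fun x => XX (eS e) (zS z (Om_not z)) dS Finset.univ x.1 x.2).prod F).1 u) =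
      fun _ => (0 : M) := by
    ext u
    have h3 := congrArg (fun G => evS u G) hD
    rw [map_zero] at h3
    refine Eq.trans ?_ h3
    rw [DS, DD, rdet, LinearMap.sum_apply, map_sum]
    refine Finset.sum_congr rfl fun σ _ => ?_
    rw [LinearMap.smul_apply, map_zsmul, evS_apply, Int.cast_smul_eq_zsmul, plist, List.map_ofFn]
    rfl
  rw [h2] at h1
  have h3 := Asy_unique h1
  have h4 : ∀ σ : Equiv.Perm (Fin N), lead e s w (plist σ) =
      if ∀ y ∈ plist σ, y.1 = y.2 then lsc s m (plist σ) • w else 0 := by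
    intro σ
    refine lead_sing e hm hs _ fun l1 x l2 h hd => ?_
    obtain ⟨e1, -, -, e2⟩ := plist_split σ l1 l2 x h
    by_contra hlt
    have e3 := hd _ (e2 x.2 (not_le.1 hlt))
    simp only at e3
    rw [e1] at e3
    have e4 := σ.injective e3
    rw [e1, ← e4] at hlt
    exact hlt le_rfl
  rw [Finset.sum_eq_single 1] at h3
  · rw [h4, if_pos (by intro y hy; simp only [plist, List.mem_ofFn] at hy; obtain ⟨q, rfl⟩ := hy; rfl)] at h3
    simp only [Equiv.Perm.sign_one, Units.val_one, Int.cast_one, one_smul] at h3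
    rw [smul_eq_zero] at h3
    obtain ⟨l1, x, l2, e1, e2⟩ := lsc_zero _ (h3.resolve_right hw)
    obtain ⟨-, e3, e4, -⟩ := plist_split 1 l1 l2 x e1
    refine ⟨x.1, ?_⟩
    omega
  · intro σ _ hσ
    rw [h4, if_neg, smul_zero]
    intro hall
    apply hσ
    ext q
    have := hall (q, σ q) (by simp only [plist, List.mem_ofFn]; exact ⟨q, rfl⟩)
    simp only at this
    rw [← this]; rfl
  · simp

end Asym
end GaudinAux

set_option linter.unusedSectionVars false
set_option linter.unusedSimpArgs false
set_option linter.unusedVariables false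
namespace GaudinAux
open Filter Topology

section Fin1
variable {M : Type*} [NormedAddCommGroup M] [NormedSpace ℂ M] [FiniteDimensional ℂ M]

/-- Extension of coefficients by zero. -/
def extc {L : ℕ} (c : Fin L → M) (k : ℕ) : M := if h : k < L then c ⟨k, h⟩ else 0

lemma extc_val {L : ℕ} (c : Fin L → M) (s : Fin L) : extc c s = c s := by
  simp [extc]

lemma pfL_rev {L : ℕ} (c : Fin L → M) (s : Fin L) (hs : ∀ i, s < i → c i = 0) :
    pfL M L c = fun x => ∑ t ∈ Finset.range ((s : ℕ) + 1), x ^ ((s : ℕ) - t) • extc c ((s : ℕ) - t) := by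
  funext x
  have h1 := Finset.sum_range_reflect (fun k => x ^ k • extc c k) ((s : ℕ) + 1)
  simp only [Nat.add_sub_cancel] at h1
  rw [h1, pfL_apply]
  have h2 : ∑ k ∈ Finset.range L, x ^ k • extc c k = ∑ i : Fin L, x ^ (i : ℕ) • c i := by
    rw [Finset.sum_range]
    exact Finset.sum_congr rfl fun i _ => by rw [extc_val]
  rw [← h2]
  symm
  refine Finset.sum_subset (fun k hk => ?_) fun k hk hk' => ?_
  · have := s.2
    simp only [Finset.mem_range] at hk ⊢; omega
  · simp only [Finset.mem_range] at hk hk'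
    have : c ⟨k, hk⟩ = 0 := hs ⟨k, hk⟩ (Fin.lt_def.2 (by show (s : ℕ) < k; omega))
    rw [extc, dif_pos hk, this, smul_zero]

variable {N : ℕ} {J : Type*} [DecidableEq J] [Fintype J]
  (e : J → Fin N → Fin N → Module.End ℂ M) (m : Fin N → ℕ)

/-- The operators cutting out the singular weight space. -/
def sgo (a b : Fin N) : Module.End ℂ M :=
  if a = b then etot e Finset.univ a a - ((m a : ℤ) : ℂ) • 1 else
    if a < b then etot e Finset.univ a b else 0

/-- The singular weight space. -/
def Sg : Submodule ℂ M := ⨅ a, ⨅ b, LinearMap.ker (sgo e m a b)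

lemma mem_Sg {v : M} : v ∈ Sg e m ↔ ∀ a b, sgo e m a b v = 0 := by
  simp [Sg, Submodule.mem_iInf]

lemma Sg_wt {v : M} (h : v ∈ Sg e m) (a : Fin N) :
    etot e Finset.univ a a v = ((m a : ℤ) : ℂ) • v := by
  have := (mem_Sg e m).1 h a a
  rw [sgo, if_pos rfl] at this
  exact sub_eq_zero.1 this

lemma Sg_sing {v : M} (h : v ∈ Sg e m) (a b : Fin N) (hab : a < b) :
    etot e Finset.univ a b v = 0 := by
  have := (mem_Sg e m).1 h a b
  rwa [sgo, if_neg hab.ne, if_pos hab] at this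

variable {e}

lemma etot_eS {U : TopologicalSpace.Opens ℂ} (a b : Fin N) :
    (opS (etot e Finset.univ a b) : Module.End ℂ (HolS U M)) = etot (eS e) Finset.univ a b := by
  rw [etot, map_sum]; rfl

lemma sgo_comm (hG : GLM e) {U : TopologicalSpace.Opens ℂ} (z : J → ℂ) (hz : ∀ j, z j ∉ U)
    (a b : Fin N) : opS (sgo e m a b) * DS e z hz = DS e z hz * opS (sgo e m a b) := by
  unfold sgo
  split_ifs
  · rw [map_sub, etot_eS, sub_mul, mul_sub, map_smul, map_one, smul_mul_assoc, mul_smul_comm,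
      one_mul, mul_one]
    congr 1
    exact DD_etot (GDS hG z hz) _ a a
  · rw [etot_eS]
    exact DD_etot (GDS hG z hz) _ a b
  · rw [map_zero, zero_mul, mul_zero]

lemma Om_infinite (z : J → ℂ) : (Om z : Set ℂ).Infinite := by
  show ((Set.range z)ᶜ : Set ℂ).Infinite
  exact (Set.finite_range z).infinite_compl

lemma opS_dpow {U : TopologicalSpace.Opens ℂ} (A : Module.End ℂ M) (i : ℕ) (F : HolS U M) :
    (dS ^ i) (opS A F) = opS A ((dS ^ i) F) := dpow_hS A i F

/-- Sing-valued functions have Sing-valued jets. -/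
lemma jet_Sg {U : TopologicalSpace.Opens ℂ} (F : HolS U M) (hF : ∀ u ∈ U, F.1 u ∈ Sg e m) (i : ℕ)
    (u : ℂ) : ((dS ^ i) F).1 u ∈ Sg e m := by
  rw [mem_Sg]
  intro a b
  have h1 : opS (sgo e m a b) F = 0 := HolS.ext' fun u hu => by
    rw [opS_apply, (mem_Sg e m).1 (hF u hu) a b]; rfl
  rw [← opS_apply, ← opS_dpow, h1, map_zero]; rfl

/-- A solution with Sing-valued jets is Sing-valued. -/
lemma val_Sg (hG : GLM e) {U : TopologicalSpace.Opens ℂ} (hU : IsPreconnected (U : Set ℂ))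
    {u0 : ℂ} (hu0 : u0 ∈ U) (z : J → ℂ) (hz : ∀ j, z j ∉ U) (F : HolS U M)
    (hD : DS e z hz F = 0) (hj : ∀ i < N, ((dS ^ i) F).1 u0 ∈ Sg e m) (u : ℂ) :
    F.1 u ∈ Sg e m := by
  rw [mem_Sg]
  intro a b
  have h1 : opS (sgo e m a b) F = 0 := by
    refine uniq hU hu0 (e := e) z hz _ ?_ ?_
    · rw [← Module.End.mul_apply, ← sgo_comm m hG, Module.End.mul_apply, hD, map_zero]
    · intro i hi
      rw [opS_dpow, opS_apply]
      exact (mem_Sg e m).1 (hj i hi) a b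
  rw [← opS_apply, h1]; rfl

/-- Restriction of a polynomial. -/
def rP {L : ℕ} (U : TopologicalSpace.Opens ℂ) (c : Fin L → M) : HolS U M :=
  resS (pfL M L c) (PolM_analytic (D := L) ⟨c, rfl⟩ _)

lemma rP_apply {L : ℕ} {U : TopologicalSpace.Opens ℂ} (c : Fin L → M) {u : ℂ} (hu : u ∈ U) :
    (rP U c).1 u = pfL M L c u := resS_apply _ _ hu

lemma rP_iter {L : ℕ} {U : TopologicalSpace.Opens ℂ} (c : Fin L → M) (i : ℕ) {u : ℂ} (hu : u ∈ U) :
    ((dS ^ i) (rP U c)).1 u = iteratedDeriv i (pfL M L c) u := iter_resS _ _ _ hu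

lemma coef_Sg (hG : GLM e) (z : J → ℂ) {u0 : ℂ} (hu0 : u0 ∈ Om z) {L : ℕ} (c : Fin L → M)
    (hD : DS e z (Om_not z) (rP (Om z) c) = 0)
    (hj : ∀ i < N, iteratedDeriv i (pfL M L c) u0 ∈ Sg e m) (i : Fin L) : c i ∈ Sg e m := by
  rw [mem_Sg]
  intro a b
  have h0 := val_Sg m hG (Om_preconn z) hu0 z (Om_not z) _ hD (fun i hi => by
    rw [rP_iter _ _ hu0]; exact hj i hi)
  have h1 : pfL M L (fun i => sgo e m a b (c i)) = 0 := by
    refine PolM_eq_zero' (D := L) ⟨_, rfl⟩ _ (Om_infinite z) fun u hu => ?_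
    have h2 := (mem_Sg e m).1 (h0 u) a b
    rw [rP_apply c hu, pfL_apply, map_sum] at h2
    rw [pfL_apply, ← h2]
    exact Finset.sum_congr rfl fun i _ => by rw [map_smul]
  exact congrFun (pfL_injective L (h1.trans (map_zero _).symm)) i

lemma top_exp (z : J → ℂ) {L : ℕ} (c : Fin L → M) (hc : c ≠ 0)
    (hS : ∀ i, c i ∈ Sg e m) (hD : DS e z (Om_not z) (rP (Om z) c) = 0) :
    ∃ s : Fin L, c s ≠ 0 ∧ (∀ i, s < i → c i = 0) ∧
      ∃ a : Fin N, (s : ℕ) = m a + (N - 1 - (a : ℕ)) := by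
  classical
  obtain ⟨i0, hi0⟩ : ∃ i, c i ≠ 0 := by
    by_contra h; push Not at h; exact hc (funext h)
  let T : Finset (Fin L) := Finset.univ.filter fun i => c i ≠ 0
  have hT : T.Nonempty := ⟨i0, by simp [T, hi0]⟩
  have h1 : T.max' hT ∈ T := Finset.max'_mem _ _
  have h2 : ∀ i, T.max' hT < i → c i = 0 := by
    intro i hi
    by_contra h
    exact absurd (Finset.le_max' T i (by simp [T, h])) (not_le.2 hi)
  set s := T.max' hT
  have h1' : c s ≠ 0 := by simpa [T] using h1
  refine ⟨s, h1', h2, ?_⟩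
  have h3 : Asy (rP (Om z) c).1 ((s : ℕ) : ℤ) (c s) := by
    refine Asy_congr (Asy_pol c s h2) ?_
    filter_upwards [Om_event z] with t ht
    exact rP_apply c ht
  obtain ⟨a, ha⟩ := exps e (m := fun a => (m a : ℤ)) (fun a => Sg_wt e m (hS s) a) (Sg_sing e m (hS s)) h1' h3 hD
  refine ⟨a, ?_⟩
  have := a.2
  omega

variable (e) in
/-- Sing-valued polynomials to holomorphic functions. -/
def sT (z : J → ℂ) (L : ℕ) : (Fin L → Sg e m) →ₗ[ℂ] HolS (Om z) M where
  toFun c := rP (Om z) fun i => (c i : M)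
  map_add' c d := HolS.ext' fun u hu => by
    rw [HolS.add_apply, rP_apply _ hu, rP_apply _ hu, rP_apply _ hu]
    simp [pfL_apply, Finset.sum_add_distrib]
  map_smul' a c := HolS.ext' fun u hu => by
    rw [RingHom.id_apply, HolS.smul_apply, rP_apply _ hu, rP_apply _ hu]
    simp only [pfL_apply, Finset.smul_sum, Pi.smul_apply, Submodule.coe_smul]
    exact Finset.sum_congr rfl fun i _ => smul_comm _ _ _

lemma part1 (hG : GLM e) (z : J → ℂ) (hP : PK e z) (ii : Fin N) (v0 : M) (hv : v0 ∈ Sg e m)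
    (hv0 : v0 ≠ 0) : ∃ (L : ℕ) (c : Fin L → M) (s : Fin L), (∀ i, c i ∈ Sg e m) ∧
      DS e z (Om_not z) (rP (Om z) c) = 0 ∧ (s : ℕ) = m ii + (N - 1 - (ii : ℕ)) ∧ c s = v0 ∧
      ∀ i, s < i → c i = 0 := by
  classical
  obtain ⟨L, hL⟩ := hP
  obtain ⟨u0, hu0⟩ := (Om_dense z).nonempty
  let Sol : Submodule ℂ (Fin L → Sg e m) := LinearMap.ker (DS e z (Om_not z) ∘ₗ sT e m z L)
  let jet : Sol →ₗ[ℂ] (Fin N → M) :=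
    { toFun := fun x i => ((dS ^ (i : ℕ)) (sT e m z L x.1)).1 u0
      map_add' := fun x y => by
        ext i
        simp only [Submodule.coe_add, map_add]; rfl
      map_smul' := fun a x => by
        ext i
        simp only [Submodule.coe_smul, map_smul]; rfl }
  let ι : (Fin N → Sg e m) →ₗ[ℂ] (Fin N → M) :=
    LinearMap.pi fun i => (Sg e m).subtype ∘ₗ LinearMap.proj i
  have hι : Function.Injective ι := by
    intro x y h
    ext i
    exact congrFun h i
  have hr : LinearMap.range ι ≤ LinearMap.range jet := by
    rintro _ ⟨x, rfl⟩
    obtain ⟨f, ⟨c, rfl⟩, hD, hj⟩ := hL u0 hu0 (fun i => (x i : M))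
    have hcS := coef_Sg m hG z hu0 c hD (fun i hi => by
      have := hj ⟨i, hi⟩
      simp only at this
      rw [this]; exact (x _).2)
    refine ⟨⟨fun i => ⟨c i, hcS i⟩, hD⟩, ?_⟩
    ext i
    exact (rP_iter c i hu0).trans (hj i)
  have hdim : Module.finrank ℂ (Fin N → Sg e m) ≤ Module.finrank ℂ Sol := by
    rw [← LinearMap.finrank_range_of_inj hι]
    exact (Submodule.finrank_mono hr).trans (LinearMap.finrank_range_le jet)
  let Ψ : Sol →ₗ[ℂ] (Fin N → Sg e m) :=
    { toFun := fun x a => if h : m a + (N - 1 - (a : ℕ)) < L then x.1 ⟨_, h⟩ else 0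
      map_add' := fun x y => by
        ext a
        by_cases h : m a + (N - 1 - (a : ℕ)) < L <;> simp [h]
      map_smul' := fun r x => by
        ext a
        by_cases h : m a + (N - 1 - (a : ℕ)) < L <;> simp [h] }
  have htop : ∀ x : Sol, x ≠ 0 → ∃ s : Fin L, x.1 s ≠ 0 ∧ (∀ i, s < i → x.1 i = 0) ∧
      ∃ a : Fin N, (s : ℕ) = m a + (N - 1 - (a : ℕ)) ∧ Ψ x a = x.1 s := by
    intro x hx
    obtain ⟨s, h1, h2, a, ha⟩ := top_exp m z (fun i => (x.1 i : M)) (fun h => hx (by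
      apply Subtype.ext; funext i; exact Subtype.ext (congrFun h i))) (fun i => (x.1 i).2) x.2
    refine ⟨s, fun h => h1 (by rw [h]; rfl), fun i hi => Subtype.ext (h2 i hi), a, ha, ?_⟩
    show (if h : m a + (N - 1 - (a : ℕ)) < L then x.1 ⟨_, h⟩ else 0) = x.1 s
    have hs : m a + (N - 1 - (a : ℕ)) < L := ha ▸ s.2
    rw [dif_pos hs]
    exact congrArg x.1 (Fin.ext ha.symm)
  have hinj : Function.Injective Ψ := by
    rw [← LinearMap.ker_eq_bot, LinearMap.ker_eq_bot']
    intro x hx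
    by_contra h
    obtain ⟨s, h1, _, a, _, h3⟩ := htop x h
    rw [hx] at h3
    exact h1 h3.symm
  have hsurj : Function.Surjective Ψ :=
    (LinearMap.injective_iff_surjective_of_finrank_eq_finrank
      (le_antisymm (LinearMap.finrank_le_finrank_of_injective hinj) hdim)).1 hinj
  obtain ⟨x, hx⟩ := hsurj (Pi.single ii ⟨v0, hv⟩)
  have hx0 : x ≠ 0 := by
    rintro rfl
    have := congrFun hx ii
    rw [map_zero, Pi.single_eq_same] at this
    exact hv0 (congrArg Subtype.val this).symm
  obtain ⟨s, h1, h2, a, ha, h3⟩ := htop x hx0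
  have haii : a = ii := by
    by_contra h
    rw [hx, Pi.single_eq_of_ne h] at h3
    exact h1 h3.symm
  subst haii
  rw [hx, Pi.single_eq_same] at h3
  exact ⟨L, fun i => (x.1 i : M), s, fun i => (x.1 i).2, x.2, ha, (congrArg Subtype.val h3).symm,
    fun i hi => by show (x.1 i : M) = 0; rw [h2 i hi]; rfl⟩

/-- Jets realized with Sing coefficients. -/
lemma part2 (hG : GLM e) (z : J → ℂ) (hP : PK e z) {u0 : ℂ} (hu0 : u0 ∈ Om z) (w : Fin N → M)
    (hw : ∀ i, w i ∈ Sg e m) : ∃ (L : ℕ) (c : Fin L → M), (∀ i, c i ∈ Sg e m) ∧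
      DS e z (Om_not z) (rP (Om z) c) = 0 ∧ ∀ i : Fin N, iteratedDeriv i (pfL M L c) u0 = w i := by
  obtain ⟨L, hL⟩ := hP
  obtain ⟨f, ⟨c, rfl⟩, hD, hj⟩ := hL u0 hu0 w
  exact ⟨L, c, coef_Sg m hG z hu0 c hD (fun i hi => by
      have := hj ⟨i, hi⟩
      simp only at this
      rw [this]; exact hw _), hD, hj⟩

end Fin1

section Model
open GaudinModel
variable {N n : ℕ} (V : Fin n → Type*) [∀ i, AddCommGroup (V i)] [∀ i, Module ℂ (V i)]
  (M : Type*) [NormedAddCommGroup M] [NormedSpace ℂ M] [FiniteDimensional ℂ M]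
  (E : ∀ i : Fin n, Fin N → Fin N → (V i →ₗ[ℂ] V i))
  (φ : M ≃ₗ[ℂ] PiTensorProduct ℂ V)

lemma Sg_eq (m : Fin N → ℕ) : SingWt V M E φ (fun b => (m b : ℤ)) = Sg (EE V M E φ) m := by
  ext v
  rw [mem_Sg]
  simp only [SingWt, Wt, Submodule.mem_inf, Submodule.mem_iInf, LinearMap.mem_ker]
  constructor
  · rintro ⟨h1, h2⟩ a b
    unfold sgo
    split_ifs with h3 h4
    · exact h1 a
    · exact h2 a b h4
    · rfl
  · intro h
    constructor
    · intro a
      have := h a a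
      rwa [sgo, if_pos rfl] at this
    · intro a b hab
      exact Sg_sing (EE V M E φ) m ((mem_Sg _ _).2 h) a b hab

lemma bridge_list {U : TopologicalSpace.Opens ℂ} (z : Fin n → ℂ) (hz : ∀ j, z j ∉ U) (F : HolS U M)
    (f : ℂ → M) (hf : ∀ u ∈ U, f u = F.1 u) (l : List (Fin N × Fin N)) :
    ∀ u ∈ U, ((l.map fun x => Xg V M E φ z (0 : Matrix (Fin N) (Fin N) ℂ) x.1 x.2).foldr (· ∘ ·) id) f u
      = ((l.map fun x => XX (eS (EE V M E φ)) (zS z hz) dS Finset.univ x.1 x.2).prod F).1 u := by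
  induction l with
  | nil => exact hf
  | cons x l ih =>
    intro u hu
    rw [List.map_cons, List.map_cons, List.prod_cons, List.foldr_cons, Module.End.mul_apply,
      XX_apply _ _ _ _ _ _ hu]
    simp only [Function.comp, Xg]
    rw [ih u hu, (HolS.eventuallyEq (M := M) ih hu).deriv_eq]
    simp

lemma bridge {U : TopologicalSpace.Opens ℂ} (z : Fin n → ℂ) (hz : ∀ j, z j ∉ U) (F : HolS U M)
    (f : ℂ → M) (hf : ∀ u ∈ U, f u = F.1 u) {u : ℂ} (hu : u ∈ U) :
    Dg V M E φ z (0 : Matrix (Fin N) (Fin N) ℂ) f u = (DS (EE V M E φ) z hz F).1 u := by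
  rw [← evS_apply]
  simp only [DS, DD, rdet, Dg, LinearMap.sum_apply, map_sum]
  refine Finset.sum_congr rfl fun σ _ => ?_
  rw [LinearMap.smul_apply, map_zsmul, evS_apply]
  congr 1
  have := bridge_list V M E φ z hz F f hf (List.ofFn fun a : Fin N => (a, σ a)) u hu
  simpa only [List.map_ofFn, Function.comp_def] using this

end Model
end GaudinAux



namespace GaudinModel

/-- Assume `K = 0`.  For every `i` (encoded by `ii : Fin N`,
`i = ii + 1`) and every nonzero `v₀ ∈ sing M[m]` there is a polynomial
`v₀ u^{m_i+N−i} + v₁ u^{m_i+N−i−1} + … + v_{m_i+N−i}` with all `v_t ∈ sing M[m]`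
annihilated by `D_{K=0,M}(u,∂)` away from `z_1,…,z_n`; moreover every holomorphic solution
of `D_{K=0,M} f = 0` with values in `sing M[m]` on a simply connected open subset of
`ℂ∖{z_1,…,z_n}` is a `ℂ`-linear combination of restrictions of such polynomials. -/
theorem statement_18
    {N n : ℕ} (hN : 2 ≤ N) (hn : 1 ≤ n)
    (V : Fin n → Type*) [∀ i, AddCommGroup (V i)] [∀ i, Module ℂ (V i)]
    [∀ i, FiniteDimensional ℂ (V i)]
    (M : Type*) [NormedAddCommGroup M] [NormedSpace ℂ M] [FiniteDimensional ℂ M]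
    (Λ : Fin n → Fin N → ℤ)
    (hdom : ∀ i, ∀ a b : Fin N, a ≤ b → Λ i b ≤ Λ i a)
    (hpoly : ∀ i a, 0 ≤ Λ i a)
    (hlast : ∀ i, Λ i ⟨N - 1, by omega⟩ = 0)
    (E : ∀ i : Fin n, Fin N → Fin N → (V i →ₗ[ℂ] V i))
    (hrel : GlRel V E)
    (hhw : IsHW V E Λ)
    (φ : M ≃ₗ[ℂ] PiTensorProduct ℂ V)
    (z : Fin n → ℂ) (hz : Function.Injective z)
    (m : Fin N → ℕ) :
    -- for every `i` and nonzero `v₀ ∈ sing M[m]` there is a polynomial solution of degree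
    -- `m_i + N − i` with leading coefficient `v₀`
    (∀ ii : Fin N, ∀ v0 ∈ SingWt V M E φ (fun b => (m b : ℤ)), v0 ≠ 0 →
      ∃ v : ℕ → M, (∀ t, v t ∈ SingWt V M E φ (fun b => (m b : ℤ))) ∧ v 0 = v0 ∧
        ∀ u : ℂ, GoodG z u →
          Dg V M E φ z (0 : Matrix (Fin N) (Fin N) ℂ)
            (fun x => ∑ t ∈ Finset.range (m ii + (N - 1 - (ii : ℕ)) + 1),
              (x ^ (m ii + (N - 1 - (ii : ℕ)) - t)) • v t) u = 0) ∧
    -- every `sing M[m]`-valued holomorphic solution on a simply connected open subset of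
    -- `ℂ∖{z_1,…,z_n}` is a `ℂ`-linear combination of such polynomials
    (∀ U : Set ℂ, IsOpen U → (∀ j, z j ∉ U) → SimplyConnectedSpace U →
      ∀ f : ℂ → M, DifferentiableOn ℂ f U →
        (∀ u ∈ U, f u ∈ SingWt V M E φ (fun b => (m b : ℤ))) →
        (∀ u ∈ U, Dg V M E φ z (0 : Matrix (Fin N) (Fin N) ℂ) f u = 0) →
        ∃ (r : ℕ) (c : Fin r → ℂ) (G : Fin r → ℂ → M),
          (∀ t, ∃ (ii : Fin N) (v : ℕ → M),
            (∀ s, v s ∈ SingWt V M E φ (fun b => (m b : ℤ))) ∧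
            G t = fun x => ∑ s ∈ Finset.range (m ii + (N - 1 - (ii : ℕ)) + 1),
              (x ^ (m ii + (N - 1 - (ii : ℕ)) - s)) • v s) ∧
          (∀ t, ∀ u : ℂ, GoodG z u →
            Dg V M E φ z (0 : Matrix (Fin N) (Fin N) ℂ) (G t) u = 0) ∧
          (∀ u ∈ U, f u = ∑ t, c t • G t u)) := by
  have hG := GaudinAux.EE_glm V M E φ hrel
  have hP := GaudinAux.PK_EE V M E φ (by omega) Λ hdom hpoly hrel hhw z
  rw [GaudinAux.Sg_eq V M E φ m]
  have hOm : ∀ u, GoodG z u → u ∈ GaudinAux.Om z := by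
    rintro u hu ⟨j, rfl⟩
    exact hu j rfl
  have hsol : ∀ {L : ℕ} (c : Fin L → M),
      GaudinAux.DS (EE V M E φ) z (GaudinAux.Om_not z) (GaudinAux.rP (GaudinAux.Om z) c) = 0 →
      ∀ u, u ∈ GaudinAux.Om z →
      Dg V M E φ z (0 : Matrix (Fin N) (Fin N) ℂ) (GaudinAux.pfL M L c) u = 0 := by
    intro L c hD u hu
    rw [GaudinAux.bridge V M E φ z (GaudinAux.Om_not z) (GaudinAux.rP (GaudinAux.Om z) c) _
      (fun u hu => (GaudinAux.rP_apply c hu).symm) hu, hD]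
    rfl
  have hext : ∀ {L : ℕ} (c : Fin L → M), (∀ i, c i ∈ GaudinAux.Sg (EE V M E φ) m) →
      ∀ k, GaudinAux.extc c k ∈ GaudinAux.Sg (EE V M E φ) m := by
    intro L c hc k
    unfold GaudinAux.extc
    split_ifs
    · exact hc _
    · exact Submodule.zero_mem _
  constructor
  · intro ii v0 hv hv0
    obtain ⟨L, c, s, hcS, hD, hs, hcs, htop⟩ := GaudinAux.part1 m hG z hP ii v0 hv hv0
    refine ⟨fun t => GaudinAux.extc c ((s : ℕ) - t), fun t => hext c hcS _, ?_, fun u hu => ?_⟩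
    · show GaudinAux.extc c (s : ℕ) = v0
      rw [GaudinAux.extc_val, hcs]
    · rw [← hs]
      have h1 := hsol c hD u (hOm u hu)
      rwa [GaudinAux.pfL_rev c s htop] at h1
  · intro U hUo hzU hUs f hf hfS hfD
    have := FiniteDimensional.complete ℂ M
    have hpc : IsPathConnected U := by
      have : PathConnectedSpace U := inferInstance
      exact isPathConnected_iff_pathConnectedSpace.2 this
    have hpre : IsPreconnected U := hpc.isConnected.isPreconnected
    obtain ⟨u0, hu0⟩ := hpc.nonempty
    let UU : TopologicalSpace.Opens ℂ := ⟨U, hUo⟩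
    have hzU' : ∀ j, z j ∉ UU := hzU
    have hUOm : ∀ u ∈ UU, u ∈ GaudinAux.Om z := by
      rintro u hu ⟨j, rfl⟩
      exact hzU j hu
    have hfa : AnalyticOnNhd ℂ f (UU : Set ℂ) := hf.analyticOnNhd hUo
    let F : GaudinAux.HolS UU M := GaudinAux.resS f hfa
    have hFf : ∀ u ∈ UU, F.1 u = f u := fun u hu => GaudinAux.resS_apply f hfa hu
    have hFS : ∀ u ∈ UU, F.1 u ∈ GaudinAux.Sg (EE V M E φ) m := by
      intro u hu
      rw [hFf u hu]; exact hfS u hu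
    obtain ⟨L, c, hcS, hD, hj⟩ := GaudinAux.part2 m hG z hP (hUOm u0 hu0)
      (fun i => ((GaudinAux.dS ^ (i : ℕ)) F).1 u0) (fun i => GaudinAux.jet_Sg m F hFS i u0)
    have hFc : F - GaudinAux.rP UU c = 0 := by
      refine GaudinAux.uniq (U := UU) hpre hu0 (e := EE V M E φ) z hzU' _ ?_ ?_
      · rw [map_sub]
        refine GaudinAux.HolS.ext' fun u hu => ?_
        rw [GaudinAux.HolS.sub_apply,
          ← GaudinAux.bridge V M E φ z hzU' F f (fun u hu => (hFf u hu).symm) hu,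
          ← GaudinAux.bridge V M E φ z hzU' (GaudinAux.rP UU c) (GaudinAux.pfL M L c)
            (fun u hu => (GaudinAux.rP_apply c hu).symm) hu,
          hfD u hu, hsol c hD u (hUOm u hu), sub_zero]
        rfl
      · intro i hi
        rw [map_sub, GaudinAux.HolS.sub_apply, GaudinAux.rP_iter c i hu0]
        exact sub_eq_zero.2 (hj ⟨i, hi⟩).symm
    have hfc : ∀ u ∈ U, f u = GaudinAux.pfL M L c u := by
      intro u hu
      have h1 : F = GaudinAux.rP UU c := sub_eq_zero.1 hFc
      rw [← hFf u hu, h1]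
      exact GaudinAux.rP_apply c hu
    by_cases hc : c = 0
    · refine ⟨0, fun i => 0, fun i _ => 0, fun t => t.elim0, fun t => t.elim0, fun u hu => ?_⟩
      rw [hfc u hu, hc]
      simp
    · obtain ⟨s, h1, h2, a, ha⟩ := GaudinAux.top_exp m z c hc hcS hD
      refine ⟨1, fun _ => 1, fun _ => GaudinAux.pfL M L c, fun t => ⟨a,
        fun t => GaudinAux.extc c ((s : ℕ) - t), fun t => hext c hcS _, ?_⟩,
        fun t u hu => hsol c hD u (hOm u hu), fun u hu => ?_⟩
      · rw [← ha]; exact GaudinAux.pfL_rev c s h2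
      · simp [hfc u hu]


end GaudinModel
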